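/- For all n,d ∈ ℕ: if n ≥ 2, d ≥ 2 and (n,d) ≠ (2,2), then the cone P_{n,2d} of nonnegative polynomials has no ((𝒮₊ᵏ)^m)-lift for any k,m ∈ ℕ (i.e. sxdeg(P_{n,2d}) = sxc(P_{n,2d}) = ∞); otherwise (i.e. if n = 1, or d = 1, or (n,d) = (2,2)), sxdeg(P_{n,2d}) = sxc(P_{n,2d}) = C(n+d,n). -/

import Mathlib

open MvPolynomial

/-- The cone of `m`-tuples of `k × k` real positive semidefinite matrices, `(𝒮₊ᵏ)^m`. -/
def PSDTuple (k m : ℕ) : Set (Fin m → Matrix (Fin k) (Fin k) ℝ) :=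
  {A | ∀ i, (A i).PosSemidef}

/-- The cone `𝒮₊ᵏ` of `k × k` real positive semidefinite matrices. -/
def PSDCone (k : ℕ) : Set (Matrix (Fin k) (Fin k) ℝ) :=
  {A | A.PosSemidef}

/-- `S ⊆ V` has a `K`-lift if `S = π(K ∩ H)` for an affine subspace `H` and a linear map `π`. -/
def HasLift {W V : Type*} [AddCommGroup W] [Module ℝ W] [AddCommGroup V] [Module ℝ V]
    (K : Set W) (S : Set V) : Prop :=
  ∃ (H : AffineSubspace ℝ W) (p : W →ₗ[ℝ] V), S = p '' (K ∩ (H : Set W))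

/-- Semidefinite extension degree: the smallest `k` such that `S` has an `(𝒮₊ᵏ)^m`-lift
for some finite `m` (`⊤` if there is no such `k`). -/
noncomputable def sxdeg {V : Type*} [AddCommGroup V] [Module ℝ V] (S : Set V) : ℕ∞ :=
  sInf {c : ℕ∞ | ∃ k m : ℕ, c = (k : ℕ∞) ∧ HasLift (PSDTuple k m) S}

/-- Semidefinite extension complexity: the smallest `k` such that `S` has an `𝒮₊ᵏ`-lift. -/
noncomputable def sxc {V : Type*} [AddCommGroup V] [Module ℝ V] (S : Set V) : ℕ∞ :=
  sInf {c : ℕ∞ | ∃ k : ℕ, c = (k : ℕ∞) ∧ HasLift (PSDCone k) S}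

/-- Coefficient embedding of polynomials into the product space `(Fin n →₀ ℕ) → ℝ`;
used to express topological notions (closedness) for sets of polynomials. -/
noncomputable def coeffMap (n : ℕ) : MvPolynomial (Fin n) ℝ →ₗ[ℝ] ((Fin n →₀ ℕ) → ℝ) where
  toFun f := fun a => coeff a f
  map_add' := by intros; funext; simp
  map_smul' := by intros; funext; simp

/-- `Σ_{n,2d}`: sums of squares of polynomials, of degree at most `2d`, in `n` variables. -/
def SOSCone (n d : ℕ) : Set (MvPolynomial (Fin n) ℝ) :=
  {f | f.totalDegree ≤ 2 * d ∧
    ∃ (r : ℕ) (g : Fin r → MvPolynomial (Fin n) ℝ), f = ∑ i, g i ^ 2}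

/-- `P_{n,2d}(X)`: polynomials of degree at most `2d` that are nonnegative on `X`. -/
def PosCone (n d : ℕ) (X : Set (Fin n → ℝ)) : Set (MvPolynomial (Fin n) ℝ) :=
  {f | f.totalDegree ≤ 2 * d ∧ ∀ x ∈ X, 0 ≤ MvPolynomial.eval x f}

/-- The vector `v_{n,d}(x) = (x^α)_{|α| ≤ d}` of all monomials of degree at most `d`
evaluated at `x`, regarded inside the coordinate space `(Fin n →₀ ℕ) → ℝ`. -/
noncomputable def monVec (n d : ℕ) (x : Fin n → ℝ) : (Fin n →₀ ℕ) → ℝ :=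
  fun a => if (a.sum fun _ e => e) ≤ d then ∏ i, x i ^ a i else 0

/-- The convex conic hull: all finite nonnegative combinations of elements of `s`. -/
def coneHull {V : Type*} [AddCommGroup V] [Module ℝ V] (s : Set V) : Set V :=
  {y | ∃ (r : ℕ) (c : Fin r → ℝ) (v : Fin r → V),
    (∀ i, 0 ≤ c i) ∧ (∀ i, v i ∈ s) ∧ y = ∑ i, c i • v i}

open scoped IntermediateField.algebraAdjoinAdjoin in
/-- A transcendence basis of a field extension in characteristic zero can be moved arbitrarily
in an adically complete ring, compatibly with a given residue map. -/
theorem exists_ringHom_of_isTranscendenceBasis {K L S ι : Type*} [Field K] [Field L] [CharZero K]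
    [Algebra K L] [CommRing S] {I : Ideal S} [IsAdicComplete I S] {v : ι → L}
    (hv : IsTranscendenceBasis K v) (g : MvPolynomial ι K →+* S) (f : L →+* S ⧸ I)
    (hgf : ∀ p, f (MvPolynomial.aeval v p) = Ideal.Quotient.mk I (g p)) :
    ∃ φ : L →+* S, ∀ p, φ (MvPolynomial.aeval v p) = g p := by
  let A := Algebra.adjoin K (Set.range v)
  let F := IntermediateField.adjoin K (Set.range v)
  let e : MvPolynomial ι K ≃ₐ[K] A := hv.1.aevalEquiv
  have : Algebra.IsAlgebraic F L := hv.isAlgebraic_field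
  have : Algebra.FormallyEtale F L := Algebra.FormallyEtale.of_isSeparable _ L
  have : Algebra.FormallyEtale A F := .of_isLocalization (nonZeroDivisors _)
  have : Algebra.FormallySmooth A L := .comp A F L
  let G : A →+* S := g.comp (e.symm : A →+* MvPolynomial ι K)
  algebraize [G]
  let f' : L →ₐ[A] S ⧸ I :=
    { f with
      commutes' := fun a => by
        obtain ⟨p, rfl⟩ := e.surjective a
        have h1 : algebraMap A L (e p) = MvPolynomial.aeval v p := hv.1.algebraMap_aevalEquiv p
        have h2 : algebraMap A (S ⧸ I) (e p) = Ideal.Quotient.mk I (G (e p)) := rfl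
        change f _ = _
        rw [h1, h2, hgf]
        simp [G] }
  obtain ⟨φ, -⟩ := Algebra.FormallySmooth.exists_mkₐ_comp_eq_of_isAdicComplete f'
  refine ⟨φ, fun p => ?_⟩
  have h1 : algebraMap A L (e p) = MvPolynomial.aeval v p := hv.1.algebraMap_aevalEquiv p
  have h2 := φ.commutes (e p)
  rw [h1] at h2
  have h3 : algebraMap A S (e p) = g p := by
    change G (e p) = _
    simp [G]
  exact h2.trans h3

open Cardinal in
/-- A generic point of `ℝⁿ` over a countable set of scalars can be formally moved. -/
theorem exists_generic_formal_translation (n : ℕ) (s : Set ℝ) (hs : s.Countable) :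
    ∃ (x : Fin n → ℝ) (φ : ℝ →+* MvPowerSeries (Fin n) ℝ),
      (∀ a ∈ s, φ a = MvPowerSeries.C a) ∧
      ∀ i, φ (x i) = MvPowerSeries.C (x i) + MvPowerSeries.X i := by
  classical
  let k := IntermediateField.adjoin ℚ s
  obtain ⟨b, hb⟩ := exists_isTranscendenceBasis k ℝ
  have hk : #k ≤ ℵ₀ := by
    refine (IntermediateField.cardinalMk_adjoin_le ℚ s).trans ?_
    simp [hs.le_aleph0]
  have hinf : Infinite b := by
    by_contra hfin
    rw [not_infinite_iff_finite] at hfin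
    have := hb.isAlgebraic_field
    have h1 := Algebra.IsAlgebraic.cardinalMk_le_max
      (IntermediateField.adjoin k (Set.range (Subtype.val : b → ℝ))) ℝ
    have h2 := IntermediateField.cardinalMk_adjoin_le k (Set.range (Subtype.val : b → ℝ))
    have h4 : #ℝ ≤ ℵ₀ := h1.trans (max_le (h2.trans (by simp [hk])) le_rfl)
    rw [mk_real] at h4
    exact absurd h4 (not_le.2 aleph0_lt_continuum)
  obtain ⟨e⟩ : Nonempty (Fin n ↪ b) := ⟨(Fin.valEmbedding).trans (Infinite.natEmbedding b)⟩
  let x : Fin n → ℝ := fun i => e i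
  let I : Ideal (MvPowerSeries (Fin n) ℝ) := .span (.range MvPowerSeries.X)
  let f : ℝ →+* MvPowerSeries (Fin n) ℝ ⧸ I := (Ideal.Quotient.mk I).comp MvPowerSeries.C
  let δ : b → MvPowerSeries (Fin n) ℝ := fun t => ∑ i, if e i = t then MvPowerSeries.X i else 0
  let g : MvPolynomial b k →+* MvPowerSeries (Fin n) ℝ :=
    MvPolynomial.eval₂Hom (MvPowerSeries.C.comp (algebraMap k ℝ))
      (fun t => MvPowerSeries.C (t : ℝ) + δ t)
  have hδ : ∀ t, δ t ∈ I := fun t => Ideal.sum_mem _ fun i _ => by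
    split_ifs
    · exact Ideal.subset_span ⟨i, rfl⟩
    · exact I.zero_mem
  obtain ⟨φ, hφ⟩ := exists_ringHom_of_isTranscendenceBasis (I := I) hb g f (by
    intro p
    have : f.comp (MvPolynomial.aeval (R := k) (Subtype.val : b → ℝ)).toRingHom =
        (Ideal.Quotient.mk I).comp g := by
      refine MvPolynomial.ringHom_ext ?_ ?_
      · intro r
        simp [f, g]
      · intro t
        simp [f, g, Ideal.Quotient.eq_zero_iff_mem.2 (hδ t)]
    exact RingHom.congr_fun this p)
  refine ⟨x, φ, fun a ha => ?_, fun i => ?_⟩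
  · have := hφ (MvPolynomial.C ⟨a, IntermediateField.subset_adjoin ℚ s ha⟩)
    simpa [g, IntermediateField.algebraMap_apply] using this
  · have := hφ (MvPolynomial.X (e i))
    simpa [g, δ, x] using this

open scoped MatrixOrder ComplexOrder in
theorem Matrix.PosSemidef.exists_eq_transpose_mul_self {ι : Type*} [Fintype ι]
    {B : Matrix ι ι ℝ} (hB : B.PosSemidef) : ∃ M : Matrix ι ι ℝ, B = M.transpose * M := by
  classical
  obtain ⟨M, hM⟩ := CStarAlgebra.nonneg_iff_eq_star_mul_self.mp hB.nonneg
  exact ⟨M, by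
    simpa [Matrix.star_eq_conjTranspose, Matrix.conjTranspose_eq_transpose_of_trivial] using hM⟩

theorem Matrix.dotProduct_transpose_mul_mulVec {ι κ : Type*} [Fintype ι] [Fintype κ]
    (M : Matrix κ ι ℝ) (v w : ι → ℝ) :
    v ⬝ᵥ (M.transpose * M).mulVec w = M.mulVec v ⬝ᵥ M.mulVec w := by
  rw [← Matrix.mulVec_mulVec, Matrix.dotProduct_mulVec, Matrix.vecMul_transpose]

theorem Matrix.posSemidef_real_iff {ι : Type*} [Fintype ι] {A : Matrix ι ι ℝ} :
    A.PosSemidef ↔ A.transpose = A ∧ ∀ v, 0 ≤ v ⬝ᵥ A.mulVec v := by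
  rw [Matrix.posSemidef_iff_dotProduct_mulVec, Matrix.IsHermitian,
    Matrix.conjTranspose_eq_transpose_of_trivial]
  simp

theorem Matrix.PosSemidef.dotProduct_mulVec_eq_zero_iff {ι : Type*} [Fintype ι]
    {A : Matrix ι ι ℝ} (hA : A.PosSemidef) (v : ι → ℝ) : v ⬝ᵥ A.mulVec v = 0 ↔ A.mulVec v = 0 := by
  simpa using hA.dotProduct_mulVec_zero_iff v

theorem Matrix.posSemidef_transpose_mul_self {ι κ : Type*} [Fintype ι] [Fintype κ]
    (M : Matrix κ ι ℝ) : (M.transpose * M).PosSemidef := by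
  simpa [Matrix.conjTranspose_eq_transpose_of_trivial] using
    Matrix.posSemidef_conjTranspose_mul_self M

/-- Every square matrix over a field has a generalized inverse. -/
theorem Matrix.exists_mul_mul_eq {ι : Type*} [Fintype ι] [DecidableEq ι] (G : Matrix ι ι ℝ) :
    ∃ Y : Matrix ι ι ℝ, G * Y * G = G := by
  let f := Matrix.toLin' G
  obtain ⟨g, hg⟩ := LinearMap.exists_rightInverse_of_surjective f.rangeRestrict
    f.range_rangeRestrict
  obtain ⟨g', hg'⟩ := LinearMap.exists_extend g
  refine ⟨LinearMap.toMatrix' g', Matrix.toLin'.injective ?_⟩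
  rw [Matrix.toLin'_mul, Matrix.toLin'_mul, Matrix.toLin'_toMatrix']
  refine LinearMap.ext fun v => ?_
  have h1 : g' (f v) = g (f.rangeRestrict v) := by rw [← hg']; rfl
  have h2 := congrArg Subtype.val (LinearMap.congr_fun hg (f.rangeRestrict v))
  simp only [LinearMap.comp_apply]
  change f (g' (f _)) = f _
  rw [h1]
  exact h2

/-- A nonempty midpoint-convex family of tuples of positive semidefinite matrices has a member
whose kernels are minimal. -/
theorem exists_ker_minimal {κ ι : Type*} [Fintype κ] [Fintype ι]
    (F : Set (κ → Matrix ι ι ℝ)) (hne : F.Nonempty) (hpsd : ∀ Z ∈ F, ∀ i, (Z i).PosSemidef)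
    (hmid : ∀ Z ∈ F, ∀ Z' ∈ F, (1 / 2 : ℝ) • (Z + Z') ∈ F) :
    ∃ Z₀ ∈ F, ∀ Z ∈ F, ∀ i v, (Z₀ i).mulVec v = 0 → (Z i).mulVec v = 0 := by
  classical
  let r : (κ → Matrix ι ι ℝ) → ℕ := fun Z => ∑ i, Module.finrank ℝ (LinearMap.ker (Z i).mulVecLin)
  obtain ⟨Z₀, hZ₀, hmin⟩ := exists_minimalFor_of_wellFoundedLT (fun Z => Z ∈ F) r hne
  refine ⟨Z₀, hZ₀, fun Z hZ i v hv => ?_⟩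
  set W := (1 / 2 : ℝ) • (Z₀ + Z) with hW
  have hker : ∀ i v, (W i).mulVec v = 0 → (Z₀ i).mulVec v = 0 ∧ (Z i).mulVec v = 0 := by
    intro i v hv
    have h1 := congrArg (fun w => v ⬝ᵥ w) hv
    simp only [hW, Pi.smul_apply, Pi.add_apply, Matrix.smul_mulVec, Matrix.add_mulVec,
      dotProduct_smul, dotProduct_add, dotProduct_zero, smul_eq_mul] at h1
    have h2 := (Matrix.posSemidef_real_iff.1 (hpsd _ hZ₀ i)).2 v
    have h3 := (Matrix.posSemidef_real_iff.1 (hpsd _ hZ i)).2 v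
    exact ⟨((hpsd _ hZ₀ i).dotProduct_mulVec_eq_zero_iff v).1 (by linarith),
      ((hpsd _ hZ i).dotProduct_mulVec_eq_zero_iff v).1 (by linarith)⟩
  have hle : ∀ i, LinearMap.ker (W i).mulVecLin ≤ LinearMap.ker (Z₀ i).mulVecLin := by
    intro i v hv
    simp only [LinearMap.mem_ker, Matrix.mulVecLin_apply] at hv ⊢
    exact (hker i v hv).1
  have hfin : ∀ i, Module.finrank ℝ (LinearMap.ker (W i).mulVecLin)
      ≤ Module.finrank ℝ (LinearMap.ker (Z₀ i).mulVecLin) := fun i => Submodule.finrank_mono (hle i)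
  have hr : r Z₀ ≤ r W := hmin (hmid _ hZ₀ _ hZ) (Finset.sum_le_sum fun i _ => hfin i)
  have heq := (Finset.sum_eq_sum_iff_of_le fun i _ => hfin i).1
    (le_antisymm (Finset.sum_le_sum fun i _ => hfin i) hr) i (Finset.mem_univ i)
  have hker' := Submodule.eq_of_le_of_finrank_eq (hle i) heq
  have hv' : v ∈ LinearMap.ker (W i).mulVecLin := by
    rw [hker']
    simpa using hv
  exact (hker i v (by simpa using hv')).2

theorem Matrix.exists_abs_dotProduct_mulVec_le {ι : Type*} [Fintype ι] (C : Matrix ι ι ℝ) :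
    ∃ R : ℝ, 0 ≤ R ∧ ∀ v : ι → ℝ, |v ⬝ᵥ C.mulVec v| ≤ R * (v ⬝ᵥ v) := by
  refine ⟨∑ i, ∑ j, |C i j|, Finset.sum_nonneg fun i _ => Finset.sum_nonneg fun j _ =>
    abs_nonneg _, fun v => ?_⟩
  have hvv : ∀ i, v i ^ 2 ≤ v ⬝ᵥ v := fun i => by
    rw [dotProduct, sq]
    exact Finset.single_le_sum (f := fun i => v i * v i) (fun i _ => mul_self_nonneg _)
      (Finset.mem_univ i)
  have hsum : v ⬝ᵥ C.mulVec v = ∑ i, v i * ∑ j, C i j * v j := rfl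
  rw [hsum, Finset.sum_mul]
  refine (Finset.abs_sum_le_sum_abs _ _).trans (Finset.sum_le_sum fun i _ => ?_)
  rw [Finset.sum_mul, Finset.mul_sum]
  refine (Finset.abs_sum_le_sum_abs _ _).trans (Finset.sum_le_sum fun j _ => ?_)
  have h2 : |v i * v j| ≤ v ⬝ᵥ v := by
    rw [abs_mul]
    nlinarith [sq_nonneg (|v i| - |v j|), sq_abs (v i), sq_abs (v j), hvv i, hvv j]
  rw [mul_left_comm, abs_mul]
  exact mul_le_mul_of_nonneg_left h2 (abs_nonneg _)

/-- A matrix annihilated by the kernel of `Gᵀ * G` factors through `G`. -/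
theorem Matrix.mul_eq_self_of_ker_le {ι : Type*} [Fintype ι] [DecidableEq ι]
    {G Y Z : Matrix ι ι ℝ} (hY : G * Y * G = G)
    (hker : ∀ v, (G.transpose * G).mulVec v = 0 → Z.mulVec v = 0) (hs : Z.transpose = Z) :
    G.transpose * (Y.transpose * Z * Y) * G = Z := by
  have h3 : Z * (Y * G) = Z := by
    refine Matrix.toLin'.injective (LinearMap.ext fun v => ?_)
    simp only [Matrix.toLin'_apply]
    rw [← sub_eq_zero, ← Matrix.mulVec_mulVec, ← Matrix.mulVec_sub]
    refine hker _ ?_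
    rw [Matrix.mulVec_sub, Matrix.mulVec_mulVec]
    have : G.transpose * G * (Y * G) = G.transpose * G := by
      rw [Matrix.mul_assoc, ← Matrix.mul_assoc G Y G, hY]
    rw [this, sub_self]
  have h4 : (Y * G).transpose * Z = Z := by
    have := congrArg Matrix.transpose h3
    rwa [Matrix.transpose_mul, hs] at this
  calc _ = (Y * G).transpose * (Z * (Y * G)) := by
        rw [Matrix.transpose_mul]; simp only [Matrix.mul_assoc]
    _ = Z := by rw [h3, h4]

theorem Matrix.PosSemidef.exists_smul_sub_posSemidef {ι : Type*} [Fintype ι] {A B : Matrix ι ι ℝ}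
    (hA : A.PosSemidef) (hB : B.PosSemidef) (hker : ∀ v, A.mulVec v = 0 → B.mulVec v = 0) :
    ∃ R : ℝ, 0 ≤ R ∧ ∀ r, R ≤ r → (r • A - B).PosSemidef := by
  classical
  obtain ⟨G, rfl⟩ := hA.exists_eq_transpose_mul_self
  obtain ⟨Y, hY⟩ := G.exists_mul_mul_eq
  have hs := (Matrix.posSemidef_real_iff.1 hB).1
  obtain ⟨R, hR0, hR⟩ := (Y.transpose * B * Y).exists_abs_dotProduct_mulVec_le
  refine ⟨R, hR0, fun r hr => ?_⟩
  rw [Matrix.posSemidef_real_iff]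
  refine ⟨by simp [hs], fun v => ?_⟩
  rw [Matrix.sub_mulVec, dotProduct_sub, Matrix.smul_mulVec, dotProduct_smul, smul_eq_mul,
    Matrix.dotProduct_transpose_mul_mulVec]
  have h1 : v ⬝ᵥ B.mulVec v = G.mulVec v ⬝ᵥ (Y.transpose * B * Y).mulVec (G.mulVec v) := by
    conv_lhs => rw [← Matrix.mul_eq_self_of_ker_le hY hker hs]
    rw [← Matrix.mulVec_mulVec, ← Matrix.mulVec_mulVec, Matrix.dotProduct_mulVec,
      Matrix.vecMul_transpose]
  have h2 := (le_abs_self _).trans (hR (G.mulVec v))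
  have h3 : 0 ≤ G.mulVec v ⬝ᵥ G.mulVec v := by simpa using dotProduct_self_star_nonneg (G.mulVec v)
  have := mul_le_mul_of_nonneg_right hr h3
  linarith

theorem half_sum_sq_le_of_diagonal_dominant {ι : Type*} (s : Finset ι) (w : ι → ℝ)
    (a : ι → ι → ℝ) (h : ℝ) (hw : ∀ i, 1 ≤ w i) (hh : 4 * (s.card : ℝ) ≤ h) (h0 : 0 < h)
    (hdiag : ∀ i, w i ^ 2 ≤ a i i) (hoff : ∀ i j, i ≠ j → |a i j| * h ≤ 2 * (w i * w j))
    (g : ι → ℝ) :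
    (1 / 2) * ∑ i ∈ s, g i ^ 2 ≤ ∑ i ∈ s, ∑ j ∈ s, a i j * (g i * g j) := by
  classical
  have key : ∀ i j, (if i = j then h * (w i * g i) ^ 2 else 0)
      - ((w i * g i) ^ 2 + (w j * g j) ^ 2) ≤ h * (a i j * (g i * g j)) := by
    intro i j
    split_ifs with hij
    · subst hij
      have h1 : h * (w i * g i) ^ 2 ≤ h * (a i i * (g i * g i)) := by
        have := mul_le_mul_of_nonneg_right (hdiag i) (mul_nonneg h0.le (sq_nonneg (g i)))
        nlinarith
      nlinarith [sq_nonneg (w i * g i)]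
    · have h1 := hoff i j hij
      have h2 : -(|a i j| * h * (|g i| * |g j|)) ≤ h * (a i j * (g i * g j)) := by
        have := neg_abs_le (h * (a i j * (g i * g j)))
        rw [abs_mul, abs_mul, abs_mul, abs_of_pos h0] at this
        linarith
      have h3 : |a i j| * h * (|g i| * |g j|) ≤ 2 * (w i * w j) * (|g i| * |g j|) :=
        mul_le_mul_of_nonneg_right h1 (by positivity)
      have h4 := sq_nonneg (w i * |g i| - w j * |g j|)
      have h5 : (w i * |g i|) ^ 2 = (w i * g i) ^ 2 := by rw [mul_pow, sq_abs, mul_pow]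
      have h6 : (w j * |g j|) ^ 2 = (w j * g j) ^ 2 := by rw [mul_pow, sq_abs, mul_pow]
      nlinarith
  have hsum := Finset.sum_le_sum fun i (_ : i ∈ s) => Finset.sum_le_sum fun j (_ : j ∈ s) => key i j
  have hL : ∑ i ∈ s, ∑ j ∈ s, ((if i = j then h * (w i * g i) ^ 2 else 0)
      - ((w i * g i) ^ 2 + (w j * g j) ^ 2)) = (h - 2 * s.card) * ∑ i ∈ s, (w i * g i) ^ 2 := by
    simp only [Finset.sum_sub_distrib, Finset.sum_add_distrib, Finset.sum_ite_eq, Finset.sum_const,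
      nsmul_eq_mul, ← Finset.mul_sum]
    rw [Finset.sum_congr rfl (fun i hi => if_pos hi), ← Finset.mul_sum]
    ring
  rw [hL] at hsum
  simp only [← Finset.mul_sum] at hsum
  have h7 : ∑ i ∈ s, g i ^ 2 ≤ ∑ i ∈ s, (w i * g i) ^ 2 := Finset.sum_le_sum fun i _ => by
    rw [mul_pow]
    exact le_mul_of_one_le_left (sq_nonneg _) (one_le_pow₀ (hw i))
  have h8 : 0 ≤ ∑ i ∈ s, (w i * g i) ^ 2 := Finset.sum_nonneg fun i _ => sq_nonneg _
  have h9 : h / 2 * ∑ i ∈ s, (w i * g i) ^ 2 ≤ (h - 2 * s.card) * ∑ i ∈ s, (w i * g i) ^ 2 :=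
    mul_le_mul_of_nonneg_right (by linarith) h8
  have h10 : h * (1 / 2 * ∑ i ∈ s, g i ^ 2) ≤ h * ∑ i ∈ s, ∑ j ∈ s, a i j * (g i * g j) := by
    have := mul_le_mul_of_nonneg_left h7 h0.le
    nlinarith
  exact le_of_mul_le_mul_left h10 h0

/-- A vector sequence indexed by monomials is spanned by its members of bounded degree. -/
theorem exists_forall_mem_span_degree_le {σ E : Type*} [AddCommGroup E]
    [Module ℝ E] [FiniteDimensional ℝ E] (u : (σ →₀ ℕ) → E) (d : ℕ) :
    ∃ N, d ≤ N ∧ ∀ a, u a ∈ Submodule.span ℝ (u '' {b | b.degree ≤ N}) := by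
  let f : ℕ →o Submodule ℝ E := ⟨fun N => Submodule.span ℝ (u '' {b | b.degree ≤ N}),
    fun M N h => Submodule.span_mono (Set.image_mono fun b (hb : _ ≤ _) => hb.trans h)⟩
  obtain ⟨N, hN⟩ := monotone_stabilizes_iff_noetherian.mpr (inferInstance : IsNoetherian ℝ E) f
  refine ⟨max d N, le_max_left _ _, fun a => ?_⟩
  have h1 : f (max d N) = f (max (max d N) a.degree) := by
    rw [← hN _ (le_max_right _ _), ← hN _ ((le_max_right d N).trans (le_max_left _ _))]
  change u a ∈ f (max d N)
  rw [h1]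
  exact Submodule.subset_span ⟨a, le_max_right (max d N) a.degree, rfl⟩

/-- The quadratic form with dominant low-degree part stays nonnegative under small perturbations
in high degree. -/
theorem quadratic_nonneg_of_small_high {ι : Type*} (L T : Finset ι) (hLT : L ⊆ T)
    (a : ι → ι → ℝ)
    (hlow : ∀ g : ι → ℝ, (1 / 2) * ∑ i ∈ L, g i ^ 2 ≤ ∑ i ∈ L, ∑ j ∈ L, a i j * (g i * g j))
    (hhigh : ∀ i j, i ∉ L → j ∉ L → a i j = 0) :
    ∃ δ > 0, ∀ g : ι → ℝ, (∀ i ∈ T, i ∉ L → |g i| ≤ δ * ∑ j ∈ L, |g j|) →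
      0 ≤ ∑ i ∈ T, ∑ j ∈ T, a i j * (g i * g j) := by
  classical
  set A : ℝ := ∑ i ∈ T, ∑ j ∈ T, |a i j| with hA
  have hA0 : 0 ≤ A := Finset.sum_nonneg fun i _ => Finset.sum_nonneg fun j _ => abs_nonneg _
  set c : ℝ := (L.card : ℝ) with hc
  have hc0 : 0 ≤ c := Nat.cast_nonneg _
  refine ⟨1 / (2 * (A * c) + 1), by positivity, fun g hg => ?_⟩
  set δ : ℝ := 1 / (2 * (A * c) + 1) with hδ
  set G : ℝ := ∑ j ∈ L, |g j| with hG
  have hG0 : 0 ≤ G := Finset.sum_nonneg fun j _ => abs_nonneg _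
  have hδ0 : 0 ≤ δ := by positivity
  have hle : ∀ j ∈ L, |g j| ≤ G := fun j hj =>
    Finset.single_le_sum (f := fun j => |g j|) (fun _ _ => abs_nonneg _) hj
  have hG2 : G ^ 2 ≤ c * ∑ i ∈ L, g i ^ 2 := by
    have := sq_sum_le_card_mul_sum_sq (s := L) (f := fun j => |g j|)
    simpa using this
  have hterm : ∀ i ∈ T, ∀ j ∈ T, (if i ∈ L ∧ j ∈ L then a i j * (g i * g j) else 0)
      - |a i j| * (δ * G ^ 2) ≤ a i j * (g i * g j) := by
    intro i hi j hj
    have hab : -(|a i j| * (|g i| * |g j|)) ≤ a i j * (g i * g j) := by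
      have := neg_abs_le (a i j * (g i * g j))
      rwa [abs_mul, abs_mul] at this
    by_cases hiL : i ∈ L <;> by_cases hjL : j ∈ L
    · rw [if_pos ⟨hiL, hjL⟩]
      have : 0 ≤ |a i j| * (δ * G ^ 2) := by positivity
      linarith
    · rw [if_neg (by tauto)]
      have : |g i| * |g j| ≤ G * (δ * G) :=
        mul_le_mul (hle i hiL) (hg j hj hjL) (abs_nonneg _) hG0
      have := mul_le_mul_of_nonneg_left this (abs_nonneg (a i j))
      nlinarith
    · rw [if_neg (by tauto)]
      have : |g i| * |g j| ≤ (δ * G) * G :=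
        mul_le_mul (hg i hi hiL) (hle j hjL) (abs_nonneg _) (by positivity)
      have := mul_le_mul_of_nonneg_left this (abs_nonneg (a i j))
      nlinarith
    · rw [if_neg (by tauto), hhigh i j hiL hjL]
      simp
  have hsum := Finset.sum_le_sum fun i hi => Finset.sum_le_sum fun j hj => hterm i hi j hj
  refine le_trans ?_ hsum
  simp only [Finset.sum_sub_distrib, ← Finset.sum_mul]
  rw [← hA]
  have hL : ∑ i ∈ T, ∑ j ∈ T, (if i ∈ L ∧ j ∈ L then a i j * (g i * g j) else 0)
      = ∑ i ∈ L, ∑ j ∈ L, a i j * (g i * g j) := by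
    rw [← Finset.sum_subset hLT]
    · refine Finset.sum_congr rfl fun i hi => ?_
      rw [← Finset.sum_subset hLT]
      · exact Finset.sum_congr rfl fun j hj => if_pos ⟨hi, hj⟩
      · intro j _ hj; simp [hj]
    · intro i _ hi; simp [hi]
  rw [hL]
  have h1 := hlow g
  have hS : 0 ≤ ∑ i ∈ L, g i ^ 2 := Finset.sum_nonneg fun i _ => sq_nonneg _
  have h2 : A * (δ * G ^ 2) ≤ (1 / 2) * ∑ i ∈ L, g i ^ 2 := by
    have h3 : A * (δ * G ^ 2) ≤ (A * c * δ) * ∑ i ∈ L, g i ^ 2 := by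
      have := mul_le_mul_of_nonneg_left hG2 (mul_nonneg hA0 hδ0)
      nlinarith
    have h4 : A * c * δ ≤ 1 / 2 := by
      rw [hδ, mul_one_div, div_le_iff₀ (by positivity)]
      linarith
    exact h3.trans (mul_le_mul_of_nonneg_right h4 hS)
  linarith

/-- The rescaling `t ^ D * m (x / t)` of a polynomial of degree at most `D`. -/
noncomputable def MvPolynomial.rescale {σ : Type*} (D : ℕ) (t : ℝ) (m : MvPolynomial σ ℝ) :
    MvPolynomial σ ℝ :=
  ∑ c ∈ m.support, MvPolynomial.monomial c (t ^ (D - c.degree) * m.coeff c)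

theorem MvPolynomial.coeff_rescale {σ : Type*} (D : ℕ) (t : ℝ) (m : MvPolynomial σ ℝ)
    (c : σ →₀ ℕ) : (m.rescale D t).coeff c = t ^ (D - c.degree) * m.coeff c := by
  classical
  rw [rescale, coeff_sum]
  simp only [coeff_monomial, Finset.sum_ite_eq', mem_support_iff]
  split_ifs with h
  · rfl
  · rw [not_not] at h
    rw [h, mul_zero]

theorem MvPolynomial.degree_le_totalDegree {σ R : Type*} [CommSemiring R]
    {m : MvPolynomial σ R} {c : σ →₀ ℕ} (h : c ∈ m.support) : c.degree ≤ m.totalDegree :=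
  le_totalDegree h

theorem MvPolynomial.eval_rescale {n D : ℕ} {t : ℝ} (ht : t ≠ 0) {m : MvPolynomial (Fin n) ℝ}
    (hm : m.totalDegree ≤ D) (x : Fin n → ℝ) :
    eval x (m.rescale D t) = t ^ D * eval (fun i => x i / t) m := by
  rw [rescale, map_sum, eval_eq' (fun i => x i / t), Finset.mul_sum]
  refine Finset.sum_congr rfl fun c hc => ?_
  have hcd : c.degree ≤ D := (degree_le_totalDegree hc).trans hm
  have h1 : t ^ D = t ^ (D - c.degree) * t ^ c.degree := by rw [← pow_add, Nat.sub_add_cancel hcd]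
  have h2 : ∏ i, (x i / t) ^ c i = (∏ i, x i ^ c i) / t ^ c.degree := by
    simp only [div_pow, Finset.prod_div_distrib, Finset.prod_pow_eq_pow_sum,
      Finsupp.degree_eq_sum]
  rw [eval_monomial, Finsupp.prod_fintype _ _ (by simp), h1, h2]
  field_simp

theorem rescale_mem_posCone {n d : ℕ} {t : ℝ} (ht : 0 < t) {m : MvPolynomial (Fin n) ℝ}
    (hm : m ∈ PosCone n d Set.univ) : m.rescale (2 * d) t ∈ PosCone n d Set.univ := by
  refine ⟨?_, fun x _ => ?_⟩
  · refine MvPolynomial.totalDegree_finsetSum_le fun c hc => ?_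
    exact (MvPolynomial.totalDegree_monomial_le c _).trans
      ((MvPolynomial.le_totalDegree hc).trans hm.1)
  · rw [MvPolynomial.eval_rescale ht.ne' hm.1]
    exact mul_nonneg (by positivity) (hm.2 _ trivial)

/-- A sequence of formal vectors cannot represent the expansions of all nonnegative polynomials by
positive semidefinite forms, provided a linear functional, which is negative on one nonnegative
polynomial, has a diagonally dominant moment matrix. -/
theorem not_forall_exists_formal_gram {n d q : ℕ} (u : (Fin n →₀ ℕ) → Fin q → ℝ)
    (m : MvPolynomial (Fin n) ℝ) (hm : m ∈ PosCone n d Set.univ)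
    (s : (Fin n →₀ ℕ) → ℕ) (l : ℝ → (Fin n →₀ ℕ) → ℝ)
    (hdiag : ∀ h, 1 ≤ h → ∀ a, h ^ (2 * s a) ≤ l h (a + a))
    (hoff : ∀ h, 1 ≤ h → ∀ a b, a ≠ b → |l h (a + b)| * h ≤ 2 * h ^ (s a + s b))
    (hneg : ∀ h, 1 ≤ h → ∑ c ∈ m.support, l h c * m.coeff c < 0) :
    ¬ ∀ f ∈ PosCone n d Set.univ, ∃ B : Matrix (Fin q) (Fin q) ℝ, B.PosSemidef ∧
      ∀ c, f.coeff c = ∑ p ∈ Finset.HasAntidiagonal.antidiagonal c, u p.1 ⬝ᵥ B.mulVec (u p.2) := by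
  classical
  intro H
  obtain ⟨N, hdN, hN⟩ := exists_forall_mem_span_degree_le u d
  set L := (Finsupp.finite_of_degree_le (σ := Fin n) N).toFinset with hLdef
  set T := (Finsupp.finite_of_degree_le (σ := Fin n) (2 * N)).toFinset with hTdef
  have mL : ∀ a, a ∈ L ↔ a.degree ≤ N := fun a => by simp [hLdef]
  have mT : ∀ a, a ∈ T ↔ a.degree ≤ 2 * N := fun a => by simp [hTdef]
  have hLT : L ⊆ T := fun a ha => by rw [mT]; have := (mL a).1 ha; omega
  set h : ℝ := 4 * (L.card : ℝ) + 1 with hh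
  have h1 : 1 ≤ h := by have : (0 : ℝ) ≤ L.card := Nat.cast_nonneg _; linarith
  let a : (Fin n →₀ ℕ) → (Fin n →₀ ℕ) → ℝ := fun x y => if x + y ∈ T then l h (x + y) else 0
  have hlow : ∀ g : (Fin n →₀ ℕ) → ℝ,
      (1 / 2) * ∑ i ∈ L, g i ^ 2 ≤ ∑ i ∈ L, ∑ j ∈ L, a i j * (g i * g j) := by
    intro g
    refine (half_sum_sq_le_of_diagonal_dominant L (fun x => h ^ s x) (fun x y => l h (x + y)) h
      (fun x => one_le_pow₀ h1) (by linarith) (by linarith) (fun x => ?_) (fun x y hxy => ?_)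
      g).trans_eq ?_
    · rw [← pow_mul, mul_comm]; exact hdiag h h1 x
    · rw [← pow_add]; exact hoff h h1 x y hxy
    · refine Finset.sum_congr rfl fun i hi => Finset.sum_congr rfl fun j hj => ?_
      rw [mL] at hi hj
      have : i + j ∈ T := by rw [mT, map_add]; omega
      simp only [a, if_pos this]
  have hhigh : ∀ i j, i ∉ L → j ∉ L → a i j = 0 := by
    intro i j hi hj
    rw [mL] at hi hj
    refine if_neg ?_
    rw [mT, map_add]; omega
  obtain ⟨δ, hδ, hquad⟩ := quadratic_nonneg_of_small_high L T hLT a hlow hhigh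
  have hτ : ∀ x, ∃ τ : (Fin n →₀ ℕ) → ℝ, u x = ∑ y ∈ L, τ y • u y := by
    intro x
    have := hN x
    have hset : {b : Fin n →₀ ℕ | b.degree ≤ N} = (L : Set (Fin n →₀ ℕ)) := by
      ext b; simp [mL]
    rw [hset, Submodule.mem_span_image_finset_iff_exists_fun] at this
    obtain ⟨c, hc⟩ := this
    refine ⟨fun y => if hy : y ∈ L then c ⟨y, hy⟩ else 0, ?_⟩
    rw [← hc, ← Finset.sum_attach L, Finset.univ_eq_attach]
    exact Finset.sum_congr rfl fun y _ => by simp only [dif_pos y.2]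
  choose τ hτ using hτ
  set K : ℝ := ∑ x ∈ T, ∑ y ∈ L, |τ x y| with hK
  have hK0 : 0 ≤ K := Finset.sum_nonneg fun i _ => Finset.sum_nonneg fun j _ => abs_nonneg _
  have hτK : ∀ x ∈ T, ∀ y ∈ L, |τ x y| ≤ K := fun x hx y hy =>
    (Finset.single_le_sum (f := fun y => |τ x y|) (fun _ _ => abs_nonneg _) hy).trans
      (Finset.single_le_sum (f := fun x => ∑ y ∈ L, |τ x y|)
        (fun _ _ => Finset.sum_nonneg fun j _ => abs_nonneg _) hx)
  set t : ℝ := δ / (K + 1 + δ) with ht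
  have ht0 : 0 < t := by positivity
  have ht1 : t ≤ 1 := by rw [ht, div_le_one (by positivity)]; linarith
  have htK : t * K ≤ δ := by
    rw [ht, div_mul_eq_mul_div, div_le_iff₀ (by positivity)]; nlinarith
  obtain ⟨B, hB, hBc⟩ := H _ (rescale_mem_posCone ht0 hm)
  obtain ⟨M, rfl⟩ := hB.exists_eq_transpose_mul_self
  let g : Fin q → (Fin n →₀ ℕ) → ℝ := fun j x => t ^ x.degree * M.mulVec (u x) j
  have hrow : ∀ j, 0 ≤ ∑ x ∈ T, ∑ y ∈ T, a x y * (g j x * g j y) := by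
    intro j
    refine hquad (g j) fun x hx hxL => ?_
    have hgx : g j x = ∑ y ∈ L, t ^ x.degree * (τ x y * M.mulVec (u y) j) := by
      simp only [g]
      conv_lhs => rw [hτ x]
      rw [Matrix.mulVec_sum, Finset.sum_apply, Finset.mul_sum]
      simp only [Matrix.mulVec_smul, Pi.smul_apply, smul_eq_mul]
    rw [hgx]
    refine (Finset.abs_sum_le_sum_abs _ _).trans ?_
    rw [Finset.mul_sum]
    refine Finset.sum_le_sum fun y hy => ?_
    have hdeg : t ^ x.degree ≤ t * t ^ y.degree := by
      rw [← pow_succ']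
      rw [mL] at hxL hy
      exact pow_le_pow_of_le_one ht0.le ht1 (by omega)
    rw [abs_mul, abs_mul, abs_of_pos (pow_pos ht0 _)]
    calc t ^ x.degree * (|τ x y| * |M.mulVec (u y) j|)
        ≤ (t * t ^ y.degree) * (K * |M.mulVec (u y) j|) :=
          mul_le_mul hdeg (mul_le_mul_of_nonneg_right (hτK x hx y hy) (abs_nonneg _))
            (by positivity) (by positivity)
      _ = (t * K) * |g j y| := by
          simp only [g, abs_mul, abs_of_pos (pow_pos ht0 _)]; ring
      _ ≤ δ * |g j y| := mul_le_mul_of_nonneg_right htK (abs_nonneg _)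
  have hsum := Finset.sum_nonneg fun j (_ : j ∈ Finset.univ) => hrow j
  have hpair : ∀ x y, ∑ j, g j x * g j y
      = t ^ (x + y).degree * (u x ⬝ᵥ (M.transpose * M).mulVec (u y)) := by
    intro x y
    rw [Matrix.dotProduct_transpose_mul_mulVec, dotProduct, Finset.mul_sum, map_add, pow_add]
    refine Finset.sum_congr rfl fun j _ => ?_
    simp only [g]; ring
  have htot : ∑ j, ∑ x ∈ T, ∑ y ∈ T, a x y * (g j x * g j y)
      = t ^ (2 * d) * ∑ c ∈ m.support, l h c * m.coeff c := by
    have e1 : ∑ j, ∑ x ∈ T, ∑ y ∈ T, a x y * (g j x * g j y)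
        = ∑ p ∈ T ×ˢ T with p.1 + p.2 ∈ T, l h (p.1 + p.2) * (t ^ (p.1 + p.2).degree *
            (u p.1 ⬝ᵥ (M.transpose * M).mulVec (u p.2))) := by
      rw [Finset.sum_comm]
      simp only [Finset.sum_comm (s := Finset.univ), ← Finset.mul_sum, hpair]
      rw [Finset.sum_filter, Finset.sum_product]
      simp only [a, ite_mul, zero_mul]
    have hfib : ∀ c ∈ T, ({p ∈ T ×ˢ T | p.1 + p.2 ∈ T} : Finset _).filter
        (fun p => p.1 + p.2 = c) = Finset.HasAntidiagonal.antidiagonal c := by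
      intro c hc
      ext p
      simp only [Finset.mem_filter, Finset.mem_product, Finset.HasAntidiagonal.mem_antidiagonal]
      refine ⟨fun hp => hp.2, fun hp => ⟨⟨?_, hp ▸ hc⟩, hp⟩⟩
      rw [mT] at hc
      rw [← hp, map_add] at hc
      rw [mT, mT]
      omega
    rw [e1, ← Finset.sum_fiberwise_of_maps_to (t := T)
      (g := fun p : (Fin n →₀ ℕ) × (Fin n →₀ ℕ) => p.1 + p.2)
      (fun p hp => (Finset.mem_filter.1 hp).2)]
    have e2 : ∀ c ∈ T, ∑ p ∈ ({p ∈ T ×ˢ T | p.1 + p.2 ∈ T} : Finset _).filter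
        (fun p => p.1 + p.2 = c), l h (p.1 + p.2) * (t ^ (p.1 + p.2).degree *
            (u p.1 ⬝ᵥ (M.transpose * M).mulVec (u p.2)))
        = t ^ (2 * d) * (l h c * m.coeff c) := by
      intro c hc
      have e3 : ∑ p ∈ ({p ∈ T ×ˢ T | p.1 + p.2 ∈ T} : Finset _).filter
        (fun p => p.1 + p.2 = c), l h (p.1 + p.2) * (t ^ (p.1 + p.2).degree *
            (u p.1 ⬝ᵥ (M.transpose * M).mulVec (u p.2)))
          = l h c * (t ^ c.degree * (m.rescale (2 * d) t).coeff c) := by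
        rw [hBc, hfib c hc, Finset.mul_sum, Finset.mul_sum]
        refine Finset.sum_congr rfl fun p hp => ?_
        rw [Finset.HasAntidiagonal.mem_antidiagonal.1 hp]
      rw [e3, MvPolynomial.coeff_rescale]
      by_cases hcs : m.coeff c = 0
      · simp [hcs]
      · have : c.degree ≤ 2 * d :=
          (MvPolynomial.degree_le_totalDegree (MvPolynomial.mem_support_iff.2 hcs)).trans hm.1
        have e4 : t ^ (2 * d) = t ^ c.degree * t ^ (2 * d - c.degree) := by
          rw [← pow_add, Nat.add_sub_cancel' this]
        rw [e4]; ring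
    rw [Finset.sum_congr rfl e2, ← Finset.mul_sum]
    congr 1
    symm
    refine Finset.sum_subset (fun c hc => ?_) fun c _ hc => ?_
    · rw [mT]
      exact (MvPolynomial.degree_le_totalDegree hc).trans (hm.1.trans (by omega))
    · rw [MvPolynomial.notMem_support_iff.1 hc, mul_zero]
  rw [htot] at hsum
  have := mul_neg_of_pos_of_neg (pow_pos ht0 (2 * d)) (hneg h h1)
  linarith

theorem MvPolynomial.sum_support_mul_coeff {σ : Type*} (l : (σ →₀ ℕ) → ℝ)
    (m : MvPolynomial σ ℝ) :
    ∑ c ∈ m.support, l c * m.coeff c = (MvPolynomial.basisMonomials σ ℝ).constr ℝ l m := by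
  conv_rhs => rw [m.as_sum, map_sum]
  refine Finset.sum_congr rfl fun c _ => ?_
  have h : MvPolynomial.monomial c (m.coeff c)
      = m.coeff c • (MvPolynomial.basisMonomials σ ℝ) c := by
    rw [MvPolynomial.coe_basisMonomials, MvPolynomial.smul_monomial, smul_eq_mul, mul_one]
  rw [h, map_smul, Module.Basis.constr_basis, smul_eq_mul, mul_comm]

theorem MvPolynomial.constr_basisMonomials_monomial {σ : Type*} (l : (σ →₀ ℕ) → ℝ)
    (c : σ →₀ ℕ) (r : ℝ) :
    (MvPolynomial.basisMonomials σ ℝ).constr ℝ l (MvPolynomial.monomial c r) = r * l c := by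
  have h : MvPolynomial.monomial c r = r • (MvPolynomial.basisMonomials σ ℝ) c := by
    rw [MvPolynomial.coe_basisMonomials, MvPolynomial.smul_monomial, smul_eq_mul, mul_one]
  rw [h, map_smul, Module.Basis.constr_basis, smul_eq_mul]

/-- The exponent with the given coordinates. -/
noncomputable def expo {n : ℕ} (v : Fin n → ℕ) : Fin n →₀ ℕ := Finsupp.equivFunOnFinite.symm v

@[simp] theorem expo_apply {n : ℕ} (v : Fin n → ℕ) (i : Fin n) : expo v i = v i := rfl

theorem MvPolynomial.eval_monomial_expo {n : ℕ} (v : Fin n → ℕ) (r : ℝ) (x : Fin n → ℝ) :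
    MvPolynomial.eval x (MvPolynomial.monomial (expo v) r) = r * ∏ i, x i ^ v i := by
  rw [MvPolynomial.eval_monomial, Finsupp.prod_fintype _ _ (by simp)]
  simp

theorem MvPolynomial.totalDegree_monomial_expo_le {n D : ℕ} (v : Fin n → ℕ) (r : ℝ)
    (h : ∑ i, v i ≤ D) : (MvPolynomial.monomial (expo v) r).totalDegree ≤ D := by
  refine (MvPolynomial.totalDegree_monomial_le _ _).trans ?_
  rw [Finsupp.sum_fintype _ _ (by simp)]
  simpa using h

/-- The Motzkin polynomial. -/
noncomputable def motzkin : MvPolynomial (Fin 2) ℝ :=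
  MvPolynomial.monomial (expo ![0, 0]) 1 + MvPolynomial.monomial (expo ![4, 2]) 1
    + MvPolynomial.monomial (expo ![2, 4]) 1 + MvPolynomial.monomial (expo ![2, 2]) (-3)

theorem motzkin_mem_posCone : motzkin ∈ PosCone 2 3 Set.univ := by
  refine ⟨?_, fun x _ => ?_⟩
  · refine (MvPolynomial.totalDegree_add _ _).trans (max_le
      ((MvPolynomial.totalDegree_add _ _).trans (max_le
        ((MvPolynomial.totalDegree_add _ _).trans (max_le ?_ ?_)) ?_)) ?_) <;>
    exact MvPolynomial.totalDegree_monomial_expo_le _ _ (by simp [Fin.sum_univ_two])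
  · simp only [motzkin, map_add, MvPolynomial.eval_monomial_expo, Fin.prod_univ_two]
    simp only [Matrix.cons_val_zero, Matrix.cons_val_one]
    have h1 : |x 0 * x 1| ^ 2 = (x 0 * x 1) ^ 2 := sq_abs _
    have h2 : 2 * |x 0 * x 1| ≤ x 0 ^ 2 + x 1 ^ 2 := by
      rw [abs_mul]
      nlinarith [sq_nonneg (|x 0| - |x 1|), sq_abs (x 0), sq_abs (x 1)]
    have h3 := mul_le_mul_of_nonneg_left h2 (sq_nonneg (x 0 * x 1))
    have h4 : 0 ≤ (|x 0 * x 1| - 1) ^ 2 * (2 * |x 0 * x 1| + 1) := by positivity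
    nlinarith

/-- The Choi–Lam polynomial. -/
noncomputable def choiLam : MvPolynomial (Fin 3) ℝ :=
  MvPolynomial.monomial (expo ![0, 0, 0]) 1 + MvPolynomial.monomial (expo ![2, 2, 0]) 1
    + MvPolynomial.monomial (expo ![0, 2, 2]) 1 + MvPolynomial.monomial (expo ![2, 0, 2]) 1
    + MvPolynomial.monomial (expo ![1, 1, 1]) (-4)

theorem choiLam_mem_posCone : choiLam ∈ PosCone 3 2 Set.univ := by
  refine ⟨?_, fun x _ => ?_⟩
  · refine (MvPolynomial.totalDegree_add _ _).trans (max_le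
      ((MvPolynomial.totalDegree_add _ _).trans (max_le
        ((MvPolynomial.totalDegree_add _ _).trans (max_le
          ((MvPolynomial.totalDegree_add _ _).trans (max_le ?_ ?_)) ?_)) ?_)) ?_) <;>
    exact MvPolynomial.totalDegree_monomial_expo_le _ _ (by simp [Fin.sum_univ_three])
  · simp only [choiLam, map_add, MvPolynomial.eval_monomial_expo, Fin.prod_univ_three]
    simp only [Matrix.cons_val_zero, Matrix.cons_val_one, Matrix.cons_val]
    rcases le_total 0 (x 0 * x 1) with h | h
    · nlinarith [sq_nonneg (x 0 * x 1 - 1), sq_nonneg (x 2 * (x 0 - x 1)),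
        mul_nonneg h (sq_nonneg (1 - x 2))]
    · nlinarith [sq_nonneg (x 0 * x 1 + 1), sq_nonneg (x 2 * (x 0 + x 1)),
        mul_nonneg (neg_nonneg.2 h) (sq_nonneg (1 + x 2))]

/-- Weight exponents for the Motzkin moment matrix. -/
def motzkinWeight (a b : ℕ) : ℕ :=
  if (a = 0 ∧ b = 0) ∨ (a = 2 ∧ b = 1) ∨ (a = 1 ∧ b = 2) then 0
  else (((a : ℤ) - 1) ^ 2 - (a - 1) * (b - 1) + (b - 1) ^ 2).toNat

theorem motzkinWeight_midpoint {a b a' b' c e : ℕ} (h1 : a + a' = 2 * c) (h2 : b + b' = 2 * e)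
    (hne : ¬ (a = a' ∧ b = b')) :
    2 * motzkinWeight c e + 1 ≤ motzkinWeight a b + motzkinWeight a' b' := by
  have hnn : ∀ x y : ℤ, 0 ≤ x ^ 2 - x * y + y ^ 2 := fun x y => by
    nlinarith [sq_nonneg (x - y), sq_nonneg x, sq_nonneg y]
  have hle : ∀ x y : ℕ, (motzkinWeight x y : ℤ)
      ≤ ((x : ℤ) - 1) ^ 2 - (x - 1) * (y - 1) + (y - 1) ^ 2 := by
    intro x y
    unfold motzkinWeight
    split_ifs
    · exact hnn _ _
    · rw [Int.toNat_of_nonneg (hnn _ _)]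
  have hge : ∀ x y : ℕ, (motzkinWeight x y : ℤ)
      = ((x : ℤ) - 1) ^ 2 - (x - 1) * (y - 1) + (y - 1) ^ 2
      ∨ (((x = 0 ∧ y = 0) ∨ (x = 2 ∧ y = 1) ∨ (x = 1 ∧ y = 2)) ∧
      (motzkinWeight x y : ℤ) = ((x : ℤ) - 1) ^ 2 - (x - 1) * (y - 1) + (y - 1) ^ 2 - 1) := by
    intro x y
    unfold motzkinWeight
    split_ifs with h
    · right
      refine ⟨h, ?_⟩
      rcases h with ⟨rfl, rfl⟩ | ⟨rfl, rfl⟩ | ⟨rfl, rfl⟩ <;> norm_num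
    · left
      rw [Int.toNat_of_nonneg (hnn _ _)]
  have hc := hle c e
  have e1 : (a : ℤ) + a' = 2 * c := by exact_mod_cast h1
  have e2 : (b : ℤ) + b' = 2 * e := by exact_mod_cast h2
  have key : (2 : ℤ) * (((c : ℤ) - 1) ^ 2 - (c - 1) * (e - 1) + (e - 1) ^ 2) + 2
      ≤ (((a : ℤ) - 1) ^ 2 - (a - 1) * (b - 1) + (b - 1) ^ 2)
        + (((a' : ℤ) - 1) ^ 2 - (a' - 1) * (b' - 1) + (b' - 1) ^ 2) := by
    obtain ⟨x, hx⟩ : ∃ x : ℤ, x = a - c := ⟨_, rfl⟩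
    obtain ⟨y, hy⟩ : ∃ y : ℤ, y = b - e := ⟨_, rfl⟩
    have ha : (a : ℤ) = c + x := by omega
    have ha' : (a' : ℤ) = c - x := by omega
    have hb : (b : ℤ) = e + y := by omega
    have hb' : (b' : ℤ) = e - y := by omega
    have hxy : 1 ≤ x ^ 2 - x * y + y ^ 2 := by
      by_contra hlt
      have h0 : x ^ 2 - x * y + y ^ 2 = 0 := le_antisymm (by omega) (hnn x y)
      have hx0 : x = 0 := by
        have : x ^ 2 ≤ 0 := by nlinarith [sq_nonneg (x - 2 * y)]
        exact pow_eq_zero_iff two_ne_zero |>.1 (le_antisymm this (sq_nonneg x))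
      have hy0 : y = 0 := by
        have : y ^ 2 ≤ 0 := by nlinarith [sq_nonneg (y - 2 * x)]
        exact pow_eq_zero_iff two_ne_zero |>.1 (le_antisymm this (sq_nonneg y))
      exact hne ⟨by omega, by omega⟩
    rw [ha, ha', hb, hb']
    nlinarith
  rcases hge a b with h | ⟨hv, h⟩ <;> rcases hge a' b' with h' | ⟨hv', h'⟩
  · omega
  · omega
  · omega
  · omega

/-- The functional separating the Motzkin polynomial. -/
noncomputable def motzkinFunctional (h : ℝ) (c : Fin 2 →₀ ℕ) : ℝ :=
  if c 0 = 2 ∧ c 1 = 2 then 2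
  else if 2 ∣ c 0 ∧ 2 ∣ c 1 then h ^ (2 * motzkinWeight (c 0 / 2) (c 1 / 2)) else 0

theorem not_forall_exists_formal_gram_motzkin {q : ℕ} (u : (Fin 2 →₀ ℕ) → Fin q → ℝ) :
    ¬ ∀ f ∈ PosCone 2 3 Set.univ, ∃ B : Matrix (Fin q) (Fin q) ℝ, B.PosSemidef ∧
      ∀ c, f.coeff c
        = ∑ p ∈ Finset.HasAntidiagonal.antidiagonal c, u p.1 ⬝ᵥ B.mulVec (u p.2) := by
  refine not_forall_exists_formal_gram u motzkin motzkin_mem_posCone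
    (fun a => motzkinWeight (a 0) (a 1)) motzkinFunctional ?_ ?_ ?_
  · intro h hh a
    unfold motzkinFunctional
    split_ifs with h1 h2
    · have h3 : a 0 = 1 := by have := h1.1; simp at this; omega
      have h4 : a 1 = 1 := by have := h1.2; simp at this; omega
      rw [h3, h4]
      norm_num [motzkinWeight]
    · have h3 : (a + a) 0 / 2 = a 0 := by simp; omega
      have h4 : (a + a) 1 / 2 = a 1 := by simp; omega
      rw [h3, h4]
    · exact absurd ⟨⟨a 0, by simp; omega⟩, ⟨a 1, by simp; omega⟩⟩ h2
  · intro h hh a b hab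
    have hne : ¬ (a 0 = b 0 ∧ a 1 = b 1) := fun h => hab (by ext i; fin_cases i <;> simp [h])
    have h0 : (0 : ℝ) ≤ h := by linarith
    by_cases hev : 2 ∣ (a + b) 0 ∧ 2 ∣ (a + b) 1
    · obtain ⟨⟨c, hc⟩, ⟨e, he⟩⟩ := hev
      have hw := motzkinWeight_midpoint (a := a 0) (a' := b 0) (b := a 1) (b' := b 1) hc he hne
      have hl : |motzkinFunctional h (a + b)| ≤ 2 * h ^ (2 * motzkinWeight c e) := by
        have h1 : (1 : ℝ) ≤ h ^ (2 * motzkinWeight c e) := one_le_pow₀ hh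
        unfold motzkinFunctional
        rw [hc, he]
        simp only [Nat.mul_div_cancel_left _ two_pos]
        split_ifs
        · rw [abs_of_pos two_pos]; linarith
        · rw [abs_of_nonneg (by positivity)]; linarith
        · simp; positivity
      calc _ ≤ 2 * h ^ (2 * motzkinWeight c e) * h := mul_le_mul_of_nonneg_right hl h0
        _ = 2 * h ^ (2 * motzkinWeight c e + 1) := by ring
        _ ≤ _ := by
          have := pow_le_pow_right₀ hh hw
          linarith
    · have : motzkinFunctional h (a + b) = 0 := by
        unfold motzkinFunctional
        rw [if_neg, if_neg hev]
        rintro ⟨h1, h2⟩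
        exact hev (by rw [h1, h2]; norm_num)
      rw [this]
      simp; positivity
  · intro h hh
    rw [MvPolynomial.sum_support_mul_coeff]
    simp only [motzkin, map_add, MvPolynomial.constr_basisMonomials_monomial]
    norm_num [motzkinFunctional, motzkinWeight]

/-- Weight exponents for the Choi–Lam moment matrix. -/
def choiLamWeight (a b c : ℕ) : ℕ :=
  if (a = 0 ∧ b = 0 ∧ c = 0) ∨ (a = 1 ∧ b = 1 ∧ c = 0) ∨ (a = 0 ∧ b = 1 ∧ c = 1)
    ∨ (a = 1 ∧ b = 0 ∧ c = 1) then 0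
  else ((2 * (a : ℤ) - 1) ^ 2 + (2 * b - 1) ^ 2 + (2 * c - 1) ^ 2).toNat

theorem choiLamWeight_midpoint {a b c a' b' c' x y z : ℕ} (h1 : a + a' = 2 * x)
    (h2 : b + b' = 2 * y) (h3 : c + c' = 2 * z) (hne : ¬ (a = a' ∧ b = b' ∧ c = c')) :
    2 * choiLamWeight x y z + 1 ≤ choiLamWeight a b c + choiLamWeight a' b' c' := by
  have hle : ∀ x y z : ℕ, (choiLamWeight x y z : ℤ)
      ≤ (2 * (x : ℤ) - 1) ^ 2 + (2 * y - 1) ^ 2 + (2 * z - 1) ^ 2 := by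
    intro x y z
    unfold choiLamWeight
    split_ifs
    · simp only [Nat.cast_zero]; positivity
    · rw [Int.toNat_of_nonneg (by positivity)]
  have hge : ∀ x y z : ℕ,
      (choiLamWeight x y z : ℤ) = (2 * (x : ℤ) - 1) ^ 2 + (2 * y - 1) ^ 2 + (2 * z - 1) ^ 2
      ∨ (((x = 0 ∧ y = 0 ∧ z = 0) ∨ (x = 1 ∧ y = 1 ∧ z = 0) ∨ (x = 0 ∧ y = 1 ∧ z = 1)
        ∨ (x = 1 ∧ y = 0 ∧ z = 1)) ∧ (choiLamWeight x y z : ℤ)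
        = (2 * (x : ℤ) - 1) ^ 2 + (2 * y - 1) ^ 2 + (2 * z - 1) ^ 2 - 3) := by
    intro x y z
    unfold choiLamWeight
    split_ifs with h
    · right
      refine ⟨h, ?_⟩
      rcases h with ⟨rfl, rfl, rfl⟩ | ⟨rfl, rfl, rfl⟩ | ⟨rfl, rfl, rfl⟩ | ⟨rfl, rfl, rfl⟩ <;>
        norm_num
    · left
      rw [Int.toNat_of_nonneg (by positivity)]
  have hc := hle x y z
  have key : (2 : ℤ) * ((2 * (x : ℤ) - 1) ^ 2 + (2 * y - 1) ^ 2 + (2 * z - 1) ^ 2) + 8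
      ≤ ((2 * (a : ℤ) - 1) ^ 2 + (2 * b - 1) ^ 2 + (2 * c - 1) ^ 2)
        + ((2 * (a' : ℤ) - 1) ^ 2 + (2 * b' - 1) ^ 2 + (2 * c' - 1) ^ 2) := by
    obtain ⟨p, hp⟩ : ∃ p : ℤ, p = a - x := ⟨_, rfl⟩
    obtain ⟨q, hq⟩ : ∃ q : ℤ, q = b - y := ⟨_, rfl⟩
    obtain ⟨r, hr⟩ : ∃ r : ℤ, r = c - z := ⟨_, rfl⟩
    have ha : (a : ℤ) = x + p := by omega
    have ha' : (a' : ℤ) = x - p := by omega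
    have hb : (b : ℤ) = y + q := by omega
    have hb' : (b' : ℤ) = y - q := by omega
    have hc : (c : ℤ) = z + r := by omega
    have hc' : (c' : ℤ) = z - r := by omega
    have hpq : 1 ≤ p ^ 2 + q ^ 2 + r ^ 2 := by
      have hsq : ∀ w : ℤ, w ≠ 0 → 1 ≤ w ^ 2 := fun w hw => by
        have := pow_pos (abs_pos.2 hw) 2
        rw [sq_abs] at this
        omega
      have hp2 := sq_nonneg p
      have hq2 := sq_nonneg q
      have hr2 := sq_nonneg r
      by_cases hp0 : p = 0
      · by_cases hq0 : q = 0
        · have : r ≠ 0 := fun hr0 => hne ⟨by omega, by omega, by omega⟩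
          have := hsq r this
          omega
        · have := hsq q hq0
          omega
      · have := hsq p hp0
        omega
    rw [ha, ha', hb, hb', hc, hc']
    nlinarith
  rcases hge a b c with h | ⟨hv, h⟩ <;> rcases hge a' b' c' with h' | ⟨hv', h'⟩
  · omega
  · omega
  · omega
  · omega

/-- The functional separating the Choi–Lam polynomial. -/
noncomputable def choiLamFunctional (h : ℝ) (c : Fin 3 →₀ ℕ) : ℝ :=
  if c 0 = 1 ∧ c 1 = 1 ∧ c 2 = 1 then 2
  else if 2 ∣ c 0 ∧ 2 ∣ c 1 ∧ 2 ∣ c 2 then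
    h ^ (2 * choiLamWeight (c 0 / 2) (c 1 / 2) (c 2 / 2)) else 0

theorem not_forall_exists_formal_gram_choiLam {q : ℕ} (u : (Fin 3 →₀ ℕ) → Fin q → ℝ) :
    ¬ ∀ f ∈ PosCone 3 2 Set.univ, ∃ B : Matrix (Fin q) (Fin q) ℝ, B.PosSemidef ∧
      ∀ c, f.coeff c
        = ∑ p ∈ Finset.HasAntidiagonal.antidiagonal c, u p.1 ⬝ᵥ B.mulVec (u p.2) := by
  refine not_forall_exists_formal_gram u choiLam choiLam_mem_posCone
    (fun a => choiLamWeight (a 0) (a 1) (a 2)) choiLamFunctional ?_ ?_ ?_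
  · intro h hh a
    unfold choiLamFunctional
    split_ifs with h1 h2
    · have := h1.1; simp at this; omega
    · have h3 : (a + a) 0 / 2 = a 0 := by simp; omega
      have h4 : (a + a) 1 / 2 = a 1 := by simp; omega
      have h5 : (a + a) 2 / 2 = a 2 := by simp; omega
      rw [h3, h4, h5]
    · exact absurd ⟨⟨a 0, by simp; omega⟩, ⟨a 1, by simp; omega⟩, ⟨a 2, by simp; omega⟩⟩ h2
  · intro h hh a b hab
    have hne : ¬ (a 0 = b 0 ∧ a 1 = b 1 ∧ a 2 = b 2) :=
      fun h => hab (by ext i; fin_cases i <;> simp [h])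
    have h0 : (0 : ℝ) ≤ h := by linarith
    by_cases hev : 2 ∣ (a + b) 0 ∧ 2 ∣ (a + b) 1 ∧ 2 ∣ (a + b) 2
    · obtain ⟨⟨x, hx⟩, ⟨y, hy⟩, ⟨z, hz⟩⟩ := hev
      have hw := choiLamWeight_midpoint (a := a 0) (a' := b 0) (b := a 1) (b' := b 1)
        (c := a 2) (c' := b 2) hx hy hz hne
      have hl : |choiLamFunctional h (a + b)| ≤ 2 * h ^ (2 * choiLamWeight x y z) := by
        have h1 : (1 : ℝ) ≤ h ^ (2 * choiLamWeight x y z) := one_le_pow₀ hh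
        unfold choiLamFunctional
        rw [hx, hy, hz]
        simp only [Nat.mul_div_cancel_left _ two_pos]
        split_ifs
        · rw [abs_of_pos two_pos]; linarith
        · rw [abs_of_nonneg (by positivity)]; linarith
        · simp; positivity
      calc _ ≤ 2 * h ^ (2 * choiLamWeight x y z) * h := mul_le_mul_of_nonneg_right hl h0
        _ = 2 * h ^ (2 * choiLamWeight x y z + 1) := by ring
        _ ≤ _ := by
          have := pow_le_pow_right₀ hh hw
          linarith
    · by_cases h1 : (a + b) 0 = 1 ∧ (a + b) 1 = 1 ∧ (a + b) 2 = 1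
      · have hl : choiLamFunctional h (a + b) = 2 := if_pos h1
        rw [hl, abs_of_pos two_pos]
        have hw : 1 ≤ choiLamWeight (a 0) (a 1) (a 2) + choiLamWeight (b 0) (b 1) (b 2) := by
          simp only [Finsupp.add_apply] at h1
          obtain ⟨e1, e2, e3⟩ := h1
          have p1 : (a 0 = 0 ∧ b 0 = 1) ∨ (a 0 = 1 ∧ b 0 = 0) := by omega
          have p2 : (a 1 = 0 ∧ b 1 = 1) ∨ (a 1 = 1 ∧ b 1 = 0) := by omega
          have p3 : (a 2 = 0 ∧ b 2 = 1) ∨ (a 2 = 1 ∧ b 2 = 0) := by omega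
          rcases p1 with ⟨q1, r1⟩ | ⟨q1, r1⟩ <;> rcases p2 with ⟨q2, r2⟩ | ⟨q2, r2⟩ <;>
            rcases p3 with ⟨q3, r3⟩ | ⟨q3, r3⟩ <;> rw [q1, q2, q3, r1, r2, r3] <;> decide
        have := pow_le_pow_right₀ hh hw
        rw [pow_one] at this
        linarith
      · have : choiLamFunctional h (a + b) = 0 := by
          unfold choiLamFunctional
          rw [if_neg h1, if_neg hev]
        rw [this]
        simp; positivity
  · intro h hh
    rw [MvPolynomial.sum_support_mul_coeff]
    simp only [choiLam, map_add, MvPolynomial.constr_basisMonomials_monomial]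
    simp only [choiLamFunctional, expo_apply, Matrix.cons_val_zero, Matrix.cons_val_one,
      Matrix.cons_val]
    norm_num [choiLamWeight]

theorem MvPolynomial.totalDegree_aeval_le_of_le_one {σ τ : Type*}
    (g : σ → MvPolynomial τ ℝ) (hg : ∀ i, (g i).totalDegree ≤ 1) (f : MvPolynomial σ ℝ) :
    (MvPolynomial.aeval g f).totalDegree ≤ f.totalDegree := by
  rw [MvPolynomial.aeval_def, MvPolynomial.eval₂_eq]
  refine MvPolynomial.totalDegree_finsetSum_le fun c hc => ?_
  refine (MvPolynomial.totalDegree_mul _ _).trans ?_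
  rw [MvPolynomial.algebraMap_eq, MvPolynomial.totalDegree_C, zero_add]
  refine (MvPolynomial.totalDegree_finsetProd _ _).trans ?_
  refine le_trans (Finset.sum_le_sum fun i _ => ?_) (MvPolynomial.le_totalDegree hc)
  refine (MvPolynomial.totalDegree_pow _ _).trans ?_
  exact (Nat.mul_le_mul_left _ (hg i)).trans (by simp)

/-- The translate `f (X + a)` of a polynomial. -/
noncomputable def MvPolynomial.translate {σ : Type*} (a : σ → ℝ) :
    MvPolynomial σ ℝ →ₐ[ℝ] MvPolynomial σ ℝ :=
  MvPolynomial.aeval fun i => MvPolynomial.C (a i) + MvPolynomial.X i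

theorem MvPolynomial.eval_translate {σ : Type*} (a x : σ → ℝ) (f : MvPolynomial σ ℝ) :
    MvPolynomial.eval x (f.translate a) = MvPolynomial.eval (a + x) f := by
  have : (MvPolynomial.aeval x).comp (MvPolynomial.translate a) = MvPolynomial.aeval (a + x) := by
    ext i; simp [translate]
  simpa [MvPolynomial.coe_aeval_eq_eval] using DFunLike.congr_fun this f

theorem MvPolynomial.translate_translate_neg {σ : Type*} (a : σ → ℝ) (f : MvPolynomial σ ℝ) :
    MvPolynomial.translate a (MvPolynomial.translate (-a) f) = f := by
  have : (MvPolynomial.translate a).comp (MvPolynomial.translate (-a)) = AlgHom.id ℝ _ := by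
    ext i; simp [translate]
  simpa using DFunLike.congr_fun this f

theorem translate_mem_posCone {n d : ℕ} {f : MvPolynomial (Fin n) ℝ}
    (hf : f ∈ PosCone n d Set.univ) (a : Fin n → ℝ) :
    MvPolynomial.translate a f ∈ PosCone n d Set.univ := by
  refine ⟨(MvPolynomial.totalDegree_aeval_le_of_le_one _ (fun i => ?_) f).trans hf.1, fun x _ => ?_⟩
  · refine (MvPolynomial.totalDegree_add _ _).trans ?_
    rw [MvPolynomial.totalDegree_C, MvPolynomial.totalDegree_X]
    simp
  · rw [MvPolynomial.eval_translate]
    exact hf.2 _ trivial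

theorem map_eval_eq_translate {n : ℕ} {x : Fin n → ℝ} {φ : ℝ →+* MvPowerSeries (Fin n) ℝ}
    (hx : ∀ i, φ (x i) = MvPowerSeries.C (x i) + MvPowerSeries.X i) {f : MvPolynomial (Fin n) ℝ}
    (hf : ∀ c, φ (f.coeff c) = MvPowerSeries.C (f.coeff c)) :
    φ (MvPolynomial.eval x f) = (MvPolynomial.translate x f : MvPowerSeries (Fin n) ℝ) := by
  rw [MvPolynomial.eval_eq', MvPolynomial.translate, MvPolynomial.aeval_def,
    MvPolynomial.eval₂_eq', map_sum]
  change _ = MvPolynomial.coeToMvPowerSeries.ringHom _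
  rw [map_sum]
  refine Finset.sum_congr rfl fun c _ => ?_
  simp only [map_mul, map_prod, map_pow, map_add, hf, hx]
  simp [MvPolynomial.algebraMap_eq]

/-- A pointwise representation of all nonnegative polynomials by positive semidefinite forms
yields a representation of their Taylor expansions. -/
theorem exists_formal_gram_of_pointwise {n d q : ℕ} (u : (Fin n → ℝ) → Fin q → ℝ)
    (hu : ∀ f ∈ PosCone n d Set.univ, ∃ B : Matrix (Fin q) (Fin q) ℝ, B.PosSemidef ∧
      ∀ x, MvPolynomial.eval x f = u x ⬝ᵥ B.mulVec (u x)) :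
    ∃ U : (Fin n →₀ ℕ) → Fin q → ℝ, ∀ f ∈ PosCone n d Set.univ,
      ∃ B : Matrix (Fin q) (Fin q) ℝ, B.PosSemidef ∧ ∀ c, f.coeff c
        = ∑ p ∈ Finset.HasAntidiagonal.antidiagonal c, U p.1 ⬝ᵥ B.mulVec (U p.2) := by
  classical
  choose! B hB hBu using hu
  let S : Set (MvPolynomial (Fin n) ℝ × Matrix (Fin q) (Fin q) ℝ) :=
    (fun f => (f, B f)) '' PosCone n d Set.univ
  have hfg : (Submodule.span ℝ S).FG := by
    have h1 : ((MvPolynomial.restrictTotalDegree (Fin n) ℝ (2 * d)).prod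
        (⊤ : Submodule ℝ (Matrix (Fin q) (Fin q) ℝ))).FG :=
      Submodule.FG.prod (Module.Finite.iff_fg.1 inferInstance) Module.Finite.fg_top
    have h2 : Submodule.span ℝ S ≤ (MvPolynomial.restrictTotalDegree (Fin n) ℝ (2 * d)).prod ⊤ := by
      rw [Submodule.span_le]
      rintro _ ⟨f, hf, rfl⟩
      exact ⟨(MvPolynomial.mem_restrictTotalDegree _ _ _).2 hf.1, trivial⟩
    have : IsNoetherian ℝ ((MvPolynomial.restrictTotalDegree (Fin n) ℝ (2 * d)).prod
        (⊤ : Submodule ℝ (Matrix (Fin q) (Fin q) ℝ))) := by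
      have := Module.Finite.iff_fg.2 h1
      infer_instance
    exact (isNoetherian_submodule.1 this) _ h2
  obtain ⟨T, hTS, hspan⟩ := (Submodule.fg_span_iff_fg_span_finset_subset S).1 hfg
  let s : Set ℝ := (⋃ p ∈ T, Set.range fun c => p.1.coeff c) ∪
    ⋃ p ∈ T, Set.range fun ij : Fin q × Fin q => p.2 ij.1 ij.2
  have hs : s.Countable :=
    (T.countable_toSet.biUnion fun p _ => Set.countable_range _).union
      (T.countable_toSet.biUnion fun p _ => Set.countable_range _)
  obtain ⟨x, φ, hφs, hφx⟩ := exists_generic_formal_translation n s hs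
  have key : ∀ p ∈ Submodule.span ℝ S, (MvPolynomial.translate x p.1 : MvPowerSeries (Fin n) ℝ)
      = ∑ i, ∑ j, p.2 i j • (φ (u x i) * φ (u x j)) := by
    let F : MvPolynomial (Fin n) ℝ × Matrix (Fin q) (Fin q) ℝ →ₗ[ℝ] MvPowerSeries (Fin n) ℝ :=
      (MvPolynomial.coeToMvPowerSeries.algHom ℝ).toLinearMap ∘ₗ
        (MvPolynomial.translate x).toLinearMap ∘ₗ LinearMap.fst ℝ _ _
    let G : MvPolynomial (Fin n) ℝ × Matrix (Fin q) (Fin q) ℝ →ₗ[ℝ] MvPowerSeries (Fin n) ℝ :=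
      { toFun := fun p => ∑ i, ∑ j, p.2 i j • (φ (u x i) * φ (u x j))
        map_add' := fun p r => by simp [add_smul, Finset.sum_add_distrib]
        map_smul' := fun a p => by simp [mul_smul, Finset.smul_sum] }
    have hF : ∀ p, F p = (MvPolynomial.translate x p.1 : MvPowerSeries (Fin n) ℝ) := fun p => by
      simp [F, MvPolynomial.coeToMvPowerSeries.algHom_apply]
    have hFG : Set.EqOn F G T := by
      intro p hp
      obtain ⟨f, hf, rfl⟩ := hTS hp
      rw [hF]
      have hc : ∀ c, φ (f.coeff c) = MvPowerSeries.C (f.coeff c) := fun c =>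
        hφs _ (Or.inl (Set.mem_biUnion hp ⟨c, rfl⟩))
      have hb : ∀ i j, φ (B f i j) = MvPowerSeries.C (B f i j) := fun i j =>
        hφs _ (Or.inr (Set.mem_biUnion hp ⟨(i, j), rfl⟩))
      change (MvPolynomial.translate x f : MvPowerSeries (Fin n) ℝ) = _
      rw [← map_eval_eq_translate hφx hc, hBu f hf x]
      simp only [G, dotProduct, Matrix.mulVec, map_sum, map_mul, Finset.mul_sum, hb,
        LinearMap.coe_mk, AddHom.coe_mk, MvPowerSeries.smul_eq_C_mul]
      refine Finset.sum_congr rfl fun i _ => Finset.sum_congr rfl fun j _ => ?_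
      ring
    intro p hp
    rw [hspan] at hp
    rw [← hF]
    exact LinearMap.eqOn_span hFG hp
  refine ⟨fun c i => MvPowerSeries.coeff c (φ (u x i)), fun f hf => ?_⟩
  have hf' := translate_mem_posCone hf (-x)
  refine ⟨B _, hB _ hf', fun c => ?_⟩
  have h1 := key _ (Submodule.subset_span ⟨_, hf', rfl⟩)
  simp only [MvPolynomial.translate_translate_neg] at h1
  rw [← MvPolynomial.coeff_coe, h1]
  simp only [map_sum, MvPowerSeries.coeff_smul, MvPowerSeries.coeff_mul, dotProduct, Matrix.mulVec,
    Finset.mul_sum]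
  rw [Finset.sum_comm' (s := Finset.HasAntidiagonal.antidiagonal c) (t' := Finset.univ)
    (s' := fun _ => Finset.HasAntidiagonal.antidiagonal c) (by simp)]
  refine Finset.sum_congr rfl fun i _ => ?_
  rw [Finset.sum_comm]
  refine Finset.sum_congr rfl fun p _ => Finset.sum_congr rfl fun j _ => ?_
  ring

/-- A linear functional that is nonnegative on an affine slice of the positive semidefinite cone
agrees there with a trace functional plus a nonnegative constant. -/
theorem exists_posSemidef_representation {ι : Type*} [Fintype ι] [DecidableEq ι]
    (H : AffineSubspace ℝ (Matrix ι ι ℝ)) (l : Matrix ι ι ℝ →ₗ[ℝ] ℝ)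
    (hl : ∀ Z : Matrix ι ι ℝ, Z.PosSemidef → Z ∈ H → 0 ≤ l Z) :
    ∃ A : Matrix ι ι ℝ, A.PosSemidef ∧ ∃ c : ℝ, 0 ≤ c ∧
      ∀ Z : Matrix ι ι ℝ, Z.PosSemidef → Z ∈ H → l Z = ∑ i, ∑ j, A i j * Z i j + c := by
  by_cases hne : ∃ Z : Matrix ι ι ℝ, Z.PosSemidef ∧ Z ∈ H
  swap
  · exact ⟨0, Matrix.PosSemidef.zero, 0, le_rfl, fun Z h1 h2 => (hne ⟨Z, h1, h2⟩).elim⟩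
  obtain ⟨Z₀, ⟨hZ₀, hZ₀H⟩, hker⟩ : ∃ Z₀ : Matrix ι ι ℝ, (Z₀.PosSemidef ∧ Z₀ ∈ H) ∧
      ∀ Z : Matrix ι ι ℝ, Z.PosSemidef → Z ∈ H → ∀ v, Z₀.mulVec v = 0 → Z.mulVec v = 0 := by
    obtain ⟨W, hW, hmin⟩ := exists_ker_minimal (κ := Unit)
      {W : Unit → Matrix ι ι ℝ | (W ()).PosSemidef ∧ W () ∈ H}
      (let ⟨Z, hZ⟩ := hne; ⟨fun _ => Z, hZ⟩) (fun Z hZ _ => hZ.1) (by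
        rintro Z ⟨h1, h2⟩ Z' ⟨h3, h4⟩
        refine ⟨(h1.add h3).smul (by norm_num : (0 : ℝ) ≤ 1 / 2), ?_⟩
        have : ((1 / 2 : ℝ) • (Z + Z')) () = AffineMap.lineMap (Z ()) (Z' ()) (1 / 2 : ℝ) := by
          rw [AffineMap.lineMap_apply_module]
          simp only [Pi.smul_apply, Pi.add_apply, smul_add]
          norm_num
        rw [this]
        exact AffineMap.lineMap_mem _ h2 h4)
    exact ⟨W (), hW, fun Z h1 h2 => hmin (fun _ => Z) ⟨h1, h2⟩ ()⟩
  obtain ⟨G, hG⟩ := hZ₀.exists_eq_transpose_mul_self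
  obtain ⟨Y, hY⟩ := G.exists_mul_mul_eq
  have hfix : ∀ Z : Matrix ι ι ℝ, Z.PosSemidef → Z ∈ H →
      G.transpose * (Y.transpose * Z * Y) * G = Z := by
    intro Z h1 h2
    have hs := (Matrix.posSemidef_real_iff.1 h1).1
    exact Matrix.mul_eq_self_of_ker_le hY (hG ▸ hker Z h1 h2) hs
  let cone : PointedCone ℝ (Matrix ι ι ℝ × ℝ) :=
    { carrier := {p | (∀ v, 0 ≤ v ⬝ᵥ p.1.mulVec v) ∧ 0 ≤ p.2}
      add_mem' := fun {p r} hp hr => ⟨fun v => by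
        simp only [Prod.fst_add, Matrix.add_mulVec, dotProduct_add]
        exact add_nonneg (hp.1 v) (hr.1 v), add_nonneg hp.2 hr.2⟩
      zero_mem' := ⟨fun v => by simp, le_rfl⟩
      smul_mem' := fun a p hp => ⟨fun v => by
        change 0 ≤ v ⬝ᵥ ((a : ℝ) • p.1).mulVec v
        rw [Matrix.smul_mulVec, dotProduct_smul]
        exact mul_nonneg a.2 (hp.1 v), mul_nonneg a.2 hp.2⟩ }
  let Φ : Matrix ι ι ℝ →ₗ[ℝ] Matrix ι ι ℝ :=
    { toFun := fun y => G.transpose * y * G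
      map_add' := fun y z => by rw [Matrix.mul_add, Matrix.add_mul]
      map_smul' := fun a y => by simp }
  let Ψ : (Matrix ι ι ℝ × ℝ) →ₗ[ℝ] Matrix ι ι ℝ :=
    Φ ∘ₗ LinearMap.fst ℝ _ _ - LinearMap.smulRight (LinearMap.snd ℝ (Matrix ι ι ℝ) ℝ) Z₀
  let sym : (Matrix ι ι ℝ × ℝ) →ₗ[ℝ] Matrix ι ι ℝ :=
    (Matrix.transposeLinearEquiv ι ι ℝ ℝ).toLinearMap ∘ₗ LinearMap.fst ℝ _ _ - LinearMap.fst ℝ _ _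
  let D : Submodule ℝ (Matrix ι ι ℝ × ℝ) := H.direction.comap Ψ ⊓ LinearMap.ker sym
  have hD : ∀ p : Matrix ι ι ℝ × ℝ, p ∈ D ↔ G.transpose * p.1 * G - p.2 • Z₀ ∈ H.direction ∧
      p.1.transpose = p.1 := by
    intro p
    simp [D, Ψ, Φ, sym, sub_eq_zero]
  let f : (Matrix ι ι ℝ × ℝ) →ₗ.[ℝ] ℝ := ⟨D, (l ∘ₗ Φ ∘ₗ LinearMap.fst ℝ _ _) ∘ₗ D.subtype⟩
  have hpos : ∀ p : Matrix ι ι ℝ × ℝ, p ∈ D → p ∈ cone → 0 < p.2 → 0 ≤ l (Φ p.1) := by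
    intro p hp hc h0
    rw [hD] at hp
    have h1 : (p.2⁻¹ • Φ p.1).PosSemidef := by
      refine Matrix.PosSemidef.smul ?_ (inv_nonneg.2 h0.le)
      rw [Matrix.posSemidef_real_iff]
      refine ⟨?_, fun v => ?_⟩
      · simp only [Φ, LinearMap.coe_mk, AddHom.coe_mk, Matrix.transpose_mul, hp.2,
          Matrix.transpose_transpose, Matrix.mul_assoc]
      · have := hc.1 (G.mulVec v)
        simp only [Φ, LinearMap.coe_mk, AddHom.coe_mk]
        rwa [← Matrix.mulVec_mulVec, ← Matrix.mulVec_mulVec, Matrix.dotProduct_mulVec,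
          Matrix.vecMul_transpose]
    have h2 : p.2⁻¹ • Φ p.1 ∈ H := by
      have := AffineSubspace.vadd_mem_of_mem_direction
        (H.direction.smul_mem p.2⁻¹ hp.1) hZ₀H
      rw [smul_sub, smul_smul, inv_mul_cancel₀ h0.ne', one_smul, vadd_eq_add,
        sub_add_cancel] at this
      exact this
    have h3 := hl _ h1 h2
    rw [map_smul, smul_eq_mul] at h3
    exact nonneg_of_mul_nonneg_right h3 (inv_pos.2 h0)
  have hone : ((1 : Matrix ι ι ℝ), (1 : ℝ)) ∈ D := by
    rw [hD]
    simp [hG]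
  have honec : ((1 : Matrix ι ι ℝ), (1 : ℝ)) ∈ cone :=
    ⟨fun v => by simpa using dotProduct_self_star_nonneg v, zero_le_one⟩
  obtain ⟨g, hgf, hgpos⟩ := riesz_extension cone f (by
    rintro ⟨p, hp⟩ hc
    change 0 ≤ l (Φ p.1)
    by_contra hlt
    push Not at hlt
    obtain ⟨ε, hε, hεl⟩ : ∃ ε : ℝ, 0 < ε ∧ l (Φ p.1) + ε * l (Φ 1) < 0 := by
      refine ⟨-l (Φ p.1) / (2 * (|l (Φ 1)| + 1)), by
        have := abs_nonneg (l (Φ 1)); exact div_pos (by linarith) (by linarith), ?_⟩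
      have h1 : 0 < |l (Φ 1)| + 1 := by have := abs_nonneg (l (Φ 1)); linarith
      have h2 : -l (Φ p.1) / (2 * (|l (Φ 1)| + 1)) * l (Φ 1)
          ≤ -l (Φ p.1) / (2 * (|l (Φ 1)| + 1)) * (|l (Φ 1)| + 1) :=
        mul_le_mul_of_nonneg_left ((le_abs_self _).trans (by linarith))
          (div_nonneg (by linarith) (by linarith))
      have h3 : -l (Φ p.1) / (2 * (|l (Φ 1)| + 1)) * (|l (Φ 1)| + 1) = -l (Φ p.1) / 2 := by
        field_simp
      linarith
    have h1 := hpos (p + ε • ((1 : Matrix ι ι ℝ), (1 : ℝ))) (D.add_mem hp (D.smul_mem _ hone))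
      (cone.add_mem hc (PointedCone.smul_mem cone hε.le honec)) (by
        have := hc.2
        simp only [Prod.snd_add, Prod.smul_snd, smul_eq_mul, mul_one]
        linarith)
    simp only [Prod.fst_add, Prod.smul_fst, map_add, map_smul, smul_eq_mul] at h1
    linarith) (by
    intro y
    obtain ⟨R, hR0, hR⟩ := y.1.exists_abs_dotProduct_mulVec_le
    refine ⟨⟨(R + |y.2|) • ((1 : Matrix ι ι ℝ), (1 : ℝ)), D.smul_mem _ hone⟩, fun v => ?_, ?_⟩
    · simp only [Prod.fst_add, Prod.smul_fst, Matrix.add_mulVec, Matrix.smul_mulVec,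
        Matrix.one_mulVec, dotProduct_add, dotProduct_smul, smul_eq_mul]
      have h0 : 0 ≤ v ⬝ᵥ v := by simpa using dotProduct_self_star_nonneg v
      have h1 := (abs_le.1 (hR v)).1
      have h5 : 0 ≤ |y.2| * (v ⬝ᵥ v) := by positivity
      linarith
    · simp only [Prod.snd_add, Prod.smul_snd, smul_eq_mul, mul_one]
      have := neg_abs_le y.2
      linarith)
  let A₀ : Matrix ι ι ℝ := Matrix.of fun i j =>
    (1 / 2 : ℝ) * (g (Matrix.single i j 1, 0) + g (Matrix.single j i 1, 0))
  have hgsum : ∀ y : Matrix ι ι ℝ, g (y, 0) = ∑ i, ∑ j, y i j * g (Matrix.single i j 1, 0) := by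
    intro y
    have h1 : (y, (0 : ℝ)) = ∑ i, ∑ j, y i j • (Matrix.single i j (1 : ℝ), (0 : ℝ)) := by
      have := Matrix.matrix_eq_sum_single y
      refine Prod.ext ?_ ?_
      · simp only [Prod.fst_sum, Prod.smul_fst, Matrix.smul_single, smul_eq_mul, mul_one]
        exact this
      · simp [Prod.snd_sum]
    rw [h1]
    simp only [map_sum, map_smul, smul_eq_mul]
  have hA₀ : ∀ y : Matrix ι ι ℝ, y.transpose = y → g (y, 0) = ∑ i, ∑ j, A₀ i j * y i j := by
    intro y hy
    have h1 : ∑ i, ∑ j, y i j * g (Matrix.single i j 1, 0)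
        = ∑ i, ∑ j, y i j * g (Matrix.single j i 1, 0) := by
      rw [Finset.sum_comm]
      refine Finset.sum_congr rfl fun i _ => Finset.sum_congr rfl fun j _ => ?_
      rw [← congrFun (congrFun hy i) j, Matrix.transpose_apply]
    have h2 : ∑ i, ∑ j, A₀ i j * y i j
        = (1 / 2) * (∑ i, ∑ j, y i j * g (Matrix.single i j 1, 0)
          + ∑ i, ∑ j, y i j * g (Matrix.single j i 1, 0)) := by
      simp only [← Finset.sum_add_distrib, Finset.mul_sum]
      refine Finset.sum_congr rfl fun i _ => Finset.sum_congr rfl fun j _ => ?_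
      simp only [A₀, Matrix.of_apply]; ring
    rw [h2, ← h1, hgsum]; ring
  have hA₀pos : A₀.PosSemidef := by
    rw [Matrix.posSemidef_real_iff]
    refine ⟨?_, fun v => ?_⟩
    · ext i j; simp only [A₀, Matrix.transpose_apply, Matrix.of_apply]; ring
    · have h1 := hgpos (Matrix.vecMulVec v v, 0) ⟨fun w => by
        rw [Matrix.vecMulVec_mulVec]
        simp only [dotProduct_smul, MulOpposite.smul_eq_mul_unop, MulOpposite.unop_op]
        rw [dotProduct_comm w v]
        exact mul_self_nonneg _, le_rfl⟩
      rw [hA₀ _ (Matrix.transpose_vecMulVec v v)] at h1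
      convert h1 using 1
      simp only [dotProduct, Matrix.mulVec, Finset.mul_sum, Matrix.vecMulVec_apply]
      refine Finset.sum_congr rfl fun i _ => Finset.sum_congr rfl fun j _ => ?_
      ring
  obtain ⟨N, hN⟩ := hA₀pos.exists_eq_transpose_mul_self
  refine ⟨(N * Y.transpose).transpose * (N * Y.transpose),
    Matrix.posSemidef_transpose_mul_self _, g (0, 1), hgpos _ ⟨fun v => by simp, zero_le_one⟩,
    fun Z h1 h2 => ?_⟩
  have hs := (Matrix.posSemidef_real_iff.1 h1).1
  have hmem : (Y.transpose * Z * Y, (1 : ℝ)) ∈ D := by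
    rw [hD]
    refine ⟨?_, ?_⟩
    · simp only [hfix Z h1 h2, one_smul]
      exact AffineSubspace.vsub_mem_direction h2 hZ₀H
    · simp only [Matrix.transpose_mul, Matrix.transpose_transpose, hs, Matrix.mul_assoc]
  have h3 : g (Y.transpose * Z * Y, 1) = l Z := by
    rw [hgf ⟨_, hmem⟩]
    change l (Φ (Y.transpose * Z * Y)) = l Z
    rw [← congrArg l (hfix Z h1 h2)]
    rfl
  have h4 : g (Y.transpose * Z * Y, 1) = g (Y.transpose * Z * Y, 0) + g (0, 1) := by
    rw [← map_add]; simp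
  rw [← h3, h4, hA₀ _ ((hD _).1 hmem).2]
  congr 1
  have htr : ∀ P Q : Matrix ι ι ℝ, ∑ i, ∑ j, P i j * Q i j = (P.transpose * Q).trace := by
    intro P Q
    rw [Matrix.trace, Finset.sum_comm]
    simp [Matrix.mul_apply]
  rw [htr, htr, hN]
  simp only [Matrix.transpose_mul, Matrix.transpose_transpose]
  calc _ = (Matrix.transpose N * N * Matrix.transpose Y * Z * Y).trace := by
        simp only [Matrix.mul_assoc]
    _ = (Y * (Matrix.transpose N * N * Matrix.transpose Y * Z)).trace := Matrix.trace_mul_comm _ _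
    _ = _ := by simp only [Matrix.mul_assoc]

theorem Matrix.PosSemidef.blockDiagonal {ι κ : Type*} [Fintype ι] [Fintype κ] [DecidableEq κ]
    {Z : κ → Matrix ι ι ℝ} (hZ : ∀ i, (Z i).PosSemidef) : (Matrix.blockDiagonal Z).PosSemidef := by
  choose M hM using fun i => (hZ i).exists_eq_transpose_mul_self
  have : Matrix.blockDiagonal Z = (Matrix.blockDiagonal M).transpose * Matrix.blockDiagonal M := by
    rw [Matrix.blockDiagonal_transpose, ← Matrix.blockDiagonal_mul]
    exact congrArg _ (funext hM)
  rw [this]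
  exact Matrix.posSemidef_transpose_mul_self _

theorem Matrix.PosSemidef.fromBlocks_one {ι κ : Type*} [Fintype ι] [Fintype κ] [DecidableEq κ]
    {Z : Matrix ι ι ℝ} (hZ : Z.PosSemidef) :
    (Matrix.fromBlocks Z 0 0 (1 : Matrix κ κ ℝ)).PosSemidef := by
  obtain ⟨M, hM⟩ := hZ.exists_eq_transpose_mul_self
  have : Matrix.fromBlocks Z 0 0 (1 : Matrix κ κ ℝ) =
      (Matrix.fromBlocks M 0 0 (1 : Matrix κ κ ℝ)).transpose *
        Matrix.fromBlocks M 0 0 (1 : Matrix κ κ ℝ) := by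
    rw [Matrix.fromBlocks_transpose, Matrix.fromBlocks_multiply]
    simp [hM]
  rw [this]
  exact Matrix.posSemidef_transpose_mul_self _

/-- Trace functionals against positive semidefinite matrices are Gram evaluations at a
common vector. -/
theorem exists_uniform_gram {ι T : Type*} [Fintype ι] [DecidableEq ι]
    (A : T → Matrix ι ι ℝ) (hA : ∀ t, (A t).PosSemidef) (c : T → ℝ) (hc : ∀ t, 0 ≤ c t) :
    ∃ (q : ℕ) (u : T → Fin q → ℝ), ∀ Z : Matrix ι ι ℝ, Z.PosSemidef →
      ∃ B : Matrix (Fin q) (Fin q) ℝ, B.PosSemidef ∧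
        ∀ t, ∑ i, ∑ j, A t i j * Z i j + c t = u t ⬝ᵥ B.mulVec (u t) := by
  choose N hN using fun t => (hA t).exists_eq_transpose_mul_self
  let e := Fintype.equivFin ((ι × ι) ⊕ Unit)
  let w : T → (ι × ι) ⊕ Unit → ℝ := fun t =>
    Sum.elim (fun p => N t p.2 p.1) (fun _ => Real.sqrt (c t))
  refine ⟨_, fun t => w t ∘ e.symm, fun Z hZ => ?_⟩
  refine ⟨(Matrix.fromBlocks (Matrix.blockDiagonal fun _ : ι => Z) 0 0
    (1 : Matrix Unit Unit ℝ)).submatrix e.symm e.symm,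
    (Matrix.PosSemidef.fromBlocks_one (Matrix.PosSemidef.blockDiagonal fun _ => hZ)).submatrix _,
    fun t => ?_⟩
  rw [Matrix.submatrix_mulVec_equiv, dotProduct_comp_equiv_symm]
  have h1 : (w t ∘ e.symm) ∘ e.symm.symm = w t := by
    funext i; simp
  rw [h1, Function.comp_assoc, Equiv.symm_comp_self, Function.comp_id, Matrix.fromBlocks_mulVec]
  simp only [w, Sum.elim_comp_inl, Sum.elim_comp_inr, Matrix.zero_mulVec, add_zero, zero_add,
    Matrix.one_mulVec]
  rw [sumElim_dotProduct_sumElim]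
  simp only [dotProduct, Finset.univ_unique, Finset.sum_const, Finset.card_singleton, one_smul,
    Real.mul_self_sqrt (hc t)]
  congr 1
  rw [hN, Fintype.sum_prod_type_right]
  simp only [Matrix.mulVec, dotProduct, Fintype.sum_prod_type_right, Matrix.blockDiagonal_apply,
    Matrix.mul_apply, Matrix.transpose_apply, Finset.sum_mul, Finset.mul_sum]
  simp only [ite_mul, zero_mul, mul_ite, mul_zero, Finset.sum_ite_eq, Finset.sum_ite_irrel,
    Finset.sum_const_zero, Finset.mem_univ, if_true]
  rw [eq_comm, Finset.sum_comm]
  calc _ = ∑ i, ∑ j, ∑ l, N t l i * N t l j * Z i j := by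
        refine Finset.sum_congr rfl fun i _ => ?_
        rw [Finset.sum_comm]
        exact Finset.sum_congr rfl fun j _ => Finset.sum_congr rfl fun l _ => by ring
    _ = _ := rfl

theorem exists_pointwise_of_hasLift {n d k m : ℕ}
    (h : HasLift (PSDTuple k m) (PosCone n d Set.univ)) :
    ∃ (q : ℕ) (u : (Fin n → ℝ) → Fin q → ℝ), ∀ f ∈ PosCone n d Set.univ,
      ∃ B : Matrix (Fin q) (Fin q) ℝ, B.PosSemidef ∧
        ∀ x, MvPolynomial.eval x f = u x ⬝ᵥ B.mulVec (u x) := by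
  obtain ⟨H, p, hS⟩ := h
  let bd : (Fin m → Matrix (Fin k) (Fin k) ℝ) →ₗ[ℝ] Matrix (Fin k × Fin m) (Fin k × Fin m) ℝ :=
    { toFun := Matrix.blockDiagonal
      map_add' := Matrix.blockDiagonal_add
      map_smul' := Matrix.blockDiagonal_smul }
  let bi : Matrix (Fin k × Fin m) (Fin k × Fin m) ℝ →ₗ[ℝ] (Fin m → Matrix (Fin k) (Fin k) ℝ) :=
    { toFun := Matrix.blockDiag
      map_add' := Matrix.blockDiag_add
      map_smul' := Matrix.blockDiag_smul }
  have hbi : ∀ Z, bi (bd Z) = Z := Matrix.blockDiag_blockDiagonal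
  let l : (Fin n → ℝ) → Matrix (Fin k × Fin m) (Fin k × Fin m) ℝ →ₗ[ℝ] ℝ := fun x =>
    (MvPolynomial.aeval (R := ℝ) x).toLinearMap ∘ₗ p ∘ₗ bi
  have hl : ∀ x Z, Matrix.PosSemidef Z → Z ∈ H.map bd.toAffineMap → 0 ≤ l x Z := by
    intro x Z hZ hZH
    obtain ⟨W, hW, rfl⟩ := (AffineSubspace.mem_map).1 hZH
    have h1 : p W ∈ PosCone n d Set.univ := by
      rw [hS]
      refine ⟨W, ⟨fun i => ?_, hW⟩, rfl⟩
      have := hZ.submatrix (fun a : Fin k => (a, i))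
      convert this using 1
      ext a b
      simp [bd, Matrix.blockDiagonal_apply]
    have := h1.2 x (Set.mem_univ x)
    change 0 ≤ MvPolynomial.aeval x (p (bi (bd W)))
    rwa [hbi, MvPolynomial.aeval_eq_eval]
  choose A hA c hc hAc using fun x => exists_posSemidef_representation _ (l x) (hl x)
  obtain ⟨q, u, hu⟩ := exists_uniform_gram A hA c hc
  refine ⟨q, u, fun f hf => ?_⟩
  rw [hS] at hf
  obtain ⟨W, ⟨hW, hWH⟩, rfl⟩ := hf
  have hbW : (bd W).PosSemidef := Matrix.PosSemidef.blockDiagonal hW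
  obtain ⟨B, hB, hBu⟩ := hu (bd W) hbW
  refine ⟨B, hB, fun x => ?_⟩
  rw [← hBu, ← hAc x _ hbW (AffineSubspace.mem_map_of_mem bd.toAffineMap hWH)]
  change _ = MvPolynomial.aeval x (p (bi (bd W)))
  rw [hbi, MvPolynomial.aeval_eq_eval]

theorem not_hasLift_two_three (k m : ℕ) :
    ¬ HasLift (PSDTuple k m) (PosCone 2 3 Set.univ) := fun h => by
  obtain ⟨q, u, hu⟩ := exists_pointwise_of_hasLift h
  obtain ⟨U, hU⟩ := exists_formal_gram_of_pointwise u hu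
  exact not_forall_exists_formal_gram_motzkin U hU

theorem not_hasLift_three_two (k m : ℕ) :
    ¬ HasLift (PSDTuple k m) (PosCone 3 2 Set.univ) := fun h => by
  obtain ⟨q, u, hu⟩ := exists_pointwise_of_hasLift h
  obtain ⟨U, hU⟩ := exists_formal_gram_of_pointwise u hu
  exact not_forall_exists_formal_gram_choiLam U hU

theorem HasLift.image_inter {W V V' : Type*} [AddCommGroup W] [Module ℝ W] [AddCommGroup V]
    [Module ℝ V] [AddCommGroup V'] [Module ℝ V'] {K : Set W} {S : Set V} (h : HasLift K S)
    (E : Submodule ℝ V) (r : V →ₗ[ℝ] V') : HasLift K (r '' (S ∩ E)) := by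
  obtain ⟨H, p, rfl⟩ := h
  refine ⟨H ⊓ E.toAffineSubspace.comap p.toAffineMap, r ∘ₗ p, ?_⟩
  ext y
  constructor
  · rintro ⟨_, ⟨⟨Z, ⟨hK, hH⟩, rfl⟩, hE⟩, rfl⟩
    exact ⟨Z, ⟨hK, hH, hE⟩, rfl⟩
  · rintro ⟨Z, ⟨hK, hH, hE⟩, rfl⟩
    exact ⟨p Z, ⟨⟨Z, ⟨hK, hH⟩, rfl⟩, hE⟩, rfl⟩

theorem HasLift.posCone_mono {W : Type*} [AddCommGroup W] [Module ℝ W] {K : Set W}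
    {n d n' d' : ℕ} (h : HasLift K (PosCone n d Set.univ)) (hn : n' ≤ n) (hd : d' ≤ d) :
    HasLift K (PosCone n' d' Set.univ) := by
  have hinj : Function.Injective (Fin.castLE hn) := Fin.castLE_injective hn
  suffices hP : PosCone n' d' Set.univ = (MvPolynomial.killCompl hinj).toLinearMap ''
      (PosCone n d Set.univ ∩ ((MvPolynomial.restrictTotalDegree (Fin n') ℝ (2 * d')).map
        (MvPolynomial.rename (R := ℝ) (Fin.castLE hn)).toLinearMap)) by
    rw [hP]
    exact h.image_inter _ _
  refine Set.ext fun g => ?_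
  constructor
  · rintro ⟨h1, h2⟩
    refine ⟨MvPolynomial.rename (Fin.castLE hn) g, ⟨⟨(MvPolynomial.totalDegree_rename_le _ _).trans
      (h1.trans (by omega)), fun x _ => ?_⟩, ?_⟩, MvPolynomial.killCompl_rename_app hinj g⟩
    · rw [MvPolynomial.eval_rename]
      exact h2 _ (Set.mem_univ _)
    · exact ⟨g, (MvPolynomial.mem_restrictTotalDegree _ _ _).2 h1, rfl⟩
  · rintro ⟨_, ⟨⟨-, h2⟩, ⟨g, hg, rfl⟩⟩, rfl⟩
    have h3 : (MvPolynomial.killCompl hinj).toLinearMap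
        ((MvPolynomial.rename (R := ℝ) (Fin.castLE hn)).toLinearMap g) = g :=
      MvPolynomial.killCompl_rename_app hinj g
    rw [h3]
    refine ⟨(MvPolynomial.mem_restrictTotalDegree _ _ _).1 hg, fun x _ => ?_⟩
    obtain ⟨y, hy⟩ := hinj.surjective_comp_right (γ := ℝ) x
    have := h2 y (Set.mem_univ _)
    simp only [AlgHom.toLinearMap_apply] at this
    rwa [MvPolynomial.eval_rename, show y ∘ Fin.castLE hn = x from hy] at this

theorem not_hasLift_posCone {n d : ℕ} (hn : 2 ≤ n) (hd : 2 ≤ d) (hnd : (n, d) ≠ (2, 2))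
    (k m : ℕ) : ¬ HasLift (PSDTuple k m) (PosCone n d Set.univ) := fun h => by
  by_cases h3 : 3 ≤ d
  · exact not_hasLift_two_three k m (h.posCone_mono hn h3)
  · have : n ≠ 2 := fun h' => hnd (by rw [h', show d = 2 by omega])
    exact not_hasLift_three_two k m (h.posCone_mono (by omega) hd)

theorem HasLift.psdTuple_one {V : Type*} [AddCommGroup V] [Module ℝ V] {S : Set V} {k : ℕ}
    (h : HasLift (PSDCone k) S) : HasLift (PSDTuple k 1) S := by
  obtain ⟨H, p, rfl⟩ := h
  let f : (Fin 1 → Matrix (Fin k) (Fin k) ℝ) →ₗ[ℝ] Matrix (Fin k) (Fin k) ℝ := LinearMap.proj 0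
  refine ⟨H.comap f.toAffineMap, p ∘ₗ f, ?_⟩
  ext y
  constructor
  · rintro ⟨Z, ⟨hZ, hH⟩, rfl⟩
    exact ⟨fun _ => Z, ⟨fun _ => hZ, hH⟩, rfl⟩
  · rintro ⟨Z, ⟨hZ, hH⟩, rfl⟩
    exact ⟨Z 0, ⟨hZ 0, hH⟩, rfl⟩

/-- The exponents of the monomials of degree at most `d` in `n` variables. -/
noncomputable def lowExponents (n d : ℕ) : Finset (Fin n →₀ ℕ) :=
  (Finset.range (d + 1)).biUnion fun j => Finset.finsuppAntidiag Finset.univ j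

theorem mem_lowExponents {n d : ℕ} {a : Fin n →₀ ℕ} :
    a ∈ lowExponents n d ↔ (a.sum fun _ e => e) ≤ d := by
  rw [Finsupp.sum_fintype _ _ (by simp)]
  simp [lowExponents, Finset.mem_finsuppAntidiag]

theorem card_lowExponents (n d : ℕ) : (lowExponents n d).card = (n + d).choose n := by
  rw [lowExponents, Finset.card_biUnion]
  · simp only [Finset.card_finsuppAntidiag_nat_eq_multichoose, Finset.card_univ, Fintype.card_fin]
    rw [Nat.sum_range_multichoose, add_comm]
  · intro i _ j _ hij
    refine Finset.disjoint_left.2 fun a ha hb => hij ?_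
    rw [Finset.mem_finsuppAntidiag] at ha hb
    exact ha.1.symm.trans hb.1

/-- The polynomial of degree at most `d` with the given coefficients. -/
noncomputable def lowPoly (n d : ℕ) : (lowExponents n d → ℝ) →ₗ[ℝ] MvPolynomial (Fin n) ℝ :=
  ∑ a, (MvPolynomial.monomial a.1) ∘ₗ LinearMap.proj a

theorem lowPoly_apply {n d : ℕ} (c : lowExponents n d → ℝ) :
    lowPoly n d c = ∑ a, MvPolynomial.monomial a.1 (c a) := by simp [lowPoly]

theorem lowPoly_injective (n d : ℕ) : Function.Injective (lowPoly n d) := by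
  refine (injective_iff_map_eq_zero _).2 fun c h => funext fun a => ?_
  have h1 := congrArg (MvPolynomial.coeff a.1) h
  rw [lowPoly_apply, MvPolynomial.coeff_sum] at h1
  simpa [MvPolynomial.coeff_monomial, Subtype.ext_iff.symm] using h1

theorem totalDegree_lowPoly_le {n d : ℕ} (c : lowExponents n d → ℝ) :
    (lowPoly n d c).totalDegree ≤ d := by
  rw [lowPoly_apply]
  refine MvPolynomial.totalDegree_finsetSum_le fun a _ => ?_
  exact (MvPolynomial.totalDegree_monomial_le _ _).trans (mem_lowExponents.1 a.2)

theorem exists_lowPoly_eq {n d : ℕ} {g : MvPolynomial (Fin n) ℝ} (hg : g.totalDegree ≤ d) :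
    ∃ c, lowPoly n d c = g := by
  refine ⟨fun a => g.coeff a.1, ?_⟩
  rw [lowPoly_apply, Finset.sum_coe_sort (lowExponents n d)
    fun a => MvPolynomial.monomial a (g.coeff a)]
  conv_rhs => rw [g.as_sum]
  symm
  refine Finset.sum_subset (fun a ha => ?_) fun a _ ha => ?_
  · exact mem_lowExponents.2 ((MvPolynomial.le_totalDegree ha).trans hg)
  · rw [MvPolynomial.notMem_support_iff.1 ha, map_zero]

/-- Fewer than `C(n+d,n)` points are contained in a hypersurface of degree at most `d`. -/
theorem MvPolynomial.exists_ne_zero_eval_eq_zero {n d : ℕ} (S : Finset (Fin n → ℝ))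
    (hS : S.card < (n + d).choose n) :
    ∃ g : MvPolynomial (Fin n) ℝ, g ≠ 0 ∧ g.totalDegree ≤ d ∧
      ∀ y ∈ S, MvPolynomial.eval y g = 0 := by
  let E : MvPolynomial (Fin n) ℝ →ₗ[ℝ] (S → ℝ) :=
    LinearMap.pi fun y => (MvPolynomial.aeval (R := ℝ) y.1).toLinearMap
  have hker : LinearMap.ker (E ∘ₗ lowPoly n d) ≠ ⊥ := LinearMap.ker_ne_bot_of_finrank_lt (by
    simpa [card_lowExponents] using hS)
  obtain ⟨c, hc, hc0⟩ := Submodule.exists_mem_ne_zero_of_ne_bot hker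
  exact ⟨lowPoly n d c, fun h => hc0 (lowPoly_injective n d (by rw [h, map_zero])),
    totalDegree_lowPoly_le c, fun y hy => congrFun (LinearMap.mem_ker.1 hc) ⟨y, hy⟩⟩

/-- An ultrafilter on affine space containing no proper hypersurface. -/
theorem exists_generic_ultrafilter (n : ℕ) : ∃ 𝒰 : Ultrafilter (Fin n → ℝ),
    ∀ g : MvPolynomial (Fin n) ℝ, g ≠ 0 → ∀ᶠ x in 𝒰, MvPolynomial.eval x g ≠ 0 := by
  let f : Filter (Fin n → ℝ) := ⨅ g : {g : MvPolynomial (Fin n) ℝ // g ≠ 0},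
    Filter.principal {x | MvPolynomial.eval x g.1 ≠ 0}
  have : Nonempty {g : MvPolynomial (Fin n) ℝ // g ≠ 0} := ⟨⟨1, one_ne_zero⟩⟩
  have : f.NeBot := by
    refine Filter.iInf_neBot_of_directed ?_ fun g => ?_
    · intro g h
      refine ⟨⟨g.1 * h.1, mul_ne_zero g.2 h.2⟩, ?_, ?_⟩ <;>
      · refine Filter.principal_mono.2 fun x hx => ?_
        simp only [Set.mem_ofPred_eq, map_mul] at hx ⊢
        first | exact left_ne_zero_of_mul hx | exact right_ne_zero_of_mul hx
    · rw [Filter.principal_neBot_iff]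
      by_contra h
      rw [Set.not_nonempty_iff_eq_empty, Set.eq_empty_iff_forall_notMem] at h
      refine g.2 (MvPolynomial.funext fun x => ?_)
      simpa using h x
  exact ⟨Ultrafilter.of f, fun g hg => Ultrafilter.of_le f
    (Filter.mem_iInf_of_mem ⟨g, hg⟩ (Filter.mem_principal_self _))⟩

/-- Finitely many families of subspaces of a `k`-dimensional space are generically contained in
the spans of their members at `k` suitable points. -/
theorem exists_finset_eventually_le_sup {X V κ : Type*} [Finite κ] [AddCommGroup V] [Module ℝ V]
    [FiniteDimensional ℝ V] (𝒰 : Ultrafilter X) (W : κ → X → Submodule ℝ V) :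
    ∃ S : Finset X, S.card ≤ Module.finrank ℝ V ∧ ∀ i, ∀ᶠ x in 𝒰, W i x ≤ S.sup (W i) := by
  classical
  suffices h : ∀ j : ℕ, ∃ S : Finset X, S.card ≤ j ∧ ∀ i, (∀ᶠ x in 𝒰, W i x ≤ S.sup (W i)) ∨
      j ≤ Module.finrank ℝ (S.sup (W i) : Submodule ℝ V) by
    obtain ⟨S, hS, h⟩ := h (Module.finrank ℝ V)
    refine ⟨S, hS, fun i => (h i).elim id fun h1 => ?_⟩
    rw [Submodule.eq_top_of_finrank_eq (le_antisymm (Submodule.finrank_le _) h1)]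
    exact Filter.Eventually.of_forall fun x => le_top
  intro j
  induction j with
  | zero => exact ⟨∅, by simp, fun i => Or.inr (Nat.zero_le _)⟩
  | succ j ih =>
    obtain ⟨S, hS, h⟩ := ih
    have h1 : ∀ᶠ x in 𝒰, ∀ i, (∀ᶠ x in 𝒰, W i x ≤ S.sup (W i)) ∨ ¬ W i x ≤ S.sup (W i) := by
      rw [Filter.eventually_all]
      intro i
      by_cases hi : ∀ᶠ x in 𝒰, W i x ≤ S.sup (W i)
      · exact Filter.Eventually.of_forall fun x => Or.inl hi
      · exact (Ultrafilter.eventually_not.2 hi).mono fun x hx => Or.inr hx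
    obtain ⟨y, hy⟩ := h1.exists
    refine ⟨insert y S, (Finset.card_insert_le _ _).trans (by omega), fun i => ?_⟩
    rw [Finset.sup_insert]
    rcases hy i with hi | hi
    · exact Or.inl (hi.mono fun x hx => hx.trans le_sup_right)
    · rcases h i with h2 | h2
      · exact Or.inl (h2.mono fun x hx => hx.trans le_sup_right)
      · have := Submodule.finrank_lt_finrank_of_lt (right_lt_sup.2 hi)
        exact Or.inr (by omega)

theorem apply_eq_zero_of_ker_le {k m : ℕ}
    {H : AffineSubspace ℝ (Fin m → Matrix (Fin k) (Fin k) ℝ)}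
    (l : (Fin m → Matrix (Fin k) (Fin k) ℝ) →ₗ[ℝ] ℝ)
    (hl : ∀ Z ∈ PSDTuple k m ∩ H, 0 ≤ l Z) {Z₀ Z : Fin m → Matrix (Fin k) (Fin k) ℝ}
    (hZ₀ : Z₀ ∈ PSDTuple k m ∩ H) (hZ : Z ∈ PSDTuple k m ∩ H) (h0 : l Z₀ = 0)
    (hker : ∀ i v, (Z₀ i).mulVec v = 0 → (Z i).mulVec v = 0) : l Z = 0 := by
  choose R hR0 hR using fun i => (hZ₀.1 i).exists_smul_sub_posSemidef (hZ.1 i) (hker i)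
  obtain ⟨r, hr⟩ : ∃ r : ℝ, ∀ i, R i ≤ r :=
    ⟨∑ i, R i, fun i => Finset.single_le_sum (fun i _ => hR0 i) (Finset.mem_univ i)⟩
  set s := |r| + 1
  have hs : 0 < s := by positivity
  have hT : AffineMap.lineMap Z₀ Z (-s⁻¹) ∈ PSDTuple k m ∩ H := by
    refine ⟨fun i => ?_, AffineMap.lineMap_mem _ hZ₀.2 hZ.2⟩
    have h1 := (hR i (s + 1)
        ((hr i).trans ((le_abs_self r).trans (by simp only [s]; linarith)))).smul
      (inv_nonneg.2 hs.le)
    convert h1 using 1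
    rw [AffineMap.lineMap_apply_module, smul_sub, smul_smul, mul_add, inv_mul_cancel₀ hs.ne']
    rw [neg_smul]
    simp only [Pi.add_apply, Pi.neg_apply, Pi.smul_apply, neg_neg, mul_one, sub_eq_add_neg]
  have h2 := hl _ hT
  rw [AffineMap.lineMap_apply_module, map_add, map_smul, map_smul, h0, smul_zero, zero_add,
    smul_eq_mul] at h2
  have h3 := hl _ hZ
  have h4 := inv_pos.2 hs
  nlinarith

theorem choose_le_of_hasLift {n d k m : ℕ}
    (h : HasLift (PSDTuple k m) (PosCone n d Set.univ)) : (n + d).choose n ≤ k := by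
  by_contra hk
  push Not at hk
  obtain ⟨H, p, hS⟩ := h
  let l : (Fin n → ℝ) → (Fin m → Matrix (Fin k) (Fin k) ℝ) →ₗ[ℝ] ℝ := fun x =>
    (MvPolynomial.aeval (R := ℝ) x).toLinearMap ∘ₗ p
  have hl : ∀ x Z, l x Z = MvPolynomial.eval x (p Z) := fun x Z => by
    simp [l, MvPolynomial.aeval_eq_eval]
  have hpos : ∀ x, ∀ Z ∈ PSDTuple k m ∩ H, 0 ≤ l x Z := fun x Z hZ => by
    have h1 : p Z ∈ PosCone n d Set.univ := by rw [hS]; exact ⟨Z, hZ, rfl⟩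
    rw [hl]
    exact h1.2 x (Set.mem_univ x)
  have hex : ∀ x, ∃ Z₀ ∈ {Z | Z ∈ PSDTuple k m ∩ H ∧ l x Z = 0},
      ∀ Z ∈ {Z | Z ∈ PSDTuple k m ∩ H ∧ l x Z = 0}, ∀ i v,
        (Z₀ i).mulVec v = 0 → (Z i).mulVec v = 0 := fun x => by
    refine exists_ker_minimal _ ?_ (fun Z hZ => hZ.1.1) ?_
    · have h0 : (0 : MvPolynomial (Fin n) ℝ) ∈ PosCone n d Set.univ := ⟨by simp, by simp⟩
      rw [hS] at h0
      obtain ⟨Z, hZ, hZ0⟩ := h0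
      exact ⟨Z, hZ, by rw [hl, hZ0, map_zero]⟩
    · rintro Z ⟨h1, h2⟩ Z' ⟨h3, h4⟩
      refine ⟨⟨fun i => ((h1.1 i).add (h3.1 i)).smul (by norm_num : (0 : ℝ) ≤ 1 / 2), ?_⟩, ?_⟩
      · have : (1 / 2 : ℝ) • (Z + Z') = AffineMap.lineMap Z Z' (1 / 2 : ℝ) := by
          rw [AffineMap.lineMap_apply_module, smul_add]
          norm_num
        rw [this]
        exact AffineMap.lineMap_mem _ h1.2 h3.2
      · rw [map_smul, map_add, h2, h4]
        simp
  choose Z₀ hZ₀ hmin using hex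
  obtain ⟨𝒰, h𝒰⟩ := exists_generic_ultrafilter n
  obtain ⟨S, hScard, hSle⟩ := exists_finset_eventually_le_sup 𝒰
    fun (i : Fin m) x => LinearMap.ker (Z₀ x i).mulVecLin
  rw [Module.finrank_fintype_fun_eq_card, Fintype.card_fin] at hScard
  obtain ⟨g, hg0, hgd, hgS⟩ := MvPolynomial.exists_ne_zero_eval_eq_zero S (hScard.trans_lt hk)
  have hgP : g ^ 2 ∈ PosCone n d Set.univ :=
    ⟨(MvPolynomial.totalDegree_pow _ _).trans (Nat.mul_le_mul_left 2 hgd), fun x _ => by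
      rw [map_pow]; exact sq_nonneg _⟩
  rw [hS] at hgP
  obtain ⟨B, hB, hBg⟩ := hgP
  have hBker : ∀ i, S.sup (fun x => LinearMap.ker (Z₀ x i).mulVecLin) ≤
      LinearMap.ker (B i).mulVecLin := fun i => by
    refine Finset.sup_le fun y hy v hv => ?_
    simp only [LinearMap.mem_ker, Matrix.mulVecLin_apply] at hv ⊢
    exact hmin y B ⟨hB, by rw [hl, hBg, map_pow, hgS y hy]; simp⟩ i v hv
  obtain ⟨x, hx, hxg⟩ := ((Filter.eventually_all.2 hSle).and (h𝒰 g hg0)).exists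
  have h1 := apply_eq_zero_of_ker_le (l x) (hpos x) (hZ₀ x).1 hB (hZ₀ x).2 fun i v hv => by
    have := ((hx i).trans (hBker i)) ((LinearMap.mem_ker (f := (Z₀ x i).mulVecLin)).2 hv)
    simpa using this
  rw [hl, hBg, map_pow] at h1
  exact hxg (pow_eq_zero_iff two_ne_zero |>.1 h1)

/-- The monomials of degree at most `d`, evaluated at `x`. -/
noncomputable def lowMonomials (n d : ℕ) (x : Fin n → ℝ) : lowExponents n d → ℝ :=
  fun a => MvPolynomial.eval x (MvPolynomial.monomial a.1 1)

theorem eval_lowPoly {n d : ℕ} (c : lowExponents n d → ℝ) (x : Fin n → ℝ) :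
    MvPolynomial.eval x (lowPoly n d c) = c ⬝ᵥ lowMonomials n d x := by
  simp [lowPoly_apply, lowMonomials, dotProduct, MvPolynomial.eval_monomial]

/-- The polynomial represented by a Gram matrix. -/
noncomputable def gramPoly (n d : ℕ) :
    Matrix (lowExponents n d) (lowExponents n d) ℝ →ₗ[ℝ] MvPolynomial (Fin n) ℝ :=
  ∑ a, ∑ b, (MvPolynomial.monomial (a.1 + b.1)) ∘ₗ
    LinearMap.proj (φ := fun _ => ℝ) b ∘ₗ LinearMap.proj (φ := fun _ => lowExponents n d → ℝ) a

theorem gramPoly_apply {n d : ℕ} (G : Matrix (lowExponents n d) (lowExponents n d) ℝ) :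
    gramPoly n d G = ∑ a, ∑ b, MvPolynomial.monomial (a.1 + b.1) (G a b) := by
  simp only [gramPoly, LinearMap.sum_apply, LinearMap.comp_apply]
  rfl

theorem eval_gramPoly {n d : ℕ} (G : Matrix (lowExponents n d) (lowExponents n d) ℝ)
    (x : Fin n → ℝ) : MvPolynomial.eval x (gramPoly n d G) =
      lowMonomials n d x ⬝ᵥ G.mulVec (lowMonomials n d x) := by
  simp only [gramPoly_apply, map_sum, dotProduct, Matrix.mulVec, Finset.mul_sum]
  refine Finset.sum_congr rfl fun a _ => Finset.sum_congr rfl fun b _ => ?_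
  rw [lowMonomials, lowMonomials, mul_left_comm, ← map_mul, MvPolynomial.monomial_mul, one_mul]
  conv_lhs => rw [← mul_one (G a b), ← smul_eq_mul, ← MvPolynomial.smul_monomial,
    MvPolynomial.smul_eval]

theorem totalDegree_gramPoly_le {n d : ℕ} (G : Matrix (lowExponents n d) (lowExponents n d) ℝ) :
    (gramPoly n d G).totalDegree ≤ 2 * d := by
  rw [gramPoly_apply]
  refine MvPolynomial.totalDegree_finsetSum_le fun a _ =>
    MvPolynomial.totalDegree_finsetSum_le fun b _ => ?_
  refine (MvPolynomial.totalDegree_monomial_le _ _).trans ?_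
  rw [Finsupp.sum_add_index' (fun _ => rfl) (fun _ _ _ => rfl), two_mul]
  exact add_le_add (mem_lowExponents.1 a.2) (mem_lowExponents.1 b.2)

/-- Every nonzero nonnegative polynomial dominates a nonzero square. -/
def DominatesSquare (n d : ℕ) : Prop :=
  ∀ p ∈ PosCone n d Set.univ, p ≠ 0 → ∃ g : MvPolynomial (Fin n) ℝ, g ≠ 0 ∧ g.totalDegree ≤ d ∧
    ∀ x, MvPolynomial.eval x g ^ 2 ≤ MvPolynomial.eval x p

theorem isCompact_gram_factors {n d : ℕ} (p : MvPolynomial (Fin n) ℝ) :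
    IsCompact {M : lowExponents n d → lowExponents n d → ℝ |
      ∀ x, ∑ i, (M i ⬝ᵥ lowMonomials n d x) ^ 2 ≤ MvPolynomial.eval x p} := by
  classical
  let S : Finset (Fin n → ℝ) :=
    Fintype.piFinset fun _ => (Finset.range (d + 1)).image (Nat.cast : ℕ → ℝ)
  let L : (lowExponents n d → lowExponents n d → ℝ) →ₗ[ℝ] (lowExponents n d → S → ℝ) :=
    LinearMap.pi fun i => (LinearMap.pi fun x : S =>
      (MvPolynomial.aeval (R := ℝ) x.1).toLinearMap) ∘ₗ lowPoly n d ∘ₗ LinearMap.proj i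
  have hLapp : ∀ M i x, L M i x = M i ⬝ᵥ lowMonomials n d x.1 := fun M i x => by
    rw [← eval_lowPoly, ← MvPolynomial.aeval_eq_eval]; rfl
  have hL : LinearMap.ker L = ⊥ := by
    refine LinearMap.ker_eq_bot'.2 fun M hM => funext fun i => ?_
    refine lowPoly_injective n d ?_
    simp only [Pi.zero_apply, map_zero]
    refine MvPolynomial.eq_zero_of_eval_zero_at_prod_finset _
      (fun _ => (Finset.range (d + 1)).image (Nat.cast : ℕ → ℝ)) (fun j => ?_) fun x hx => ?_
    · rw [Finset.card_image_of_injective _ Nat.cast_injective, Finset.card_range]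
      exact Nat.lt_succ_of_le ((MvPolynomial.degreeOf_le_totalDegree _ _).trans
        (totalDegree_lowPoly_le _))
    · have := congrFun (congrFun hM i) ⟨x, Fintype.mem_piFinset.2 hx⟩
      rwa [hLapp, ← eval_lowPoly] at this
  obtain ⟨K, -, hK⟩ := L.exists_antilipschitzWith hL
  refine Metric.isCompact_of_isClosed_isBounded ?_ ?_
  · simp only [dotProduct, Set.ofPred_forall]
    exact isClosed_iInter fun x => isClosed_le (by fun_prop) continuous_const
  · obtain ⟨R, hR⟩ : ∃ R : ℝ, ∀ x ∈ S, |MvPolynomial.eval x p| ≤ R :=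
      ⟨∑ x ∈ S, |MvPolynomial.eval x p|, fun x hx =>
        Finset.single_le_sum (f := fun x => |MvPolynomial.eval x p|) (fun _ _ => abs_nonneg _) hx⟩
    refine (hK.isBounded_preimage (Metric.isBounded_closedBall (x := 0) (r := |R| + 1))).subset ?_
    intro M hM
    have hR1 : 0 ≤ |R| + 1 := by positivity
    rw [Set.mem_preimage, mem_closedBall_zero_iff, pi_norm_le_iff_of_nonneg hR1]
    intro i
    rw [pi_norm_le_iff_of_nonneg hR1]
    intro x
    rw [hLapp, Real.norm_eq_abs]
    have h1 : (M i ⬝ᵥ lowMonomials n d x.1) ^ 2 ≤ ∑ i, (M i ⬝ᵥ lowMonomials n d x.1) ^ 2 :=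
      Finset.single_le_sum (f := fun i => (M i ⬝ᵥ lowMonomials n d x.1) ^ 2)
        (fun _ _ => sq_nonneg _) (Finset.mem_univ i)
    have h2 := hM x.1
    have h3 := (le_abs_self _).trans ((hR x.1 x.2).trans (le_abs_self R))
    exact abs_le_of_sq_le_sq (by nlinarith [abs_nonneg R]) hR1

theorem DominatesSquare.exists_gram {n d : ℕ} (h : DominatesSquare n d)
    {p : MvPolynomial (Fin n) ℝ} (hp : p ∈ PosCone n d Set.univ) :
    ∃ G : Matrix (lowExponents n d) (lowExponents n d) ℝ, G.PosSemidef ∧ gramPoly n d G = p := by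
  have hgram : ∀ (M : lowExponents n d → lowExponents n d → ℝ) x,
      ∑ i, (M i ⬝ᵥ lowMonomials n d x) ^ 2 =
        MvPolynomial.eval x (gramPoly n d ((Matrix.of M).transpose * Matrix.of M)) := by
    intro M x
    rw [eval_gramPoly, Matrix.dotProduct_transpose_mul_mulVec]
    simp only [dotProduct, Matrix.mulVec, Matrix.of_apply, sq]
  obtain ⟨M, hM, hmax⟩ := (isCompact_gram_factors (d := d) p).exists_isMaxOn
    ⟨0, fun x => by simpa using hp.2 x (Set.mem_univ x)⟩
    (f := fun M => ∑ i, ∑ j, M i j ^ 2) (by fun_prop)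
  have htr : ∀ M : lowExponents n d → lowExponents n d → ℝ, ∑ i, ∑ j, M i j ^ 2 =
      ((Matrix.of M).transpose * Matrix.of M).trace := by
    intro M
    rw [Matrix.trace, Finset.sum_comm]
    simp [Matrix.mul_apply, sq]
  refine ⟨_, Matrix.posSemidef_transpose_mul_self (Matrix.of M), ?_⟩
  by_contra hne
  obtain ⟨g, hg0, hgd, hg⟩ := h (p - gramPoly n d ((Matrix.of M).transpose * Matrix.of M))
    ⟨(MvPolynomial.totalDegree_sub _ _).trans (max_le hp.1 (totalDegree_gramPoly_le _)),
      fun x _ => by rw [map_sub, ← hgram]; exact sub_nonneg.2 (hM x)⟩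
    (sub_ne_zero.2 (Ne.symm hne))
  obtain ⟨c, rfl⟩ := exists_lowPoly_eq hgd
  have hc : c ≠ 0 := fun h => hg0 (by rw [h, map_zero])
  have hcc : (Matrix.vecMulVec c c).PosSemidef := by
    simpa using Matrix.posSemidef_vecMulVec_self_star c
  obtain ⟨N, hN⟩ := ((Matrix.posSemidef_transpose_mul_self (Matrix.of M)).add
    hcc).exists_eq_transpose_mul_self
  obtain ⟨M', hM'⟩ : ∃ M' : lowExponents n d → lowExponents n d → ℝ,
      (Matrix.of M).transpose * Matrix.of M + Matrix.vecMulVec c c =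
        (Matrix.of M').transpose * Matrix.of M' := ⟨Matrix.of.symm N, hN⟩
  have hmem : ∀ x, ∑ i, (M' i ⬝ᵥ lowMonomials n d x) ^ 2 ≤ MvPolynomial.eval x p := by
    intro x
    have h1 := hg x
    rw [hgram, ← hM', map_add, map_add, eval_gramPoly (Matrix.vecMulVec c c)]
    rw [map_sub, eval_lowPoly] at h1
    rw [Matrix.vecMulVec_mulVec]
    simp only [dotProduct_smul, MulOpposite.smul_eq_mul_unop, MulOpposite.unop_op]
    rw [dotProduct_comm (lowMonomials n d x) c]
    nlinarith
  have h1 : ∑ i, ∑ j, M' i j ^ 2 ≤ ∑ i, ∑ j, M i j ^ 2 := hmax hmem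
  rw [htr, htr, ← hM', Matrix.trace_add, Matrix.trace_vecMulVec] at h1
  have h2 : 0 < c ⬝ᵥ c := by
    refine lt_of_le_of_ne (by simpa using dotProduct_self_star_nonneg c) fun h => hc ?_
    exact dotProduct_self_eq_zero.1 h.symm
  linarith

theorem DominatesSquare.hasLift {n d : ℕ} (h : DominatesSquare n d) :
    HasLift (PSDCone ((n + d).choose n)) (PosCone n d Set.univ) := by
  let e : lowExponents n d ≃ Fin ((n + d).choose n) :=
    Fintype.equivFinOfCardEq (by simp [card_lowExponents])
  refine ⟨⊤, gramPoly n d ∘ₗ (Matrix.reindexLinearEquiv ℝ ℝ e.symm e.symm).toLinearMap, ?_⟩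
  refine Set.ext fun p => ⟨fun hp => ?_, ?_⟩
  · obtain ⟨G, hG, rfl⟩ := h.exists_gram hp
    refine ⟨Matrix.reindexLinearEquiv ℝ ℝ e e G, ⟨hG.submatrix _, trivial⟩, ?_⟩
    simp
  · rintro ⟨Z, ⟨hZ, -⟩, rfl⟩
    refine ⟨totalDegree_gramPoly_le _, fun x _ => ?_⟩
    simp only [LinearMap.comp_apply]
    rw [eval_gramPoly]
    exact (Matrix.posSemidef_real_iff.1 (hZ.submatrix e)).2 _

theorem Continuous.nonneg_of_forall_ne {X : Type*} [TopologicalSpace X] {a : X}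
    [(nhdsWithin a {a}ᶜ).NeBot] {f : X → ℝ} (hf : Continuous f) (h : ∀ x, x ≠ a → 0 ≤ f x) :
    0 ≤ f a :=
  ge_of_tendsto (hf.continuousAt.tendsto.mono_left nhdsWithin_le_nhds)
    (eventually_nhdsWithin_of_forall h : ∀ᶠ x in nhdsWithin a {a}ᶜ, 0 ≤ f x)

theorem Polynomial.exists_sq_le_of_nonneg (d : ℕ) (P : Polynomial ℝ) (hd : P.natDegree ≤ 2 * d)
    (h0 : P ≠ 0) (hP : ∀ t, 0 ≤ P.eval t) :
    ∃ g : Polynomial ℝ, g ≠ 0 ∧ g.natDegree ≤ d ∧ ∀ t, g.eval t ^ 2 ≤ P.eval t := by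
  induction d generalizing P with
  | zero =>
    have hPC := Polynomial.eq_C_of_natDegree_le_zero (by simpa using hd)
    rw [hPC] at hP h0 ⊢
    have hc : 0 < P.coeff 0 := lt_of_le_of_ne (by simpa using hP 0) fun h => h0 (by simp [← h])
    refine ⟨Polynomial.C √(P.coeff 0), ?_, by simp, fun t => ?_⟩
    · simpa using (Real.sqrt_pos.2 hc).ne'
    · simp [Real.sq_sqrt hc.le]
  | succ d ih =>
    by_cases hr : ∃ a, P.eval a = 0
    · obtain ⟨a, ha⟩ := hr
      obtain ⟨Q, rfl⟩ := Polynomial.dvd_iff_isRoot.2 ha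
      have hQ : Q.eval a = 0 := by
        have hm : IsLocalMin (fun t => ((Polynomial.X - Polynomial.C a) * Q).eval t) a :=
          Filter.Eventually.of_forall fun t => ha.le.trans (hP t)
        have := hm.deriv_eq_zero
        rw [Polynomial.deriv] at this
        simpa [Polynomial.derivative_mul] using this
      obtain ⟨P₁, rfl⟩ := Polynomial.dvd_iff_isRoot.2 hQ
      have h1 : P₁ ≠ 0 := fun h => h0 (by simp [h])
      have hX : (Polynomial.X - Polynomial.C a) ≠ 0 := Polynomial.X_sub_C_ne_zero a
      rw [Polynomial.natDegree_mul hX (mul_ne_zero hX h1), Polynomial.natDegree_mul hX h1,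
        Polynomial.natDegree_X_sub_C] at hd
      have heval : ∀ t, ((Polynomial.X - Polynomial.C a) * ((Polynomial.X - Polynomial.C a)
          * P₁)).eval t = (t - a) ^ 2 * P₁.eval t := fun t => by simp; ring
      have hP₁ : ∀ t, t ≠ a → 0 ≤ P₁.eval t := fun t ht => by
        have := hP t
        rw [heval] at this
        exact nonneg_of_mul_nonneg_right this (by have := sub_ne_zero.2 ht; positivity)
      obtain ⟨g, hg0, hgd, hg⟩ := ih P₁ (by omega) h1 fun t => by
        by_cases ht : t = a
        · exact ht ▸ P₁.continuous.nonneg_of_forall_ne hP₁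
        · exact hP₁ t ht
      refine ⟨(Polynomial.X - Polynomial.C a) * g, mul_ne_zero hX hg0, ?_, fun t => ?_⟩
      · rw [Polynomial.natDegree_mul hX hg0, Polynomial.natDegree_X_sub_C]
        omega
      · rw [heval, Polynomial.eval_mul, mul_pow]
        simpa using mul_le_mul_of_nonneg_left (hg t) (sq_nonneg (t - a))
    · push Not at hr
      obtain ⟨x, hx⟩ := P.exists_forall_norm_le
      have hpos : 0 < P.eval x := lt_of_le_of_ne (hP x) (hr x).symm
      refine ⟨Polynomial.C √(P.eval x), ?_, by simp, fun t => ?_⟩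
      · simpa using (Real.sqrt_pos.2 hpos).ne'
      · have := hx t
        rw [Real.norm_of_nonneg (hP x), Real.norm_of_nonneg (hP t)] at this
        simpa [Real.sq_sqrt hpos.le] using this

theorem MvPolynomial.IsHomogeneous.eval_smul {σ : Type*} [Fintype σ] {f : MvPolynomial σ ℝ} {k : ℕ}
    (hf : f.IsHomogeneous k) (t : ℝ) (v : σ → ℝ) :
    MvPolynomial.eval (t • v) f = t ^ k * MvPolynomial.eval v f := by
  rw [MvPolynomial.eval_eq', MvPolynomial.eval_eq', Finset.mul_sum]
  refine Finset.sum_congr rfl fun c hc => ?_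
  have hk : ∑ i, c i = k := by
    rw [← hf (MvPolynomial.mem_support_iff.1 hc), Finsupp.weight_apply,
      Finsupp.sum_fintype _ _ (by simp)]
    simp
  simp only [Pi.smul_apply, smul_eq_mul, mul_pow, Finset.prod_mul_distrib,
    Finset.prod_pow_eq_pow_sum, hk]
  ring

theorem dominatesSquare_one_left (d : ℕ) : DominatesSquare 1 d := by
  intro p hp hp0
  have hev : ∀ t : ℝ, (MvPolynomial.aeval (fun _ => (Polynomial.X : Polynomial ℝ)) p).eval t
      = MvPolynomial.eval (fun _ => t) p := fun t => by
    have : (Polynomial.aeval t).comp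
        (MvPolynomial.aeval fun _ : Fin 1 => (Polynomial.X : Polynomial ℝ))
        = MvPolynomial.aeval fun _ => t := by
      ext i; simp
    simpa [MvPolynomial.coe_aeval_eq_eval, Polynomial.coe_aeval_eq_eval] using
      DFunLike.congr_fun this p
  have hx : ∀ x : Fin 1 → ℝ, x = fun _ => x 0 := fun x => by
    ext i; rw [Subsingleton.elim i 0]
  obtain ⟨g, hg0, hgd, hg⟩ := Polynomial.exists_sq_le_of_nonneg d
    (MvPolynomial.aeval (fun _ => (Polynomial.X : Polynomial ℝ)) p)
    (by simpa using MvPolynomial.aeval_natDegree_le p hp.1 _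
            (fun _ : Fin 1 => Polynomial.natDegree_X_le (R := ℝ)))
    (fun h => hp0 (MvPolynomial.funext fun x => by rw [hx x, ← hev, h]; simp))
    (fun t => by rw [hev]; exact hp.2 _ trivial)
  have hev' : ∀ x : Fin 1 → ℝ,
      MvPolynomial.eval x (Polynomial.aeval (MvPolynomial.X 0) g) = g.eval (x 0) := fun x => by
    have : (MvPolynomial.aeval x).comp (Polynomial.aeval (MvPolynomial.X (R := ℝ) (0 : Fin 1)))
        = Polynomial.aeval (x 0) := by
      ext; simp
    simpa [MvPolynomial.coe_aeval_eq_eval, Polynomial.coe_aeval_eq_eval] using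
      DFunLike.congr_fun this g
  refine ⟨Polynomial.aeval (MvPolynomial.X 0) g, fun h => hg0 ?_, ?_, fun x => ?_⟩
  · refine Polynomial.funext fun t => ?_
    rw [← hev' fun _ => t, h]
    simp
  · rw [Polynomial.aeval_eq_sum_range]
    refine MvPolynomial.totalDegree_finsetSum_le fun i hi => ?_
    refine (MvPolynomial.totalDegree_smul_le _ _).trans ?_
    refine (MvPolynomial.totalDegree_pow _ _).trans ?_
    rw [MvPolynomial.totalDegree_X]
    have := Finset.mem_range.1 hi
    omega
  · rw [hev', hx x, ← hev]
    exact hg _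

theorem dominatesSquare_one_right (n : ℕ) : DominatesSquare n 1 := by
  intro p hp hp0
  obtain ⟨a, ha⟩ : ∃ a, MvPolynomial.eval a p ≠ 0 := by
    by_contra! h
    exact hp0 (MvPolynomial.funext fun x => by simp [h x])
  have hpos : 0 < MvPolynomial.eval a p := lt_of_le_of_ne (hp.2 a trivial) ha.symm
  set h := MvPolynomial.translate a p with hh
  have hmem := translate_mem_posCone hp a
  set β := MvPolynomial.homogeneousComponent 1 h with hβ
  set γ := MvPolynomial.homogeneousComponent 2 h with hγ
  have hα : MvPolynomial.eval 0 h = MvPolynomial.eval a p := by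
    rw [hh, MvPolynomial.eval_translate, add_zero]
  have hsum : h = MvPolynomial.C (MvPolynomial.eval a p) + β + γ := by
    have h1 := MvPolynomial.sum_homogeneousComponent h
    have h2 : ∑ i ∈ Finset.range 3, MvPolynomial.homogeneousComponent i h = h := by
      conv_rhs => rw [← h1]
      refine (Finset.sum_subset (fun i hi => ?_) fun i _ hi => ?_).symm
      · have := Finset.mem_range.1 hi
        have : h.totalDegree ≤ 2 * 1 := hmem.1
        rw [Finset.mem_range]; omega
      · refine MvPolynomial.homogeneousComponent_eq_zero _ _ ?_
        rw [Finset.mem_range] at hi; omega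
    rw [← h2, Finset.sum_range_succ, Finset.sum_range_succ, Finset.sum_range_one,
      MvPolynomial.homogeneousComponent_zero, ← hα, ← MvPolynomial.constantCoeff_eq,
      MvPolynomial.eval_zero]
  have hscale : ∀ (k : ℕ) (t : ℝ) v,
      MvPolynomial.eval (t • v) (MvPolynomial.homogeneousComponent k h)
      = t ^ k * MvPolynomial.eval v (MvPolynomial.homogeneousComponent k h) := fun k t v =>
    (MvPolynomial.homogeneousComponent_isHomogeneous k h).eval_smul t v
  have hquad : ∀ v, MvPolynomial.eval v β ^ 2
      ≤ 4 * MvPolynomial.eval a p * MvPolynomial.eval v γ := fun v => by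
    have := discrim_le_zero (a := MvPolynomial.eval v γ) (b := MvPolynomial.eval v β)
      (c := MvPolynomial.eval a p) fun t => by
        have := hmem.2 (t • v) trivial
        rw [← hh, hsum, map_add, map_add, MvPolynomial.eval_C, hβ, hγ, hscale, hscale] at this
        linarith
    rw [discrim] at this
    linarith
  have hs := Real.sqrt_pos.2 hpos
  have hs2 := Real.sq_sqrt hpos.le
  set s := √(MvPolynomial.eval a p)
  have hev : ∀ x, MvPolynomial.eval x (MvPolynomial.translate (-a)
      (MvPolynomial.C s + MvPolynomial.C (1 / (2 * s)) * β))
      = s + 1 / (2 * s) * MvPolynomial.eval (-a + x) β := fun x => by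
    rw [MvPolynomial.eval_translate]; simp
  refine ⟨MvPolynomial.translate (-a) (MvPolynomial.C s + MvPolynomial.C (1 / (2 * s)) * β),
    fun h0 => ?_, ?_, fun x => ?_⟩
  · have := hev a
    rw [h0, neg_add_cancel, ← zero_smul ℝ (0 : Fin n → ℝ), hβ, hscale] at this
    simp at this
    exact hs.ne' this.symm
  · refine (MvPolynomial.totalDegree_aeval_le_of_le_one _ (fun i => ?_) _).trans ?_
    · refine (MvPolynomial.totalDegree_add _ _).trans ?_
      rw [MvPolynomial.totalDegree_C, MvPolynomial.totalDegree_X]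
      simp
    · refine (MvPolynomial.totalDegree_add _ _).trans (max_le (by simp) ?_)
      refine (MvPolynomial.totalDegree_mul _ _).trans ?_
      rw [MvPolynomial.totalDegree_C, zero_add]
      exact (MvPolynomial.homogeneousComponent_isHomogeneous 1 h).totalDegree_le
  · have h1 : MvPolynomial.eval x p = MvPolynomial.eval (-a + x) h := by
      rw [hh, MvPolynomial.eval_translate, add_neg_cancel_left]
    rw [hev, h1, hsum]
    have h2 := hquad (-a + x)
    simp only [map_add, MvPolynomial.eval_C]
    have h3 : (1 / (2 * s) * MvPolynomial.eval (-a + x) β) ^ 2 ≤ MvPolynomial.eval (-a + x) γ := by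
      rw [one_div, inv_mul_eq_div, div_pow, div_le_iff₀ (by positivity)]
      linear_combination h2 - 4 * MvPolynomial.eval (-a + x) γ * hs2
    have h4 : 2 * s * (1 / (2 * s) * MvPolynomial.eval (-a + x) β)
        = MvPolynomial.eval (-a + x) β := by field_simp
    nlinarith

/-- A ternary quartic form with coefficients `c i j` at `x ^ i * y ^ j * z ^ (4 - i - j)`. -/
def ternaryQuartic (c : ℕ → ℕ → ℝ) (x y z : ℝ) : ℝ :=
  c 4 0 * x ^ 4 + x ^ 3 * (c 3 1 * y + c 3 0 * z)
    + x ^ 2 * (c 2 2 * y ^ 2 + c 2 1 * (y * z) + c 2 0 * z ^ 2)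
    + x * (c 1 3 * y ^ 3 + c 1 2 * (y ^ 2 * z) + c 1 1 * (y * z ^ 2) + c 1 0 * z ^ 3)
    + (c 0 4 * y ^ 4 + c 0 3 * (y ^ 3 * z) + c 0 2 * (y ^ 2 * z ^ 2) + c 0 1 * (y * z ^ 3)
      + c 0 0 * z ^ 4)

theorem MvPolynomial.IsHomogeneous.eval_eq_ternaryQuartic {P : MvPolynomial (Fin 3) ℝ}
    (hP : P.IsHomogeneous 4) (x y z : ℝ) : MvPolynomial.eval ![x, y, z] P
      = ternaryQuartic (fun i j => P.coeff (expo ![i, j, 4 - i - j])) x y z := by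
  have hsub : P.support ⊆ ((Finset.range 5).sigma fun i => Finset.range (5 - i)).image
      fun p => expo ![p.1, p.2, 4 - p.1 - p.2] := by
    intro c hc
    have hk : c 0 + c 1 + c 2 = 4 := by
      rw [← hP (MvPolynomial.mem_support_iff.1 hc), Finsupp.weight_apply,
        Finsupp.sum_fintype _ _ (by simp), Fin.sum_univ_three]
      simp
    refine Finset.mem_image.2 ⟨⟨c 0, c 1⟩, ?_, ?_⟩
    · simp only [Finset.mem_sigma, Finset.mem_range]
      omega
    · ext i
      fin_cases i <;> simp
      omega
  rw [MvPolynomial.eval_eq', Finset.sum_subset hsub fun c _ hc => by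
    rw [MvPolynomial.notMem_support_iff.1 hc, zero_mul], Finset.sum_image, Finset.sum_sigma]
  · simp [Finset.sum_range_succ, Fin.prod_univ_three, ternaryQuartic]
    ring
  · rintro ⟨i, j⟩ - ⟨i', j'⟩ - h
    have h0 := DFunLike.congr_fun h 0
    have h1 := DFunLike.congr_fun h 1
    simp at h0 h1
    rw [h0, h1]

/-- Functions on `ℝ³` that are quartic forms in all coordinates. -/
def IsTernaryQuartic (F : (Fin 3 → ℝ) → ℝ) : Prop :=
  ∀ u v w : Fin 3 → ℝ, ∃ c : ℕ → ℕ → ℝ, ∀ x y z : ℝ,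
    F (x • u + y • v + z • w) = ternaryQuartic c x y z

theorem MvPolynomial.IsHomogeneous.isTernaryQuartic {P : MvPolynomial (Fin 3) ℝ}
    (hP : P.IsHomogeneous 4) : IsTernaryQuartic fun v => MvPolynomial.eval v P := by
  intro u v w
  let g : Fin 3 → MvPolynomial (Fin 3) ℝ := fun i =>
    MvPolynomial.C (u i) * MvPolynomial.X 0 + MvPolynomial.C (v i) * MvPolynomial.X 1
      + MvPolynomial.C (w i) * MvPolynomial.X 2
  have hg : (MvPolynomial.aeval g P).IsHomogeneous 4 := by
    have := hP.aeval g (n := 1) fun i => by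
      refine .add (.add ?_ ?_) ?_ <;> exact MvPolynomial.isHomogeneous_C_mul_X _ _
    simpa using this
  refine ⟨_, fun x y z => Eq.trans ?_ (hg.eval_eq_ternaryQuartic x y z)⟩
  have : (MvPolynomial.aeval ![x, y, z]).comp (MvPolynomial.aeval g)
      = MvPolynomial.aeval (x • u + y • v + z • w) := by
    ext i
    simp [g]
    ring
  simpa [MvPolynomial.coe_aeval_eq_eval] using (DFunLike.congr_fun this P).symm

/-- `F` dominates the square of a nonzero quadratic form. -/
def DominatesQuadraticSq (F : (Fin 3 → ℝ) → ℝ) : Prop :=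
  ∃ g : MvPolynomial (Fin 3) ℝ, g.IsHomogeneous 2 ∧ g ≠ 0 ∧ ∀ v, MvPolynomial.eval v g ^ 2 ≤ F v

theorem linearIndependent_vec_three_iff {u v w : Fin 3 → ℝ} : LinearIndependent ℝ ![u, v, w] ↔
    ∀ r s t : ℝ, r • u + s • v + t • w = 0 → r = 0 ∧ s = 0 ∧ t = 0 := by
  rw [Fintype.linearIndependent_iff]
  refine ⟨fun h r s t hrst => ?_, fun h g hg i => ?_⟩
  · have := h ![r, s, t] (by simpa [Fin.sum_univ_three] using hrst)
    exact ⟨this 0, this 1, this 2⟩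
  · have := h (g 0) (g 1) (g 2) (by simpa [Fin.sum_univ_three] using hg)
    fin_cases i
    exacts [this.1, this.2.1, this.2.2]

theorem LinearIndependent.exists_linear_coordinates {u v w : Fin 3 → ℝ}
    (h : LinearIndependent ℝ ![u, v, w]) : ∃ B : Matrix (Fin 3) (Fin 3) ℝ, ∀ p : Fin 3 → ℝ,
      p = Matrix.mulVec B p 0 • u + Matrix.mulVec B p 1 • v + Matrix.mulVec B p 2 • w := by
  have hu : IsUnit (Matrix.of ![u, v, w]) := Matrix.linearIndependent_rows_iff_isUnit.1 h
  refine ⟨Matrix.transpose (Matrix.of ![u, v, w])⁻¹, fun p => ?_⟩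
  have h1 : Matrix.vecMul (Matrix.vecMul p (Matrix.of ![u, v, w])⁻¹)
      (Matrix.of ![u, v, w]) = p := by
    rw [Matrix.vecMul_vecMul, Matrix.nonsing_inv_mul _ ((Matrix.isUnit_iff_isUnit_det _).1 hu),
      Matrix.vecMul_one]
  rw [Matrix.mulVec_transpose]
  conv_lhs => rw [← h1]
  ext i
  simp [Matrix.vecMul, dotProduct, Fin.sum_univ_three]

/-- A function of three real variables dominates the square of a nonzero quadratic form. -/
def DominatesQuadraticSqCoord (f : ℝ → ℝ → ℝ → ℝ) : Prop :=
  ∃ a b c d e g : ℝ,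
    (∃ x y z, a * x ^ 2 + b * y ^ 2 + c * z ^ 2 + d * (x * y) + e * (x * z) + g * (y * z) ≠ 0) ∧
    ∀ x y z, (a * x ^ 2 + b * y ^ 2 + c * z ^ 2 + d * (x * y) + e * (x * z) + g * (y * z)) ^ 2
      ≤ f x y z

theorem DominatesQuadraticSqCoord.dominatesQuadraticSq {F : (Fin 3 → ℝ) → ℝ} {u v w : Fin 3 → ℝ}
    (h : LinearIndependent ℝ ![u, v, w])
    (hF : DominatesQuadraticSqCoord fun x y z => F (x • u + y • v + z • w)) :
    DominatesQuadraticSq F := by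
  obtain ⟨a, b, c, d, e, g, ⟨x, y, z, hne⟩, hle⟩ := hF
  obtain ⟨B, hB⟩ := h.exists_linear_coordinates
  let ℓ : Fin 3 → MvPolynomial (Fin 3) ℝ := fun i => ∑ j, MvPolynomial.C (B i j) * MvPolynomial.X j
  have hℓ : ∀ i, (ℓ i).IsHomogeneous 1 := fun i =>
    MvPolynomial.IsHomogeneous.sum _ _ _ fun j _ => MvPolynomial.isHomogeneous_C_mul_X _ _
  have hev : ∀ i p, MvPolynomial.eval p (ℓ i) = Matrix.mulVec B p i := fun i p => by
    simp [ℓ, Matrix.mulVec, dotProduct]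
  have hC : ∀ (r : ℝ) (i j : Fin 3), (MvPolynomial.C r * (ℓ i * ℓ j)).IsHomogeneous 2 :=
    fun r i j => by
      simpa using (MvPolynomial.isHomogeneous_C _ r).mul ((hℓ i).mul (hℓ j))
  let G : MvPolynomial (Fin 3) ℝ := MvPolynomial.C a * (ℓ 0 * ℓ 0) + MvPolynomial.C b * (ℓ 1 * ℓ 1)
    + MvPolynomial.C c * (ℓ 2 * ℓ 2) + MvPolynomial.C d * (ℓ 0 * ℓ 1)
    + MvPolynomial.C e * (ℓ 0 * ℓ 2) + MvPolynomial.C g * (ℓ 1 * ℓ 2)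
  have hG : ∀ p, MvPolynomial.eval p G = a * Matrix.mulVec B p 0 ^ 2 + b * Matrix.mulVec B p 1 ^ 2
      + c * Matrix.mulVec B p 2 ^ 2 + d * (Matrix.mulVec B p 0 * Matrix.mulVec B p 1)
      + e * (Matrix.mulVec B p 0 * Matrix.mulVec B p 2)
      + g * (Matrix.mulVec B p 1 * Matrix.mulVec B p 2) := fun p => by
    simp only [G, map_add, map_mul, MvPolynomial.eval_C, hev]
    ring
  refine ⟨G, ?_, fun h0 => hne ?_, fun p => ?_⟩
  · exact .add (.add (.add (.add (.add (hC _ _ _) (hC _ _ _)) (hC _ _ _)) (hC _ _ _)) (hC _ _ _))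
      (hC _ _ _)
  · have h1 := hG (x • u + y • v + z • w)
    have h2 := hB (x • u + y • v + z • w)
    generalize Matrix.mulVec B (x • u + y • v + z • w) = q at h1 h2
    have h3 := linearIndependent_vec_three_iff.1 h (x - q 0) (y - q 1) (z - q 2) (by
      simp only [sub_smul]
      linear_combination (exp := 1) h2)
    rw [h0, map_zero, ← sub_eq_zero.1 h3.1, ← sub_eq_zero.1 h3.2.1, ← sub_eq_zero.1 h3.2.2] at h1
    exact h1.symm
  · rw [hG]
    have := hle (Matrix.mulVec B p 0) (Matrix.mulVec B p 1) (Matrix.mulVec B p 2)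
    dsimp only at this
    rwa [← hB p] at this

theorem exists_mul_le_of_homogeneous {E : Type*} [NormedAddCommGroup E] [NormedSpace ℝ E]
    [ProperSpace E] {k : ℕ} (hk : k ≠ 0) {f g : E → ℝ} (hf : Continuous f) (hg : Continuous g)
    (hfk : ∀ (t : ℝ) v, f (t • v) = t ^ k * f v) (hgk : ∀ (t : ℝ) v, g (t • v) = t ^ k * g v)
    (hpos : ∀ v, v ≠ 0 → 0 < f v) : ∃ ε > 0, ∀ v, ε * g v ≤ f v := by
  have hzero : f 0 = 0 ∧ g 0 = 0 := by
    have h1 := hfk 0 0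
    have h2 := hgk 0 0
    rw [zero_smul, zero_pow hk, zero_mul] at h1 h2
    exact ⟨h1, h2⟩
  have hc := isCompact_sphere (0 : E) 1
  rcases (Metric.sphere (0 : E) 1).eq_empty_or_nonempty with he | hne
  · refine ⟨1, one_pos, fun v => ?_⟩
    have hv : v = 0 := by
      by_contra hv
      have : (‖v‖⁻¹ • v) ∈ Metric.sphere (0 : E) 1 := by
        simp [norm_smul, norm_ne_zero_iff.2 hv]
      rw [he] at this
      exact this
    rw [hv, hzero.1, hzero.2, mul_zero]
  · obtain ⟨a, ha, hamin⟩ := hc.exists_isMinOn hne hf.continuousOn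
    obtain ⟨b, hb, hbmax⟩ := hc.exists_isMaxOn hne hg.abs.continuousOn
    have hfa : 0 < f a := hpos a (ne_zero_of_mem_unit_sphere ⟨a, ha⟩)
    refine ⟨f a / (|g b| + 1), by positivity, fun v => ?_⟩
    by_cases hv : v = 0
    · rw [hv, hzero.1, hzero.2, mul_zero]
    · have hs : (‖v‖⁻¹ • v) ∈ Metric.sphere (0 : E) 1 := by
        simp [norm_smul, norm_ne_zero_iff.2 hv]
      have hv' : v = ‖v‖ • (‖v‖⁻¹ • v) := by
        rw [smul_smul, mul_inv_cancel₀ (norm_ne_zero_iff.2 hv), one_smul]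
      rw [hv', hfk, hgk, mul_left_comm]
      refine mul_le_mul_of_nonneg_left ?_ (by positivity)
      refine le_trans ?_ (hamin hs)
      rw [div_mul_eq_mul_div, div_le_iff₀ (by positivity)]
      refine mul_le_mul_of_nonneg_left ?_ hfa.le
      have := hbmax hs
      simp only [Set.mem_ofPred_eq] at this
      linarith [le_abs_self (g (‖v‖⁻¹ • v))]

theorem eq_zero_of_forall_cubic_nonneg {a b c d : ℝ}
    (h : ∀ x : ℝ, 0 ≤ a * x ^ 3 + b * x ^ 2 + c * x + d) : a = 0 := by
  have key : ∀ {a b c d : ℝ}, 0 < a → ¬ ∀ x : ℝ, 0 ≤ a * x ^ 3 + b * x ^ 2 + c * x + d := by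
    intro a b c d ha h
    set m := (|b| + |c| + |d|) / a + 1 with hm
    have hm1 : 1 ≤ m := by
      have : 0 ≤ (|b| + |c| + |d|) / a := by positivity
      linarith
    have ham : |b| + |c| + |d| < a * m := by
      rw [hm, mul_add, mul_div_cancel₀ _ ha.ne']
      linarith
    have h1 := h (-m)
    have hb : b * m ^ 2 ≤ |b| * m ^ 2 := mul_le_mul_of_nonneg_right (le_abs_self b) (sq_nonneg m)
    have hc : -c * m ≤ |c| * m ^ 2 := by
      have : -c * m ≤ |c| * m := mul_le_mul_of_nonneg_right (neg_le_abs c) (by linarith)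
      nlinarith [abs_nonneg c, mul_nonneg (abs_nonneg c) (sub_nonneg.2 hm1)]
    have hd : d ≤ |d| * m ^ 2 := by
      nlinarith [le_abs_self d, abs_nonneg d, one_le_pow₀ hm1 (n := 2)]
    have : (|b| + |c| + |d|) * m ^ 2 < a * m * m ^ 2 := mul_lt_mul_of_pos_right ham (by positivity)
    nlinarith
  rcases lt_trichotomy a 0 with ha | ha | ha
  · refine absurd (fun x => ?_) (key (a := -a) (b := b) (c := -c) (d := d) (by linarith))
    have := h (-x)
    linarith [this, neg_pow x 3]
  · exact ha
  · exact absurd h (key ha)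

theorem nonneg_and_sq_le_of_forall_quadratic_nonneg {a b c : ℝ}
    (h : ∀ x : ℝ, 0 ≤ a * x ^ 2 + b * x + c) : 0 ≤ a ∧ b ^ 2 ≤ 4 * a * c := by
  have hd : b ^ 2 ≤ 4 * a * c := by
    have := discrim_le_zero (a := a) (b := b) (c := c) fun x => by
      have := h x
      linarith
    rw [discrim] at this
    linarith
  refine ⟨?_, hd⟩
  have hc : 0 ≤ c := by simpa using h 0
  by_contra! ha
  have hc0 : c = 0 := by nlinarith [sq_nonneg b]
  rw [hc0, mul_zero] at hd
  have hb : b = 0 := by nlinarith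
  have := h 1
  rw [hc0, hb] at this
  linarith

theorem exists_binary_quadratic_sq_le {p q r s t : ℝ}
    (hne : ∃ y z, p * y ^ 4 + q * (y ^ 3 * z) + r * (y ^ 2 * z ^ 2) + s * (y * z ^ 3)
      + t * z ^ 4 ≠ 0)
    (h : ∀ y z, 0 ≤ p * y ^ 4 + q * (y ^ 3 * z) + r * (y ^ 2 * z ^ 2) + s * (y * z ^ 3)
      + t * z ^ 4) :
    ∃ a b c : ℝ, (∃ y z, a * y ^ 2 + b * (y * z) + c * z ^ 2 ≠ 0) ∧
      ∀ y z, (a * y ^ 2 + b * (y * z) + c * z ^ 2) ^ 2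
        ≤ p * y ^ 4 + q * (y ^ 3 * z) + r * (y ^ 2 * z ^ 2) + s * (y * z ^ 3) + t * z ^ 4 := by
  let P : Polynomial ℝ := Polynomial.C p * Polynomial.X ^ 4 + Polynomial.C q * Polynomial.X ^ 3
    + Polynomial.C r * Polynomial.X ^ 2 + Polynomial.C s * Polynomial.X + Polynomial.C t
  have hP : ∀ x, P.eval x = p * x ^ 4 + q * x ^ 3 + r * x ^ 2 + s * x + t := fun x => by
    simp [P]
  have hscale : ∀ y z, z ≠ 0 → p * y ^ 4 + q * (y ^ 3 * z) + r * (y ^ 2 * z ^ 2) + s * (y * z ^ 3)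
      + t * z ^ 4 = z ^ 4 * P.eval (y / z) := fun y z hz => by
    rw [hP]
    field_simp
  have hcont : ∀ y, ∀ f : ℝ → ℝ → ℝ, (Continuous fun z => f y z) →
      (∀ z, z ≠ 0 → 0 ≤ f y z) → ∀ z, 0 ≤ f y z := fun y f hf h z => by
    by_cases hz : z = 0
    · exact hz ▸ hf.nonneg_of_forall_ne h
    · exact h z hz
  obtain ⟨g, hg0, hgd, hg⟩ := P.exists_sq_le_of_nonneg 2
    (by simp only [P]; compute_degree) (fun h0 => by
      obtain ⟨y, z, hyz⟩ := hne
      have hzero : ∀ z, z ≠ 0 → p * y ^ 4 + q * (y ^ 3 * z) + r * (y ^ 2 * z ^ 2)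
          + s * (y * z ^ 3) + t * z ^ 4 = 0 := fun z hz => by rw [hscale y z hz, h0]; simp
      have h1 := hcont y (fun y z => -(p * y ^ 4 + q * (y ^ 3 * z) + r * (y ^ 2 * z ^ 2)
          + s * (y * z ^ 3) + t * z ^ 4)) (by fun_prop) (fun z hz => by
            simp only [hzero z hz]; simp) z
      exact hyz (le_antisymm (by linarith) (h y z)))
    (fun x => by
      have := h x 1
      rw [hP]
      linarith)
  have hgx : ∀ x, g.eval x = g.coeff 2 * x ^ 2 + g.coeff 1 * x + g.coeff 0 := fun x => by
    rw [Polynomial.eval_eq_sum_range' (Nat.lt_succ_of_le hgd)]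
    simp [Finset.sum_range_succ]
    ring
  refine ⟨g.coeff 2, g.coeff 1, g.coeff 0, ?_, fun y z => ?_⟩
  · by_contra! h0
    refine hg0 (Polynomial.funext fun x => ?_)
    have := h0 x 1
    rw [hgx, Polynomial.eval_zero]
    linarith
  · have := hcont y (fun y z => p * y ^ 4 + q * (y ^ 3 * z) + r * (y ^ 2 * z ^ 2) + s * (y * z ^ 3)
      + t * z ^ 4 - (g.coeff 2 * y ^ 2 + g.coeff 1 * (y * z) + g.coeff 0 * z ^ 2) ^ 2) (by fun_prop)
      (fun z hz => by
        have h1 : g.coeff 2 * y ^ 2 + g.coeff 1 * (y * z) + g.coeff 0 * z ^ 2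
            = z ^ 2 * g.eval (y / z) := by
          rw [hgx]
          field_simp
        rw [hscale y z hz, h1, mul_pow, ← pow_mul, ← mul_sub]
        exact mul_nonneg (by positivity) (sub_nonneg.2 (hg _))) z
    exact sub_nonneg.1 this

theorem quartic_coeff_eq_zero_of_linear {a b c d e α β : ℝ}
    (h : ∀ t : ℝ, a * t ^ 4 + b * t ^ 3 + c * t ^ 2 + d * t + e = α * t + β) :
    a = 0 ∧ b = 0 ∧ c = 0 := by
  have h0 := h 0
  have h1 := h 1
  have h2 := h (-1)
  have h3 := h 2
  have h4 := h (-2)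
  norm_num at h0 h1 h2 h3 h4
  refine ⟨?_, ?_, ?_⟩ <;> linarith

/-- A nonnegative quartic form that is affine along a line through a zero. -/
theorem dominatesQuadraticSqCoord_of_affine {c : ℕ → ℕ → ℝ}
    (hne : ∃ x y z, ternaryQuartic c x y z ≠ 0)
    (h : ∀ x y z, 0 ≤ ternaryQuartic c x y z)
    (haff : ∃ α β : ℝ, ∀ t, ternaryQuartic c t 0 1 = α * t + β) :
    DominatesQuadraticSqCoord (ternaryQuartic c) := by
  obtain ⟨α, β, haff⟩ := haff
  obtain ⟨h40, h30, h20⟩ : c 4 0 = 0 ∧ c 3 0 = 0 ∧ c 2 0 = 0 :=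
    quartic_coeff_eq_zero_of_linear (d := c 1 0) (e := c 0 0) (α := α) (β := β) fun t => by
      rw [← haff, ternaryQuartic]
      ring
  have h31 : c 3 1 = 0 := eq_zero_of_forall_cubic_nonneg (b := c 2 2) (c := c 1 3) (d := c 0 4)
    fun x => by
      have := h x 1 0
      simp only [ternaryQuartic, h40] at this
      linarith
  have hq : ∀ y z, 0 ≤ c 2 2 * y ^ 2 + c 2 1 * (y * z) ∧
      (c 1 3 * y ^ 3 + c 1 2 * (y ^ 2 * z) + c 1 1 * (y * z ^ 2) + c 1 0 * z ^ 3) ^ 2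
        ≤ 4 * (c 2 2 * y ^ 2 + c 2 1 * (y * z)) *
          (c 0 4 * y ^ 4 + c 0 3 * (y ^ 3 * z) + c 0 2 * (y ^ 2 * z ^ 2) + c 0 1 * (y * z ^ 3)
      + c 0 0 * z ^ 4) := fun y z =>
    nonneg_and_sq_le_of_forall_quadratic_nonneg fun x => by
      have := h x y z
      simp only [ternaryQuartic, h40, h30, h31, h20] at this
      linarith
  have ha : 0 ≤ c 2 2 := by simpa using (hq 1 0).1
  have h21 : c 2 1 = 0 := by
    have := (nonneg_and_sq_le_of_forall_quadratic_nonneg (a := 0) (b := c 2 1) (c := c 2 2)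
      fun t => by linarith [(hq 1 t).1]).2
    nlinarith
  have h10 : c 1 0 = 0 := by
    have := (hq 0 1).2
    norm_num at this
    nlinarith
  simp only [h21, h10, zero_mul, add_zero] at hq
  have hf : ∀ x y z, ternaryQuartic c x y z = x ^ 2 * (c 2 2 * y ^ 2)
      + x * (y * (c 1 3 * y ^ 2 + c 1 2 * (y * z) + c 1 1 * z ^ 2))
      + (c 0 4 * y ^ 4 + c 0 3 * (y ^ 3 * z) + c 0 2 * (y ^ 2 * z ^ 2) + c 0 1 * (y * z ^ 3)
      + c 0 0 * z ^ 4) := fun x y z => by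
    simp only [ternaryQuartic, h40, h30, h31, h20, h21, h10]
    ring
  rcases ha.eq_or_lt with ha0 | ha0
  · have hf' : ∀ x y z, ternaryQuartic c x y z = c 0 4 * y ^ 4 + c 0 3 * (y ^ 3 * z)
        + c 0 2 * (y ^ 2 * z ^ 2) + c 0 1 * (y * z ^ 3) + c 0 0 * z ^ 4 := fun x y z => by
      have h1 := (hq y z).2
      rw [← ha0, zero_mul, mul_zero, zero_mul] at h1
      have h2 := pow_eq_zero_iff two_ne_zero |>.1 (le_antisymm h1 (sq_nonneg _))
      rw [hf, ← ha0]
      linear_combination x * h2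
    obtain ⟨x, y, z, hxyz⟩ := hne
    obtain ⟨a, b, e, ⟨y', z', hn⟩, hle⟩ := exists_binary_quadratic_sq_le
      ⟨y, z, by rwa [← hf' x]⟩ (fun y z => by rw [← hf' 0]; exact h _ _ _)
    refine ⟨0, a, e, 0, 0, b, ⟨0, y', z', fun h0 => hn (by linarith)⟩, fun x y z => ?_⟩
    rw [hf']
    refine le_trans (le_of_eq ?_) (hle y z)
    ring
  · have hp : ∀ y z, (c 1 3 * y ^ 2 + c 1 2 * (y * z) + c 1 1 * z ^ 2) ^ 2 ≤ 4 * c 2 2 *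
        (c 0 4 * y ^ 4 + c 0 3 * (y ^ 3 * z) + c 0 2 * (y ^ 2 * z ^ 2) + c 0 1 * (y * z ^ 3)
          + c 0 0 * z ^ 4) := by
      intro y z
      have hy : ∀ y : ℝ, y ≠ 0 → 0 ≤ 4 * c 2 2 *
        (c 0 4 * y ^ 4 + c 0 3 * (y ^ 3 * z) + c 0 2 * (y ^ 2 * z ^ 2) + c 0 1 * (y * z ^ 3)
          + c 0 0 * z ^ 4) - (c 1 3 * y ^ 2 + c 1 2 * (y * z) + c 1 1 * z ^ 2) ^ 2 := fun y hy => by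
        have h1 := (hq y z).2
        have h2 : 0 < y ^ 2 := by positivity
        refine nonneg_of_mul_nonneg_right (a := y ^ 2) ?_ h2
        linarith
      by_cases hy0 : y = 0
      · refine sub_nonneg.1 ?_
        rw [hy0]
        exact Continuous.nonneg_of_forall_ne (f := fun y : ℝ => 4 * c 2 2 *
          (c 0 4 * y ^ 4 + c 0 3 * (y ^ 3 * z) + c 0 2 * (y ^ 2 * z ^ 2) + c 0 1 * (y * z ^ 3)
          + c 0 0 * z ^ 4) - (c 1 3 * y ^ 2 + c 1 2 * (y * z) + c 1 1 * z ^ 2) ^ 2) (by fun_prop) hy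
      · exact sub_nonneg.1 (hy y hy0)
    have hs := Real.sqrt_pos.2 ha0
    have hs2 := Real.sq_sqrt ha
    set s := √(c 2 2)
    refine ⟨0, c 1 3 / (2 * s), c 1 1 / (2 * s), s, 0, c 1 2 / (2 * s), ?_, fun x y z => ?_⟩
    · by_contra! h0
      have h1 := h0 1 1 0
      have h2 := h0 (-1) 1 0
      linarith
    · have h1 := hp y z
      have h2 : ((c 1 3 * y ^ 2 + c 1 2 * (y * z) + c 1 1 * z ^ 2) / (2 * s)) ^ 2
          ≤ c 0 4 * y ^ 4 + c 0 3 * (y ^ 3 * z) + c 0 2 * (y ^ 2 * z ^ 2) + c 0 1 * (y * z ^ 3)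
          + c 0 0 * z ^ 4 := by
        rw [div_pow, div_le_iff₀ (by positivity), mul_pow, hs2]
        linarith
      rw [hf]
      calc _ = x ^ 2 * (s ^ 2 * y ^ 2)
            + x * (y * (c 1 3 * y ^ 2 + c 1 2 * (y * z) + c 1 1 * z ^ 2))
            + ((c 1 3 * y ^ 2 + c 1 2 * (y * z) + c 1 1 * z ^ 2) / (2 * s)) ^ 2 := by
            field_simp
            ring
        _ ≤ _ := by rw [hs2]; linarith

theorem exists_linearIndependent_vec_three {u v : Fin 3 → ℝ} (h : LinearIndependent ℝ ![u, v]) :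
    ∃ w, LinearIndependent ℝ ![u, v, w] := by
  obtain ⟨w, hw⟩ := exists_linearIndependent_snoc_of_lt_finrank h
    (by rw [Module.finrank_fin_fun]; norm_num)
  refine ⟨w, ?_⟩
  have : Fin.snoc ![u, v] w = ![u, v, w] := by
    ext i j
    fin_cases i <;> simp [Fin.snoc]
  rwa [this] at hw

theorem exists_linearIndependent_vec_two {u : Fin 3 → ℝ} (h : u ≠ 0) :
    ∃ v, LinearIndependent ℝ ![u, v] := by
  obtain ⟨w, hw⟩ := exists_linearIndependent_snoc_of_lt_finrank (v := ![u])
    (LinearIndependent.of_subsingleton 0 h) (by rw [Module.finrank_fin_fun]; norm_num)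
  refine ⟨w, ?_⟩
  have : Fin.snoc ![u] w = ![u, w] := by
    ext i j
    fin_cases i <;> simp [Fin.snoc]
  rwa [this] at hw

theorem IsTernaryQuartic.exists_coord_ne_zero {F : (Fin 3 → ℝ) → ℝ} (hne : ∃ v, F v ≠ 0)
    {u v w : Fin 3 → ℝ} (h : LinearIndependent ℝ ![u, v, w]) :
    ∃ x y z : ℝ, F (x • u + y • v + z • w) ≠ 0 := by
  obtain ⟨p, hp⟩ := hne
  obtain ⟨B, hB⟩ := h.exists_linear_coordinates
  exact ⟨_, _, _, by rwa [← hB p]⟩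

theorem IsTernaryQuartic.dominatesQuadraticSq_of_affine {F : (Fin 3 → ℝ) → ℝ}
    (hF : IsTernaryQuartic F) (hpos : ∀ v, 0 ≤ F v) (hne : ∃ v, F v ≠ 0) {u w : Fin 3 → ℝ}
    (huw : LinearIndependent ℝ ![u, w]) (haff : ∃ α β : ℝ, ∀ t : ℝ, F (t • u + w) = α * t + β) :
    DominatesQuadraticSq F := by
  obtain ⟨v, huwv⟩ := exists_linearIndependent_vec_three huw
  have h : LinearIndependent ℝ ![u, v, w] := linearIndependent_vec_three_iff.2 fun r s t hrst => by
    obtain ⟨h1, h2, h3⟩ := linearIndependent_vec_three_iff.1 huwv r t s (by rw [← hrst]; abel)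
    exact ⟨h1, h3, h2⟩
  obtain ⟨c, hc⟩ := hF u v w
  refine DominatesQuadraticSqCoord.dominatesQuadraticSq h ?_
  simp only [hc]
  refine dominatesQuadraticSqCoord_of_affine ?_ (fun x y z => hc x y z ▸ hpos _) ?_
  · simp only [← hc]
    exact IsTernaryQuartic.exists_coord_ne_zero hne h
  · obtain ⟨α, β, haff⟩ := haff
    exact ⟨α, β, fun t => by rw [← hc, ← haff]; simp⟩

theorem linearIndependent_pair_of_vec_three {u v w : Fin 3 → ℝ}
    (h : LinearIndependent ℝ ![u, v, w]) {x y z : ℝ} (hyz : (y, z) ≠ 0) :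
    LinearIndependent ℝ ![u, x • u + y • v + z • w] := by
  rw [LinearIndependent.pair_iff]
  intro s t hst
  obtain ⟨h1, h2, h3⟩ := linearIndependent_vec_three_iff.1 h (s + t * x) (t * y) (t * z) (by
    rw [← hst]
    module)
  have ht : t = 0 := by
    by_contra ht
    refine hyz (Prod.ext ?_ ?_)
    · exact (mul_eq_zero.1 h2).resolve_left ht
    · exact (mul_eq_zero.1 h3).resolve_left ht
  exact ⟨by simpa [ht] using h1, ht⟩

theorem IsTernaryQuartic.dominatesQuadraticSq_or_exists_zero {F : (Fin 3 → ℝ) → ℝ}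
    (hF : IsTernaryQuartic F) (hpos : ∀ v, 0 ≤ F v) (hne : ∃ v, F v ≠ 0) {u : Fin 3 → ℝ}
    (hu : u ≠ 0) (hFu : F u = 0) :
    DominatesQuadraticSq F ∨ ∃ w, LinearIndependent ℝ ![u, w] ∧ F w = 0 := by
  obtain ⟨v, huv⟩ := exists_linearIndependent_vec_two hu
  obtain ⟨w, h⟩ := exists_linearIndependent_vec_three huv
  obtain ⟨c, hc⟩ := hF u v w
  have hc0 : ∀ x y z, 0 ≤ ternaryQuartic c x y z := fun x y z => hc x y z ▸ hpos _
  have h40 : c 4 0 = 0 := by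
    have := hc 1 0 0
    simpa [hFu, ternaryQuartic] using this.symm
  have h31 : c 3 1 = 0 := eq_zero_of_forall_cubic_nonneg (b := c 2 2) (c := c 1 3) (d := c 0 4)
    fun x => by
      have := hc0 x 1 0
      simp only [ternaryQuartic, h40] at this
      linarith
  have h30 : c 3 0 = 0 := eq_zero_of_forall_cubic_nonneg (b := c 2 0) (c := c 1 0) (d := c 0 0)
    fun x => by
      have := hc0 x 0 1
      simp only [ternaryQuartic, h40] at this
      linarith
  set q2 : ℝ × ℝ → ℝ := fun p => c 2 2 * p.1 ^ 2 + c 2 1 * (p.1 * p.2) + c 2 0 * p.2 ^ 2 with hq2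
  set q3 : ℝ × ℝ → ℝ := fun p => c 1 3 * p.1 ^ 3 + c 1 2 * (p.1 ^ 2 * p.2)
    + c 1 1 * (p.1 * p.2 ^ 2) + c 1 0 * p.2 ^ 3 with hq3
  set q4 : ℝ × ℝ → ℝ := fun p => c 0 4 * p.1 ^ 4 + c 0 3 * (p.1 ^ 3 * p.2)
    + c 0 2 * (p.1 ^ 2 * p.2 ^ 2) + c 0 1 * (p.1 * p.2 ^ 3) + c 0 0 * p.2 ^ 4 with hq4
  have hf : ∀ x y z, F (x • u + y • v + z • w)
      = x ^ 2 * q2 (y, z) + x * q3 (y, z) + q4 (y, z) := fun x y z => by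
    rw [hc]
    simp only [ternaryQuartic, h40, h31, h30, hq2, hq3, hq4]
    ring
  have hquad : ∀ p, 0 ≤ q2 p ∧ q3 p ^ 2 ≤ 4 * q2 p * q4 p := fun p =>
    nonneg_and_sq_le_of_forall_quadratic_nonneg fun x => by
      have := hf x p.1 p.2 ▸ hpos _
      linarith
  by_cases h2 : ∃ p, p ≠ 0 ∧ q2 p = 0
  · obtain ⟨p, hp, hp2⟩ := h2
    refine Or.inl (hF.dominatesQuadraticSq_of_affine hpos hne
      (linearIndependent_pair_of_vec_three h (x := 0) hp) ⟨q3 p, q4 p, fun t => ?_⟩)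
    have := hf t p.1 p.2
    rw [hp2] at this
    rw [zero_smul, zero_add, ← add_assoc, this]
    ring
  push Not at h2
  have h2pos : ∀ p, p ≠ 0 → 0 < q2 p := fun p hp => lt_of_le_of_ne (hquad p).1 (h2 p hp).symm
  by_cases hD : ∃ p, p ≠ 0 ∧ 4 * q2 p * q4 p - q3 p ^ 2 ≤ 0
  · obtain ⟨p, hp, hpD⟩ := hD
    refine Or.inr ⟨(-q3 p / (2 * q2 p)) • u + p.1 • v + p.2 • w,
      linearIndependent_pair_of_vec_three h hp, le_antisymm ?_ (hpos _)⟩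
    rw [hf]
    have h3 := h2pos p hp
    have : (-q3 p / (2 * q2 p)) ^ 2 * q2 p + (-q3 p / (2 * q2 p)) * q3 p + q4 p
        = (4 * q2 p * q4 p - q3 p ^ 2) / (4 * q2 p) := by
      field_simp
      ring
    rw [this]
    exact div_nonpos_of_nonpos_of_nonneg hpD (by linarith)
  · push Not at hD
    obtain ⟨ε, hε, hle⟩ := exists_mul_le_of_homogeneous (E := ℝ × ℝ) (k := 6) (by norm_num)
      (f := fun p => 4 * q2 p * q4 p - q3 p ^ 2) (g := fun p => q2 p ^ 3)
      (by simp only [hq2, hq3, hq4]; fun_prop) (by simp only [hq2]; fun_prop)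
      (fun t p => by simp [hq2, hq3, hq4]; ring) (fun t p => by simp [hq2]; ring) hD
    refine Or.inl (DominatesQuadraticSqCoord.dominatesQuadraticSq h ?_)
    have hs := Real.sqrt_pos.2 hε
    have hs2 := Real.sq_sqrt hε.le
    set s := √ε
    refine ⟨0, s / 2 * c 2 2, s / 2 * c 2 0, 0, 0, s / 2 * c 2 1, ⟨0, 1, 0, ?_⟩, fun x y z => ?_⟩
    · have := h2pos (1, 0) (by simp)
      simp only [hq2] at this
      norm_num at this ⊢
      exact ⟨hs.ne', this.ne'⟩
    · have hq : (0 * x ^ 2 + s / 2 * c 2 2 * y ^ 2 + s / 2 * c 2 0 * z ^ 2 + 0 * (x * y)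
          + 0 * (x * z) + s / 2 * c 2 1 * (y * z)) ^ 2 = ε / 4 * q2 (y, z) ^ 2 := by
        rw [← hs2]
        simp only [hq2]
        ring
      rw [hq]
      beta_reduce
      by_cases hyz : (y, z) = 0
      · have : q2 (y, z) = 0 := by rw [hyz]; simp [hq2]
        rw [this]
        simpa using hpos _
      · have h3 := h2pos _ hyz
        have h4 := hle (y, z)
        rw [hf]
        refine le_of_mul_le_mul_left ?_ h3
        nlinarith [sq_nonneg (2 * q2 (y, z) * x + q3 (y, z))]

theorem IsTernaryQuartic.dominatesQuadraticSq_or_exists_third_zero {F : (Fin 3 → ℝ) → ℝ}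
    (hF : IsTernaryQuartic F) (hpos : ∀ v, 0 ≤ F v) (hne : ∃ v, F v ≠ 0) {u v : Fin 3 → ℝ}
    (huv : LinearIndependent ℝ ![u, v]) (hFu : F u = 0) (hFv : F v = 0) :
    DominatesQuadraticSq F ∨ ∃ w, LinearIndependent ℝ ![u, v, w] ∧ F w = 0 := by
  obtain ⟨w, h⟩ := exists_linearIndependent_vec_three huv
  obtain ⟨c, hc⟩ := hF u v w
  have hc0 : ∀ x y z, 0 ≤ ternaryQuartic c x y z := fun x y z => hc x y z ▸ hpos _
  have h40 : c 4 0 = 0 := by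
    have := hc 1 0 0
    simpa [hFu, ternaryQuartic] using this.symm
  have h04 : c 0 4 = 0 := by
    have := hc 0 1 0
    simpa [hFv, ternaryQuartic] using this.symm
  have h31 : c 3 1 = 0 := eq_zero_of_forall_cubic_nonneg (b := c 2 2) (c := c 1 3) (d := c 0 4)
    fun x => by
      have := hc0 x 1 0
      simp only [ternaryQuartic, h40] at this
      linarith
  have h30 : c 3 0 = 0 := eq_zero_of_forall_cubic_nonneg (b := c 2 0) (c := c 1 0) (d := c 0 0)
    fun x => by
      have := hc0 x 0 1
      simp only [ternaryQuartic, h40] at this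
      linarith
  have h13 : c 1 3 = 0 := eq_zero_of_forall_cubic_nonneg (b := c 2 2) (c := c 3 1) (d := c 4 0)
    fun y => by
      have := hc0 1 y 0
      simp only [ternaryQuartic, h04] at this
      linarith
  have h03 : c 0 3 = 0 := eq_zero_of_forall_cubic_nonneg (b := c 0 2) (c := c 0 1) (d := c 0 0)
    fun y => by
      have := hc0 0 y 1
      simp only [ternaryQuartic, h04] at this
      linarith
  set q2 : ℝ × ℝ → ℝ := fun p => c 2 2 * p.1 ^ 2 + c 2 1 * (p.1 * p.2) + c 2 0 * p.2 ^ 2 with hq2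
  set p2 : ℝ × ℝ → ℝ := fun p => c 2 2 * p.1 ^ 2 + c 1 2 * (p.1 * p.2) + c 0 2 * p.2 ^ 2 with hp2
  set b : ℝ × ℝ → ℝ := fun p => c 1 2 * p.1 ^ 2 + c 1 1 * (p.1 * p.2) + c 1 0 * p.2 ^ 2 with hb
  set e : ℝ × ℝ → ℝ := fun p => c 0 2 * p.1 ^ 2 + c 0 1 * (p.1 * p.2) + c 0 0 * p.2 ^ 2 with he
  have hf : ∀ x y z, F (x • u + y • v + z • w)
      = x ^ 2 * q2 (y, z) + x * (z * b (y, z)) + z ^ 2 * e (y, z) := fun x y z => by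
    rw [hc]
    simp only [ternaryQuartic, h40, h31, h30, h04, h13, h03, hq2, hb, he]
    ring
  have hf' : ∀ x y z, F (x • u + y • v + z • w) = y ^ 2 * p2 (x, z)
      + y * (c 2 1 * x ^ 2 * z + c 1 1 * x * z ^ 2 + c 0 1 * z ^ 3)
      + (c 2 0 * x ^ 2 * z ^ 2 + c 1 0 * x * z ^ 3 + c 0 0 * z ^ 4) := fun x y z => by
    rw [hc]
    simp only [ternaryQuartic, h40, h31, h30, h04, h13, h03, hp2]
    ring
  have hq2n : ∀ p, 0 ≤ q2 p := fun p => (nonneg_and_sq_le_of_forall_quadratic_nonneg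
    (b := p.2 * b p) (c := p.2 ^ 2 * e p) fun x => by
      have := hf x p.1 p.2 ▸ hpos _
      linarith).1
  have hp2n : ∀ p, 0 ≤ p2 p := fun p => (nonneg_and_sq_le_of_forall_quadratic_nonneg
    (b := c 2 1 * p.1 ^ 2 * p.2 + c 1 1 * p.1 * p.2 ^ 2 + c 0 1 * p.2 ^ 3)
    (c := c 2 0 * p.1 ^ 2 * p.2 ^ 2 + c 1 0 * p.1 * p.2 ^ 3 + c 0 0 * p.2 ^ 4) fun y => by
      have := hf' p.1 y p.2 ▸ hpos _
      linarith).1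
  by_cases h2 : ∃ p, p ≠ 0 ∧ q2 p = 0
  · obtain ⟨p, hp, hpq⟩ := h2
    refine Or.inl (hF.dominatesQuadraticSq_of_affine hpos hne
      (linearIndependent_pair_of_vec_three h (x := 0) hp) ⟨p.2 * b p, p.2 ^ 2 * e p, fun t => ?_⟩)
    have := hf t p.1 p.2
    rw [hpq] at this
    rw [zero_smul, zero_add, ← add_assoc, this]
    ring
  by_cases h2' : ∃ p, p ≠ 0 ∧ p2 p = 0
  · obtain ⟨p, hp, hpq⟩ := h2'
    have hv : LinearIndependent ℝ ![v, u, w] := linearIndependent_vec_three_iff.2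
      fun r s t hrst => by
        obtain ⟨h1, h2, h3⟩ := linearIndependent_vec_three_iff.1 h s r t (by rw [← hrst]; abel)
        exact ⟨h2, h1, h3⟩
    refine Or.inl (hF.dominatesQuadraticSq_of_affine hpos hne
      (linearIndependent_pair_of_vec_three hv (x := 0) hp)
      ⟨c 2 1 * p.1 ^ 2 * p.2 + c 1 1 * p.1 * p.2 ^ 2 + c 0 1 * p.2 ^ 3,
        c 2 0 * p.1 ^ 2 * p.2 ^ 2 + c 1 0 * p.1 * p.2 ^ 3 + c 0 0 * p.2 ^ 4, fun t => ?_⟩)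
    have := hf' p.1 t p.2
    rw [hpq, add_comm (p.1 • u)] at this
    rw [zero_smul, zero_add, ← add_assoc, this]
    ring
  push Not at h2 h2'
  have h2pos : ∀ p, p ≠ 0 → 0 < q2 p := fun p hp => lt_of_le_of_ne (hq2n p) (h2 p hp).symm
  have ha : 0 < c 2 2 := by
    have := h2pos (1, 0) (by simp)
    simpa [hq2] using this
  have hdisc : 0 < 4 * c 2 2 * c 0 2 - c 1 2 ^ 2 := by
    have h3 : 0 < p2 (-c 1 2, 2 * c 2 2) :=
      lt_of_le_of_ne (hp2n _) (h2' _ fun h => by simpa [ha.ne'] using congrArg Prod.snd h).symm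
    have h4 : p2 (-c 1 2, 2 * c 2 2) = c 2 2 * (4 * c 2 2 * c 0 2 - c 1 2 ^ 2) := by
      simp only [hp2]
      ring
    rw [h4] at h3
    exact pos_of_mul_pos_right h3 ha.le
  by_cases hD : ∃ p, p ≠ 0 ∧ 4 * q2 p * e p - b p ^ 2 ≤ 0
  · obtain ⟨p, hp, hpD⟩ := hD
    have hz : p.2 ≠ 0 := fun hz => by
      have h3 : 4 * q2 p * e p - b p ^ 2 = (4 * c 2 2 * c 0 2 - c 1 2 ^ 2) * p.1 ^ 4 := by
        simp only [hq2, he, hb, hz]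
        ring
      have h4 : p.1 ≠ 0 := fun h4 => hp (Prod.ext h4 hz)
      have : 0 < (4 * c 2 2 * c 0 2 - c 1 2 ^ 2) * p.1 ^ 4 := by positivity
      linarith
    refine Or.inr ⟨(-(p.2 * b p) / (2 * q2 p)) • u + p.1 • v + p.2 • w,
      linearIndependent_vec_three_iff.2 fun r s t hrst => ?_, le_antisymm ?_ (hpos _)⟩
    · obtain ⟨h3, h4, h5⟩ := linearIndependent_vec_three_iff.1 h
        (r + t * (-(p.2 * b p) / (2 * q2 p))) (s + t * p.1) (t * p.2) (by
          rw [← hrst]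
          module)
      have ht : t = 0 := (mul_eq_zero.1 h5).resolve_right hz
      rw [ht, zero_mul, add_zero] at h3 h4
      exact ⟨h3, h4, ht⟩
    · rw [hf]
      have h3 := h2pos p hp
      have : (-(p.2 * b p) / (2 * q2 p)) ^ 2 * q2 p + (-(p.2 * b p) / (2 * q2 p)) * (p.2 * b p)
          + p.2 ^ 2 * e p = p.2 ^ 2 * (4 * q2 p * e p - b p ^ 2) / (4 * q2 p) := by
        field_simp
        ring
      rw [this]
      exact div_nonpos_of_nonpos_of_nonneg (mul_nonpos_of_nonneg_of_nonpos (sq_nonneg _) hpD)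
        (by linarith)
  · push Not at hD
    obtain ⟨ε, hε, hle⟩ := exists_mul_le_of_homogeneous (E := ℝ × ℝ) (k := 4) (by norm_num)
      (f := fun p => 4 * q2 p * e p - b p ^ 2) (g := fun p => q2 p * p.2 ^ 2)
      (by simp only [hq2, hb, he]; fun_prop) (by simp only [hq2]; fun_prop)
      (fun t p => by simp [hq2, hb, he]; ring) (fun t p => by simp [hq2]; ring) hD
    refine Or.inl (DominatesQuadraticSqCoord.dominatesQuadraticSq h ?_)
    have hs := Real.sqrt_pos.2 hε
    have hs2 := Real.sq_sqrt hε.le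
    set s := √ε
    refine ⟨0, 0, s / 2, 0, 0, 0, ⟨0, 0, 1, by simpa using hs.ne'⟩, fun x y z => ?_⟩
    have hq : (0 * x ^ 2 + 0 * y ^ 2 + s / 2 * z ^ 2 + 0 * (x * y)
        + 0 * (x * z) + 0 * (y * z)) ^ 2 = ε / 4 * z ^ 4 := by
      rw [← hs2]
      ring
    rw [hq]
    beta_reduce
    by_cases hyz : (y, z) = 0
    · rw [show z = 0 from congrArg Prod.snd hyz]
      simpa using hpos _
    · have h3 := h2pos _ hyz
      have h4 := mul_le_mul_of_nonneg_left (hle (y, z)) (sq_nonneg z)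
      rw [hf]
      refine le_of_mul_le_mul_left ?_ h3
      nlinarith [sq_nonneg (2 * q2 (y, z) * x + z * b (y, z))]

theorem IsTernaryQuartic.dominatesQuadraticSq_of_three_zeros {F : (Fin 3 → ℝ) → ℝ}
    (hF : IsTernaryQuartic F) (hpos : ∀ v, 0 ≤ F v) (hne : ∃ v, F v ≠ 0) {u v w : Fin 3 → ℝ}
    (h : LinearIndependent ℝ ![u, v, w]) (hFu : F u = 0) (hFv : F v = 0) (hFw : F w = 0) :
    DominatesQuadraticSq F := by
  obtain ⟨c, hc⟩ := hF u v w
  have hc0 : ∀ x y z, 0 ≤ ternaryQuartic c x y z := fun x y z => hc x y z ▸ hpos _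
  have h40 : c 4 0 = 0 := by
    have := hc 1 0 0
    simpa [hFu, ternaryQuartic] using this.symm
  have h04 : c 0 4 = 0 := by
    have := hc 0 1 0
    simpa [hFv, ternaryQuartic] using this.symm
  have h00 : c 0 0 = 0 := by
    have := hc 0 0 1
    simpa [hFw, ternaryQuartic] using this.symm
  have h31 : c 3 1 = 0 := eq_zero_of_forall_cubic_nonneg (b := c 2 2) (c := c 1 3) (d := c 0 4)
    fun x => by
      have := hc0 x 1 0
      simp only [ternaryQuartic, h40] at this
      linarith
  have h30 : c 3 0 = 0 := eq_zero_of_forall_cubic_nonneg (b := c 2 0) (c := c 1 0) (d := c 0 0)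
    fun x => by
      have := hc0 x 0 1
      simp only [ternaryQuartic, h40] at this
      linarith
  have h13 : c 1 3 = 0 := eq_zero_of_forall_cubic_nonneg (b := c 2 2) (c := c 3 1) (d := c 4 0)
    fun y => by
      have := hc0 1 y 0
      simp only [ternaryQuartic, h04] at this
      linarith
  have h03 : c 0 3 = 0 := eq_zero_of_forall_cubic_nonneg (b := c 0 2) (c := c 0 1) (d := c 0 0)
    fun y => by
      have := hc0 0 y 1
      simp only [ternaryQuartic, h04] at this
      linarith
  have h10 : c 1 0 = 0 := eq_zero_of_forall_cubic_nonneg (b := c 2 0) (c := c 3 0) (d := c 4 0)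
    fun z => by
      have := hc0 1 0 z
      simp only [ternaryQuartic, h00] at this
      linarith
  have h01 : c 0 1 = 0 := eq_zero_of_forall_cubic_nonneg (b := c 0 2) (c := c 0 3) (d := c 0 4)
    fun z => by
      have := hc0 0 1 z
      simp only [ternaryQuartic, h00] at this
      linarith
  have hf : ∀ x y z, F (x • u + y • v + z • w)
      = (c 2 0 * x ^ 2 + c 1 1 * (x * y) + c 0 2 * y ^ 2) * z ^ 2
        + x * y * (c 2 1 * x + c 1 2 * y) * z + c 2 2 * (x * y) ^ 2 := fun x y z => by
    rw [hc]
    simp only [ternaryQuartic, h40, h31, h30, h04, h13, h03, h00, h10, h01]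
    ring
  have hz : ∀ x y, 0 ≤ c 2 0 * x ^ 2 + c 1 1 * (x * y) + c 0 2 * y ^ 2 ∧
      (x * y * (c 2 1 * x + c 1 2 * y)) ^ 2
        ≤ 4 * (c 2 0 * x ^ 2 + c 1 1 * (x * y) + c 0 2 * y ^ 2) * (c 2 2 * (x * y) ^ 2) :=
    fun x y => nonneg_and_sq_le_of_forall_quadratic_nonneg fun z => hf x y z ▸ hpos _
  have hxq : 0 ≤ c 2 2 ∧ c 2 1 ^ 2 ≤ 4 * c 2 2 * c 2 0 :=
    nonneg_and_sq_le_of_forall_quadratic_nonneg fun t => by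
      refine (nonneg_and_sq_le_of_forall_quadratic_nonneg (b := c 1 2 * t ^ 2 + c 1 1 * t)
        (c := c 0 2 * t ^ 2) fun x => ?_).1
      have := hf x t 1 ▸ hpos _
      linarith
  have hyq : 0 ≤ c 2 2 ∧ c 1 2 ^ 2 ≤ 4 * c 2 2 * c 0 2 :=
    nonneg_and_sq_le_of_forall_quadratic_nonneg fun t => by
      refine (nonneg_and_sq_le_of_forall_quadratic_nonneg (b := c 2 1 * t ^ 2 + c 1 1 * t)
        (c := c 2 0 * t ^ 2) fun y => ?_).1
      have := hf t y 1 ▸ hpos _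
      linarith
  rcases hxq.1.eq_or_lt with ha | ha
  · have huv : LinearIndependent ℝ ![u, v] := by
      simpa using linearIndependent_pair_of_vec_three h (x := 0) (y := 1) (z := 0) (by simp)
    refine hF.dominatesQuadraticSq_of_affine hpos hne huv ⟨0, 0, fun t => ?_⟩
    have := hf t 1 0
    simp only [← ha, one_smul, zero_smul, add_zero] at this
    rw [this]
    ring
  · have hbr : ∀ x y, (c 2 1 * x + c 1 2 * y) ^ 2
        ≤ 4 * c 2 2 * (c 2 0 * x ^ 2 + c 1 1 * (x * y) + c 0 2 * y ^ 2) := fun x y => by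
      by_cases hxy : x * y = 0
      · rcases mul_eq_zero.1 hxy with h0 | h0 <;> rw [h0]
        · nlinarith [mul_le_mul_of_nonneg_right hyq.2 (sq_nonneg y)]
        · nlinarith [mul_le_mul_of_nonneg_right hxq.2 (sq_nonneg x)]
      · have h1 := (hz x y).2
        have h2 : 0 < (x * y) ^ 2 := by positivity
        refine le_of_mul_le_mul_left ?_ h2
        linarith
    refine DominatesQuadraticSqCoord.dominatesQuadraticSq h ?_
    have hs := Real.sqrt_pos.2 ha
    have hs2 := Real.sq_sqrt ha.le
    set s := √(c 2 2)
    refine ⟨0, 0, 0, s, c 2 1 / (2 * s), c 1 2 / (2 * s), ⟨1, 1, 0, by simpa using hs.ne'⟩,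
      fun x y z => ?_⟩
    beta_reduce
    rw [hf]
    have h1 : ((c 2 1 * x + c 1 2 * y) / (2 * s)) ^ 2
        ≤ c 2 0 * x ^ 2 + c 1 1 * (x * y) + c 0 2 * y ^ 2 := by
      rw [div_pow, div_le_iff₀ (by positivity), mul_pow, hs2]
      linarith [hbr x y]
    calc _ = ((c 2 1 * x + c 1 2 * y) / (2 * s)) ^ 2 * z ^ 2
          + x * y * (c 2 1 * x + c 1 2 * y) * z + s ^ 2 * (x * y) ^ 2 := by
          field_simp
          ring
      _ ≤ _ := by
          rw [hs2]
          linarith [mul_le_mul_of_nonneg_right h1 (sq_nonneg z)]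

theorem IsTernaryQuartic.dominatesQuadraticSq {F : (Fin 3 → ℝ) → ℝ}
    (hF : IsTernaryQuartic F) (hpos : ∀ v, 0 ≤ F v) (hne : ∃ v, F v ≠ 0) :
    DominatesQuadraticSq F := by
  by_cases h0 : ∃ u, u ≠ 0 ∧ F u = 0
  · obtain ⟨u, hu, hFu⟩ := h0
    rcases hF.dominatesQuadraticSq_or_exists_zero hpos hne hu hFu with h | ⟨v, huv, hFv⟩
    · exact h
    rcases hF.dominatesQuadraticSq_or_exists_third_zero hpos hne huv hFu hFv with h | ⟨w, h, hFw⟩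
    · exact h
    exact hF.dominatesQuadraticSq_of_three_zeros hpos hne h hFu hFv hFw
  push Not at h0
  obtain ⟨u, hu⟩ := exists_ne (0 : Fin 3 → ℝ)
  obtain ⟨v, huv⟩ := exists_linearIndependent_vec_two hu
  obtain ⟨w, h⟩ := exists_linearIndependent_vec_three huv
  obtain ⟨c, hc⟩ := hF u v w
  obtain ⟨ε, hε, hle⟩ := exists_mul_le_of_homogeneous (E := ℝ × ℝ × ℝ) (k := 4) (by norm_num)
    (f := fun p => ternaryQuartic c p.1 p.2.1 p.2.2)
    (g := fun p => (p.1 ^ 2 + p.2.1 ^ 2 + p.2.2 ^ 2) ^ 2)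
    (by simp only [ternaryQuartic]; fun_prop) (by fun_prop)
    (fun t p => by simp [ternaryQuartic]; ring) (fun t p => by simp; ring) (fun p hp => by
      rw [← hc]
      refine lt_of_le_of_ne (hpos _) (h0 _ fun hz => hp ?_).symm
      obtain ⟨h1, h2, h3⟩ := linearIndependent_vec_three_iff.1 h _ _ _ hz
      exact Prod.ext h1 (Prod.ext h2 h3))
  refine DominatesQuadraticSqCoord.dominatesQuadraticSq h ?_
  have hs := Real.sqrt_pos.2 hε
  have hs2 := Real.sq_sqrt hε.le
  set s := √ε
  refine ⟨s, s, s, 0, 0, 0, ⟨1, 0, 0, by simpa using hs.ne'⟩, fun x y z => ?_⟩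
  beta_reduce
  rw [hc]
  refine le_trans (le_of_eq ?_) (hle (x, y, z))
  rw [← hs2]
  ring

theorem MvPolynomial.exists_isHomogeneous_four_eval {p : MvPolynomial (Fin 2) ℝ}
    (hp : p.totalDegree ≤ 4) :
    ∃ P : MvPolynomial (Fin 3) ℝ, P.IsHomogeneous 4 ∧
      ∀ x y, MvPolynomial.eval ![x, y, 1] P = MvPolynomial.eval ![x, y] p := by
  refine ⟨∑ a ∈ p.support, MvPolynomial.monomial (expo ![a 0, a 1, 4 - a 0 - a 1])
    (p.coeff a), MvPolynomial.IsHomogeneous.sum _ _ _ fun a ha => ?_, fun x y => ?_⟩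
  · have h := (MvPolynomial.le_totalDegree ha).trans hp
    rw [Finsupp.sum_fintype _ _ (by simp), Fin.sum_univ_two] at h
    refine MvPolynomial.isHomogeneous_monomial _ ?_
    rw [Finsupp.degree_eq_sum, Fin.sum_univ_three]
    simp only [expo_apply, Matrix.cons_val]
    omega
  · rw [map_sum, MvPolynomial.eval_eq']
    refine Finset.sum_congr rfl fun a _ => ?_
    rw [MvPolynomial.eval_monomial_expo]
    simp [Fin.prod_univ_three]

theorem MvPolynomial.IsHomogeneous.eval_vec_three {P : MvPolynomial (Fin 3) ℝ} {k : ℕ}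
    (hP : P.IsHomogeneous k) {z : ℝ} (hz : z ≠ 0) (x y : ℝ) :
    MvPolynomial.eval ![x, y, z] P = z ^ k * MvPolynomial.eval ![x / z, y / z, 1] P := by
  rw [← hP.eval_smul]
  simp [mul_div_cancel₀ _ hz]

theorem MvPolynomial.IsHomogeneous.exists_eval_vec_ne_zero {P : MvPolynomial (Fin 3) ℝ} {k : ℕ}
    (hP : P.IsHomogeneous k) (h0 : P ≠ 0) : ∃ x y, MvPolynomial.eval ![x, y, 1] P ≠ 0 := by
  by_contra! h
  refine mul_ne_zero h0 (MvPolynomial.X_ne_zero (2 : Fin 3)) (MvPolynomial.funext fun v => ?_)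
  by_cases hz : v 2 = 0
  · simp [hz]
  · have hv : v = ![v 0, v 1, v 2] := by ext i; fin_cases i <;> rfl
    rw [map_mul, hv, hP.eval_vec_three hz, h]
    simp

theorem dominatesSquare_two_two : DominatesSquare 2 2 := by
  intro p hp h0
  have hvec : ∀ x : Fin 2 → ℝ, x = ![x 0, x 1] := fun x => by ext i; fin_cases i <;> rfl
  obtain ⟨P, hP, hPp⟩ := MvPolynomial.exists_isHomogeneous_four_eval (p := p) hp.1
  have hne : ∀ v : Fin 3 → ℝ, v 2 ≠ 0 → 0 ≤ MvPolynomial.eval v P := fun v hv => by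
    have hv' : v = ![v 0, v 1, v 2] := by ext i; fin_cases i <;> rfl
    rw [hv', hP.eval_vec_three hv, hPp]
    exact mul_nonneg (by positivity) (hp.2 _ (Set.mem_univ _))
  have hpos : ∀ v : Fin 3 → ℝ, 0 ≤ MvPolynomial.eval v P := fun v => by
    have hcont : Continuous fun z : ℝ => MvPolynomial.eval (Function.update v 2 z) P :=
      (MvPolynomial.continuous_eval P).comp (continuous_const.update 2 continuous_id)
    by_cases hv : v 2 = 0
    · have := hcont.nonneg_of_forall_ne (a := v 2) fun z hz => hne _ (by simpa using hv ▸ hz)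
      simpa using this
    · exact hne v hv
  obtain ⟨x, hx⟩ : ∃ x, MvPolynomial.eval x p ≠ 0 := by
    by_contra! h
    exact h0 (MvPolynomial.funext fun x => by simp [h x])
  obtain ⟨g, hg, hg0, hgP⟩ := hP.isTernaryQuartic.dominatesQuadraticSq hpos
    ⟨![x 0, x 1, 1], by rwa [hPp, ← hvec]⟩
  have heval : ∀ y : Fin 2 → ℝ, MvPolynomial.eval y (MvPolynomial.aeval
      (![MvPolynomial.X 0, MvPolynomial.X 1, 1] : Fin 3 → MvPolynomial (Fin 2) ℝ) g)
      = MvPolynomial.eval ![y 0, y 1, 1] g := fun y => by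
    rw [← MvPolynomial.coe_aeval_eq_eval, ← MvPolynomial.coe_aeval_eq_eval, RingHom.coe_coe,
      RingHom.coe_coe, ← AlgHom.comp_apply, MvPolynomial.comp_aeval]
    congr 2
    ext i
    fin_cases i <;> simp
  refine ⟨_, fun h => ?_, (MvPolynomial.totalDegree_aeval_le_of_le_one
    ![MvPolynomial.X 0, MvPolynomial.X 1, 1] (fun i => ?_) g).trans hg.totalDegree_le,
    fun y => ?_⟩
  · obtain ⟨a, b, hab⟩ := hg.exists_eval_vec_ne_zero hg0
    exact hab ((heval ![a, b]).symm.trans (by rw [h, map_zero]))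
  · fin_cases i <;> simp
  · rw [heval, hvec y, ← hPp]
    exact hgP _

theorem sxdeg_eq_and_sxc_eq_of_dominatesSquare {n d : ℕ} (h : DominatesSquare n d) :
    sxdeg (PosCone n d Set.univ) = (Nat.choose (n + d) n : ℕ∞) ∧
      sxc (PosCone n d Set.univ) = (Nat.choose (n + d) n : ℕ∞) := by
  constructor
  · refine le_antisymm (sInf_le ⟨_, 1, rfl, h.hasLift.psdTuple_one⟩) (le_sInf ?_)
    rintro _ ⟨k, m, rfl, hk⟩
    exact_mod_cast choose_le_of_hasLift hk
  · refine le_antisymm (sInf_le ⟨_, rfl, h.hasLift⟩) (le_sInf ?_)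
    rintro _ ⟨k, rfl, hk⟩
    exact_mod_cast choose_le_of_hasLift hk.psdTuple_one

/-- Corollary 2.9: if `n,d ≥ 2` and `(n,d) ≠ (2,2)` then `P_{n,2d}` has no semidefinite
extended formulation at all; otherwise `sxdeg(P_{n,2d}) = sxc(P_{n,2d}) = C(n+d,n)`. -/
theorem stmt_5 (n d : ℕ) (hn : 1 ≤ n) (hd : 1 ≤ d) :
    ((2 ≤ n ∧ 2 ≤ d ∧ (n, d) ≠ (2, 2)) →
      (∀ k m : ℕ, ¬ HasLift (PSDTuple k m) (PosCone n d Set.univ)) ∧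
      sxdeg (PosCone n d Set.univ) = ⊤ ∧ sxc (PosCone n d Set.univ) = ⊤) ∧
    (¬ (2 ≤ n ∧ 2 ≤ d ∧ (n, d) ≠ (2, 2)) →
      sxdeg (PosCone n d Set.univ) = (Nat.choose (n + d) n : ℕ∞) ∧
      sxc (PosCone n d Set.univ) = (Nat.choose (n + d) n : ℕ∞)) := by
  refine ⟨fun ⟨hn2, hd2, hnd⟩ => ?_, fun h => sxdeg_eq_and_sxc_eq_of_dominatesSquare ?_⟩
  · have hno := not_hasLift_posCone hn2 hd2 hnd
    refine ⟨hno, top_le_iff.1 (le_sInf ?_), top_le_iff.1 (le_sInf ?_)⟩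
    · rintro _ ⟨k, m, -, hk⟩
      exact (hno k m hk).elim
    · rintro _ ⟨k, -, hk⟩
      exact (hno k 1 hk.psdTuple_one).elim
  · by_cases h1 : n = 1
    · exact h1 ▸ dominatesSquare_one_left d
    by_cases h2 : d = 1
    · exact h2 ▸ dominatesSquare_one_right n
    have h22 : (n, d) = (2, 2) := by
      by_contra hne
      exact h ⟨by omega, by omega, hne⟩
    obtain ⟨rfl, rfl⟩ := Prod.mk.inj h22
    exact dominatesSquare_two_two
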